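/- arXiv:1909.01510 — 5 statements merged into one kernel-verified Lean document; each statement's English description precedes it below -/
import Mathlib

section
/- Let j ≥ 0 be an integer and m1, m4 integers with |m1| ≤ j and |m4| ≤ j. If m1 − m4 is odd, then S^j_{m1,m4}(z) = 0 for every z ∈ ℂ with Re z > 1/2. If m1 − m4 is even, then for every z ∈ ℂ with Re z > j + 1/2, S^j_{m1,m4}(z) = ((−1)^{(m1+m4)/2} · (2j)! · π / (c^j_{m1} · c^j_{m4})) · Γ(z + (m4−m1−1)/2) / ( Γ((1−2j−m1+m4)/2) · Γ(j+z) ) · ₃F₂(z−j−1, −j−m1, −j+m4; −2j, (1−2j−m1+m4)/2; 1). -/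
namespace Stmt1

noncomputable section

/-- Pochhammer symbol `(a)^{(k)} = a(a+1)⋯(a+k−1)` with natural exponent. -/
def pochN (a : ℂ) (k : ℕ) : ℂ := ∏ i ∈ Finset.range k, (a + i)

/-- Pochhammer symbol with complex exponent, `(a)^{(w)} = Γ(a+w)/Γ(a)`. -/
def pochC (a w : ℂ) : ℂ := Complex.Gamma (a + w) / Complex.Gamma a

/-- Generalized binomial coefficient `C(w,k) = w(w−1)⋯(w−k+1)/k!`. -/
def genBinom (w : ℂ) (k : ℕ) : ℂ := (∏ i ∈ Finset.range k, (w - i)) / (Nat.factorial k : ℂ)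

/-- Jacobi polynomial `P^{(α,β)}_n(x)`. -/
def jacobiP (n : ℕ) (α β x : ℂ) : ℂ :=
  ∑ s ∈ Finset.range (n + 1),
    genBinom ((n : ℂ) + α) (n - s) * genBinom ((n : ℂ) + β) s *
      ((x - 1) / 2) ^ s * ((x + 1) / 2) ^ (n - s)

/-- `c^j_m = √((j+m)!(j−m)!)`. -/
def cc (j : ℕ) (m : ℤ) : ℂ :=
  (Real.sqrt ((Nat.factorial ((j : ℤ) + m).toNat) * (Nat.factorial ((j : ℤ) - m).toNat)) : ℝ)

/-- Truncation index of a terminating hypergeometric series: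
`min {k : ℕ | −k is among the numerator parameters}`. -/
def truncN (as : List ℂ) : ℕ := sInf {k : ℕ | (-(k : ℂ)) ∈ as}

/-- Terminating hypergeometric sum `ₚF_q(as; bs; x) = Σ_{k=0}^{N} (as)ₖ/(bs)ₖ · xᵏ/k!`,
where `N` is the smallest `k` such that `−k` is a numerator parameter. -/
def pFq (as bs : List ℂ) (x : ℂ) : ℂ :=
  ∑ k ∈ Finset.range (truncN as + 1),
    ((as.map fun a => pochN a k).prod / (bs.map fun b => pochN b k).prod) * x ^ k /
      (Nat.factorial k : ℂ)

/-- `Q(z,m) = π·2^{2−2z}·Γ(2z−1)/(Γ(z+m)·Γ(z−m))`. -/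
def Qf (z m : ℂ) : ℂ :=
  (Real.pi : ℂ) * (2 : ℂ) ^ ((2 : ℂ) - 2 * z) * Complex.Gamma (2 * z - 1) /
    (Complex.Gamma (z + m) * Complex.Gamma (z - m))

/-- Change-of-basis matrix entry `M^j_{m,m'}`. -/
def Mmat (j : ℕ) (m m' : ℤ) : ℂ :=
  (cc j m' / cc j m) * Complex.I ^ (m' - m) * (2 : ℂ) ^ (-m') *
    jacobiP ((j : ℤ) - m').toNat ((m' : ℂ) - m) ((m' : ℂ) + m) 0

/-- Change-of-basis matrix entry `N^j_{m,m'}`. -/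
def Nmat (j : ℕ) (m m' : ℤ) : ℂ :=
  (cc j m' / cc j m) * Complex.I ^ (m - m') * (2 : ℂ) ^ (-m') *
    jacobiP ((j : ℤ) - m').toNat ((m' : ℂ) - m) ((m' : ℂ) + m) 0

/-- Intertwining-operator matrix entry `S^j_{m,m'}(z) = Σ_k (−1)^k M^j_{m,k} N^j_{k,m'} Q(z,k)`. -/
def Smat (j : ℕ) (m m' : ℤ) (z : ℂ) : ℂ :=
  ∑ k ∈ Finset.Icc (-(j : ℤ)) (j : ℤ), (-1 : ℂ) ^ k * Mmat j m k * Nmat j k m' * Qf z (k : ℂ)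

open Polynomial in
/-- Krawtchouk-type coefficient of `(1+X)^a (1-X)^b`. -/
def Kc (a b i : ℕ) : ℂ := (((1 + X) ^ a * (1 - X) ^ b : ℂ[X])).coeff i

open Polynomial in
/-- The linear functional sending `X^i` to `Q(z, i-d)`. -/
def Lf (z d : ℂ) : ℂ[X] →ₗ[ℂ] ℂ :=
  Polynomial.lsum (fun i => LinearMap.toSpanSingleton ℂ ℂ (Qf z ((i : ℂ) - d)))

open Polynomial in
lemma Lf_monomial (z d : ℂ) (i : ℕ) (a : ℂ) :
    Lf z d (monomial i a) = a * Qf z ((i : ℂ) - d) := by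
  simp [Lf, Polynomial.lsum, Polynomial.sum_monomial_index]

lemma Qf_rec (z m : ℂ) (hz : 1 / 2 < z.re) :
    Qf z (m + 1) + 2 * Qf z m + Qf z (m - 1) = 4 * Qf (z + 1) m := by
  have hz0 : z ≠ 0 := by
    intro h; rw [h] at hz; norm_num at hz
  have hz1 : 2 * z - 1 ≠ 0 := by
    intro h
    have h2 : (2 * z - 1).re = 0 := by rw [h]; simp
    simp at h2; linarith
  have hG : Complex.Gamma (2 * (z + 1) - 1) = (2 * z) * ((2 * z - 1) * Complex.Gamma (2 * z - 1)) := by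
    rw [← Complex.Gamma_add_one _ hz1]
    rw [show 2 * z - 1 + 1 = 2 * z by ring]
    rw [← Complex.Gamma_add_one _ (by simpa using hz0)]
    congr 1; ring
  have hp : (2 : ℂ) ^ ((2 : ℂ) - 2 * (z + 1)) = (2 : ℂ) ^ ((2 : ℂ) - 2 * z) / 4 := by
    rw [show (2 : ℂ) - 2 * (z + 1) = ((2 : ℂ) - 2 * z) - 2 by ring, Complex.cpow_sub _ _ (by norm_num)]
    norm_num
  have e := Complex.one_div_Gamma_eq_self_mul_one_div_Gamma_add_one
  have a1 := e (z + m)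
  have a2 := e (z + (m - 1))
  have b1 := e (z - m)
  have b2 := e (z - (m + 1))
  rw [show z + (m - 1) + 1 = z + m by ring] at a2
  rw [show z - (m + 1) + 1 = z - m by ring] at b2
  unfold Qf
  rw [hG, hp]
  simp only [div_eq_mul_inv, mul_inv]
  rw [show z + (m + 1) = z + m + 1 by ring, show z - (m - 1) = z - m + 1 by ring,
    show z + 1 + m = z + m + 1 by ring, show z + 1 - m = z - m + 1 by ring]
  rw [a2, b2, a1, b1]
  ring

open Polynomial in
lemma Lf_X (z d : ℂ) (p : ℂ[X]) : Lf z d (X * p) = Lf z (d - 1) p := by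
  induction p using Polynomial.induction_on' with
  | add p q hp hq => rw [mul_add, map_add, map_add, hp, hq]
  | monomial n a =>
    rw [X_mul_monomial, Lf_monomial, Lf_monomial]
    push_cast
    congr 2; ring

open Polynomial in
lemma Lf_sq (z d : ℂ) (hz : 1 / 2 < z.re) (p : ℂ[X]) :
    Lf z d ((1 + X) ^ 2 * p) = 4 * Lf (z + 1) (d - 1) p := by
  induction p using Polynomial.induction_on' with
  | add p q hp hq => rw [mul_add, map_add, map_add, hp, hq]; ring
  | monomial n a =>
    have : (1 + X : ℂ[X]) ^ 2 * monomial n a =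
        monomial n a + (2 : ℂ) • (X * monomial n a) + X * (X * monomial n a) := by
      rw [smul_eq_C_mul, show (C 2 : ℂ[X]) = 2 from rfl]; ring
    rw [this, map_add, map_add, map_smul, Lf_X, Lf_X, Lf_X, Lf_monomial, Lf_monomial, Lf_monomial,
      Lf_monomial]
    have := Qf_rec z ((n : ℂ) - (d - 1)) hz
    rw [show (n : ℂ) - (d - 1) - 1 = n - d by ring,
      show (n : ℂ) - (d - 1) + 1 = n - (d - 1 - 1) by ring] at this
    rw [smul_eq_mul]
    linear_combination a * this

open Polynomial in
lemma Lf_pow (a : ℕ) (z d : ℂ) (hz : 1 / 2 < z.re) (p : ℂ[X]) :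
    Lf z d ((1 + X) ^ (2 * a) * p) = 4 ^ a * Lf (z + a) (d - a) p := by
  induction a generalizing z d with
  | zero => simp
  | succ a ih =>
    rw [show (1 + X : ℂ[X]) ^ (2 * (a + 1)) * p = (1 + X) ^ 2 * ((1 + X) ^ (2 * a) * p) by ring,
      Lf_sq _ _ hz, ih _ _ (by simp; linarith)]
    push_cast
    rw [show z + 1 + (a : ℂ) = z + (a + 1) by ring, show d - 1 - (a : ℂ) = d - (a + 1) by ring]
    ring

lemma Qf_zero (z : ℂ) (hz : 1 / 2 < z.re) :
    Qf z 0 = Complex.Gamma (z - 1 / 2) * Complex.Gamma (1 / 2) / Complex.Gamma z := by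
  have h := Complex.Gamma_mul_Gamma_add_half (z - 1 / 2)
  rw [show z - 1 / 2 + 1 / 2 = z by ring, show 2 * (z - 1 / 2) = 2 * z - 1 by ring,
    show 1 - (2 * z - 1) = 2 - 2 * z by ring] at h
  have hG : Complex.Gamma z ≠ 0 := Complex.Gamma_ne_zero_of_re_pos (by linarith)
  have hs : ((√Real.pi : ℝ) : ℂ) * ((√Real.pi : ℝ) : ℂ) = (Real.pi : ℂ) := by
    rw [← Complex.ofReal_mul, Real.mul_self_sqrt Real.pi_pos.le]
  have hh : Complex.Gamma (1 / 2) = ((√Real.pi : ℝ) : ℂ) := by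
    have := Real.Gamma_one_half_eq
    rw [← this, ← Complex.Gamma_ofReal]; norm_num
  unfold Qf
  rw [add_zero, sub_zero, hh, ← hs, div_eq_div_iff (mul_ne_zero hG hG) hG]
  linear_combination -Complex.Gamma z * ((√Real.pi : ℝ) : ℂ) * h

open Polynomial in
lemma Lf_v (b : ℕ) (z : ℂ) (hz : 1 / 2 < z.re) :
    Lf z b ((X - 1) ^ (2 * b)) = 4 ^ b * (-1) ^ b *
      (Complex.Gamma (z - 1 / 2) * Complex.Gamma (b + 1 / 2) / Complex.Gamma (z + b)) := by
  induction b generalizing z with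
  | zero =>
    have : ((X : ℂ[X]) - 1) ^ (2 * 0) = monomial 0 1 := by simp
    rw [this, Lf_monomial]
    have := Qf_zero z hz
    simp at this ⊢
    rw [this]
  | succ b ih =>
    have : ((X : ℂ[X]) - 1) ^ (2 * (b + 1)) =
        (1 + X) ^ 2 * (X - 1) ^ (2 * b) - (4 : ℂ) • (X * (X - 1) ^ (2 * b)) := by
      rw [smul_eq_C_mul, show (C 4 : ℂ[X]) = 4 from rfl]; ring
    rw [this, map_sub, map_smul, Lf_sq _ _ hz, Lf_X]
    push_cast
    rw [show (b : ℂ) + 1 - 1 = b by ring, ih z hz, ih (z + 1) (by simp; linarith)]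
    have g1 : Complex.Gamma (z + 1 - 1 / 2) = (z - 1 / 2) * Complex.Gamma (z - 1 / 2) := by
      rw [← Complex.Gamma_add_one]
      · congr 1; ring
      · intro h
        have h2 : (z - 1 / 2).re = 0 := by rw [h]; simp
        simp at h2; norm_num at hz; linarith
    have hb : (b : ℂ) + 1 / 2 ≠ 0 := by
      intro h
      have h2 : ((b : ℂ) + 1 / 2).re = 0 := by rw [h]; simp
      simp at h2
      have : (0 : ℝ) ≤ b := Nat.cast_nonneg b
      linarith
    have g2 : Complex.Gamma ((b : ℂ) + 1 + 1 / 2) = (b + 1 / 2) * Complex.Gamma (b + 1 / 2) := by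
      rw [← Complex.Gamma_add_one _ hb]
      congr 1; ring
    have hzb : z + b ≠ 0 := by
      intro h
      have h2 : (z + b).re = 0 := by rw [h]; simp
      simp at h2
      have : (0 : ℝ) ≤ b := Nat.cast_nonneg b
      linarith
    have hG : Complex.Gamma (z + b) ≠ 0 := Complex.Gamma_ne_zero_of_re_pos (by
      simp
      have : (0 : ℝ) ≤ b := Nat.cast_nonneg b
      linarith)
    have g3 : Complex.Gamma (z + (b + 1)) = (z + b) * Complex.Gamma (z + b) := by
      rw [← Complex.Gamma_add_one _ hzb]
      congr 1; ring
    rw [show z + 1 + (b : ℂ) = z + (b + 1) by ring, g1, g2, g3, smul_eq_mul]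
    field_simp
    ring

open Polynomial in
lemma Lf_uv (a b c : ℕ) (z : ℂ) (hz : 1 / 2 < z.re) :
    Lf z (a + b + c) (X ^ c * ((1 + X) ^ (2 * a) * (X - 1) ^ (2 * b))) = 4 ^ (a + b) * (-1) ^ b *
      (Complex.Gamma (z + a - 1 / 2) * Complex.Gamma (b + 1 / 2) / Complex.Gamma (z + a + b)) := by
  induction c with
  | zero =>
    rw [pow_zero, one_mul, Lf_pow _ _ _ hz]
    have := Lf_v b (z + a) (by
      simp
      have : (0 : ℝ) ≤ a := Nat.cast_nonneg a
      norm_num at hz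
      linarith)
    rw [show (a : ℂ) + b + (0 : ℕ) - a = b by push_cast; ring, this]
    ring
  | succ c ih =>
    rw [pow_succ', mul_assoc, Lf_X]
    push_cast
    rw [show (a : ℂ) + b + (c + 1) - 1 = a + b + c by ring, ih]

/-! Polynomial identities -/

open Polynomial in
lemma homog_step (N : ℕ) (f U V : ℂ[X]) (c : ℂ) (hf : f.natDegree ≤ N) :
    ∑ i ∈ Finset.range (N + 2), C ((f * (1 + C c * X)).coeff i) * U ^ i * V ^ (N + 1 - i) =
      (∑ i ∈ Finset.range (N + 1), C (f.coeff i) * U ^ i * V ^ (N - i)) * (V + C c * U) := by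
  have hc : f * (1 + C c * X) = f + C c * f * X := by ring
  have h1 : ∑ i ∈ Finset.range (N + 2), C (f.coeff i) * U ^ i * V ^ (N + 1 - i) =
      (∑ i ∈ Finset.range (N + 1), C (f.coeff i) * U ^ i * V ^ (N - i)) * V := by
    rw [Finset.sum_range_succ, coeff_eq_zero_of_natDegree_lt (by omega)]
    simp only [map_zero, zero_mul, add_zero, Finset.sum_mul]
    refine Finset.sum_congr rfl fun i hi => ?_
    have : i ≤ N := by simpa [Nat.lt_succ_iff] using hi
    rw [show N + 1 - i = N - i + 1 by omega]; ring
  have h2 : ∑ i ∈ Finset.range (N + 2), C ((C c * f * X).coeff i) * U ^ i * V ^ (N + 1 - i) =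
      (∑ i ∈ Finset.range (N + 1), C (f.coeff i) * U ^ i * V ^ (N - i)) * (C c * U) := by
    rw [Finset.sum_range_succ']
    simp only [coeff_mul_X, coeff_C_mul, mul_coeff_zero, coeff_X_zero, mul_zero, map_zero, zero_mul, add_zero,
      Finset.sum_mul, map_mul]
    refine Finset.sum_congr rfl fun i hi => ?_
    rw [show N + 1 - (i + 1) = N - i by omega]; ring
  rw [hc]
  simp only [coeff_add, map_add, add_mul, Finset.sum_add_distrib]
  rw [h1, h2]; ring

open Polynomial in
lemma natDegree_K (a b : ℕ) : ((1 + X) ^ a * (1 - X) ^ b : ℂ[X]).natDegree ≤ a + b := by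
  compute_degree!

open Polynomial in
lemma homog_K (a b : ℕ) (U V : ℂ[X]) :
    ∑ i ∈ Finset.range (a + b + 1), C (Kc a b i) * U ^ i * V ^ (a + b - i) =
      (V + U) ^ a * (V - U) ^ b := by
  induction b with
  | zero =>
    induction a with
    | zero => simp [Kc]
    | succ a ih =>
      have := homog_step (a + 0) ((1 + X) ^ a * (1 - X) ^ 0) U V 1 (natDegree_K a 0)
      simp only [Kc] at ih ⊢
      rw [ih] at this
      rw [show (1 + X : ℂ[X]) ^ (a + 1) * (1 - X) ^ 0 = (1 + X) ^ a * (1 - X) ^ 0 * (1 + C 1 * X) by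
        rw [C_1]; ring]
      rw [show a + 1 + 0 = a + 0 + 1 by ring]
      rw [this, C_1]; ring
  | succ b ih =>
      have := homog_step (a + b) ((1 + X) ^ a * (1 - X) ^ b) U V (-1) (natDegree_K a b)
      simp only [Kc] at ih ⊢
      rw [ih] at this
      rw [show (1 + X : ℂ[X]) ^ a * (1 - X) ^ (b + 1) = (1 + X) ^ a * (1 - X) ^ b * (1 + C (-1) * X) by
        rw [C_neg, C_1]; ring]
      rw [show a + (b + 1) = a + b + 1 by ring]
      rw [this, C_neg, C_1]; ring

open Polynomial in
lemma lemA (q p n : ℕ) (w : ℂ) :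
    ∑ i ∈ Finset.range (q + p + 1), Kc q p i * Kc i (q + p - i) n * w ^ (q + p - i) =
      (((C (1 + w) - C (w - 1) * X) ^ q * (C (w - 1) - C (1 + w) * X) ^ p : ℂ[X])).coeff n := by
  have h := homog_K q p (1 + X) (C w * (1 - X))
  rw [show C w * (1 - X) + (1 + X : ℂ[X]) = C (1 + w) - C (w - 1) * X by
      simp only [map_add, map_sub, C_1]; ring,
    show C w * (1 - X) - (1 + X : ℂ[X]) = C (w - 1) - C (1 + w) * X by
      simp only [map_add, map_sub, C_1]; ring] at h
  rw [← h, finsetSum_coeff]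
  refine Finset.sum_congr rfl fun i hi => ?_
  rw [mul_pow, ← C_pow]
  rw [show C (Kc q p i) * (1 + X : ℂ[X]) ^ i * (C (w ^ (q + p - i)) * (1 - X) ^ (q + p - i)) =
    C (Kc q p i * w ^ (q + p - i)) * ((1 + X) ^ i * (1 - X) ^ (q + p - i)) by rw [C_mul]; ring]
  rw [coeff_C_mul]; unfold Kc; ring

open Polynomial in
lemma coeff_lin_pow (u v : ℂ) (M k : ℕ) :
    (((C u - C v * X) ^ M : ℂ[X])).coeff k = (M.choose k : ℂ) * (-v) ^ k * u ^ (M - k) := by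
  by_cases hk : k ≤ M
  · rw [sub_eq_add_neg, add_comm, add_pow, finsetSum_coeff, Finset.sum_eq_single k]
    · rw [show (-(C v * X) : ℂ[X]) ^ k * C u ^ (M - k) * (M.choose k : ℂ[X]) =
        C ((M.choose k : ℂ) * (-v) ^ k * u ^ (M - k)) * X ^ k by
          simp only [C_mul, C_pow, C_neg, map_natCast]; ring]
      rw [coeff_C_mul, coeff_X_pow, if_pos rfl, mul_one]
    · intro b _ hb
      rw [show (-(C v * X) : ℂ[X]) ^ b * C u ^ (M - b) * (M.choose b : ℂ[X]) =
        C ((M.choose b : ℂ) * (-v) ^ b * u ^ (M - b)) * X ^ b by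
          simp only [C_mul, C_pow, C_neg, map_natCast]; ring]
      rw [coeff_C_mul, coeff_X_pow, if_neg (Ne.symm hb), mul_zero]
    · intro h; exact absurd (Finset.mem_range.2 (by omega)) h
  · rw [Nat.choose_eq_zero_of_lt (by omega), coeff_eq_zero_of_natDegree_lt]
    · simp
    · have : ((C u - C v * X) ^ M : ℂ[X]).natDegree ≤ M := by compute_degree!
      omega

open Polynomial in
lemma lemB (q p n : ℕ) (hn : n ≤ q + p) (w : ℂ) :
    (1 + w) ^ p * (((C (1 + w) - C (w - 1) * X) ^ q * (C (w - 1) - C (1 + w) * X) ^ p : ℂ[X])).coeff n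
      = ∑ k ∈ Finset.range (p + 1), (p.choose k : ℂ) * ((q + p - k).choose (q + p - n) : ℂ) *
          ((-1) ^ n * 4 ^ k) * (w ^ k * (w - 1) ^ (p - k) * (w - 1) ^ (n - k) *
            (1 + w) ^ (q + p - n)) := by
  rw [← coeff_C_mul, C_pow]
  have e : C (1 + w) ^ p * ((C (1 + w) - C (w - 1) * X) ^ q * (C (w - 1) - C (1 + w) * X) ^ p : ℂ[X])
      = ∑ k ∈ Finset.range (p + 1), C ((p.choose k : ℂ) * (-4 * w) ^ k * (w - 1) ^ (p - k)) *
        (X ^ k * (C (1 + w) - C (w - 1) * X) ^ (q + p - k)) := by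
    rw [mul_left_comm, ← mul_pow]
    rw [show C (1 + w) * (C (w - 1) - C (1 + w) * X) =
      C (-4 * w) * X + C (w - 1) * (C (1 + w) - C (w - 1) * X) by
        simp only [map_add, map_sub, map_mul, map_neg, C_1]
        rw [show (C 4 : ℂ[X]) = 4 from rfl]; ring]
    rw [add_pow, Finset.mul_sum]
    refine Finset.sum_congr rfl fun k hk => ?_
    have : k ≤ p := by simpa [Nat.lt_succ_iff] using hk
    rw [show q + p - k = q + (p - k) by omega, pow_add, mul_pow, mul_pow]
    simp only [C_mul, C_pow, map_natCast]
    ring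
  rw [e, finsetSum_coeff]
  refine Finset.sum_congr rfl fun k hk => ?_
  have hkp : k ≤ p := by simpa [Nat.lt_succ_iff] using hk
  rw [coeff_C_mul, coeff_X_pow_mul']
  split_ifs with hkn
  · rw [coeff_lin_pow, show q + p - k - (n - k) = q + p - n by omega]
    rw [show (q + p - k).choose (n - k) = (q + p - k).choose (q + p - n) from
      Nat.choose_symm_of_eq_add (by omega)]
    obtain ⟨l, rfl⟩ := Nat.exists_eq_add_of_le hkn
    rw [Nat.add_sub_cancel_left, neg_pow (w - 1), pow_add, show (-4 * w) = (-1) * 4 * w by ring,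
      mul_pow, mul_pow]
    ring
  · rw [Nat.choose_eq_zero_of_lt (show q + p - k < q + p - n by omega)]
    simp

open Polynomial in
lemma lemP (q p n : ℕ) (hn : n ≤ q + p) :
    (1 + X : ℂ[X]) ^ (q + p) * ∑ i ∈ Finset.range (q + p + 1),
        C (Kc q p i * Kc i (q + p - i) n) * X ^ (q + p - i) =
    ∑ k ∈ Finset.range (p + 1), C ((p.choose k : ℂ) * ((q + p - k).choose (q + p - n) : ℂ) *
          ((-1) ^ n * 4 ^ k)) * (X ^ k * (X - 1) ^ (p - k) * (X - 1) ^ (n - k) *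
            (1 + X) ^ (q + p - n) * (1 + X) ^ q) := by
  refine Polynomial.funext fun w => ?_
  have h1 := lemA q p n w
  have h2 := lemB q p n hn w
  rw [← h1] at h2
  simp only [eval_mul, eval_pow, eval_add, eval_sub, eval_one, eval_X, eval_finsetSum, eval_C]
  rw [pow_add, mul_assoc, h2, Finset.mul_sum]
  refine Finset.sum_congr rfl fun k hk => ?_
  ring

lemma lemT (j p q n h : ℕ) (hN : q + p = 2 * j) (hn : n ≤ 2 * j) (hh : p + n = 2 * h)
    (z : ℂ) (hz : (j : ℝ) + 1 / 2 < z.re) :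
    4 ^ j * ∑ i ∈ Finset.range (2 * j + 1), Kc q p i * Kc i (2 * j - i) n * Qf z ((j : ℂ) - i) =
    ∑ k ∈ Finset.range (p + 1), (p.choose k : ℂ) * ((2 * j - k).choose (2 * j - n) : ℂ) *
      ((-1) ^ n * 4 ^ (2 * j)) * (-1) ^ (h - k) *
      (Complex.Gamma (z + j - h - 1 / 2) * Complex.Gamma (((h - k : ℕ) : ℂ) + 1 / 2) /
        Complex.Gamma (z + j - k)) := by
  have hz0 : 1 / 2 < (z - j).re := by simp; norm_num at hz; linarith
  have P := congrArg (Lf (z - j) (2 * j)) (lemP q p n (by omega))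
  rw [hN, Lf_pow _ _ _ hz0, map_sum, map_sum] at P
  rw [show z - (j : ℂ) + j = z by ring, show 2 * (j : ℂ) - j = j by ring] at P
  convert P using 1
  · congr 1
    refine Finset.sum_congr rfl fun i hi => ?_
    have : i ≤ 2 * j := by simpa [Nat.lt_succ_iff] using hi
    rw [Polynomial.C_mul_X_pow_eq_monomial, Lf_monomial, Nat.cast_sub this]
    push_cast
    congr 2; ring
  · refine Finset.sum_congr rfl fun k hk => ?_
    have hkp : k ≤ p := by simpa [Nat.lt_succ_iff] using hk
    by_cases hkn : k ≤ n
    · rw [← Polynomial.smul_eq_C_mul, map_smul, smul_eq_mul]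
      have := Lf_uv (2 * j - h) (h - k) k (z - j) hz0
      have c1 : ((2 * j - h : ℕ) : ℂ) = 2 * j - h := by
        rw [Nat.cast_sub (by omega)]; push_cast; ring
      have c2 : ((h - k : ℕ) : ℂ) = h - k := by
        rw [Nat.cast_sub (by omega)]
      rw [c1, c2] at this
      rw [show 2 * (j : ℂ) - h + (h - k) + k = 2 * j by ring,
        show z - (j : ℂ) + (2 * j - h) - 1 / 2 = z + j - h - 1 / 2 by ring,
        show z - (j : ℂ) + (2 * j - h) + (h - k) = z + j - k by ring] at this
      have e : (Polynomial.X ^ k * (Polynomial.X - 1) ^ (p - k) * (Polynomial.X - 1) ^ (n - k) *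
          (1 + Polynomial.X) ^ (2 * j - n) * (1 + Polynomial.X) ^ q : Polynomial ℂ) =
          Polynomial.X ^ k * ((1 + Polynomial.X) ^ (2 * (2 * j - h)) *
            (Polynomial.X - 1) ^ (2 * (h - k))) := by
        rw [show 2 * (2 * j - h) = 2 * j - n + q by omega, show 2 * (h - k) = (p - k) + (n - k) by omega,
          pow_add, pow_add]
        ring
      rw [e, this, c2, show 2 * j = (2 * j - h + (h - k)) + k by omega, pow_add 4 _ k]
      rw [show (2 * j - h + (h - k)) + k = 2 * j by omega]
      ring
    · rw [Nat.choose_eq_zero_of_lt (show 2 * j - k < 2 * j - n by omega)]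
      simp

/-! Pochhammer identities -/

lemma pochN_zero (a : ℂ) : pochN a 0 = 1 := by simp [pochN]

lemma pochN_succ (a : ℂ) (k : ℕ) : pochN a (k + 1) = pochN a k * (a + k) := by
  simp [pochN, Finset.prod_range_succ]

lemma pochN_succ' (a : ℂ) (k : ℕ) : pochN a (k + 1) = a * pochN (a + 1) k := by
  unfold pochN
  rw [Finset.prod_range_succ', mul_comm]
  congr 1
  · simp
  · refine Finset.prod_congr rfl fun i _ => ?_
    push_cast; ring

lemma pochN_add (a : ℂ) (k l : ℕ) : pochN a (k + l) = pochN a k * pochN (a + k) l := by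
  induction l with
  | zero => simp [pochN_zero]
  | succ l ih => rw [← add_assoc, pochN_succ, ih, pochN_succ]; push_cast; ring

lemma pochN_reflect (a : ℂ) (k : ℕ) : pochN a k = (-1) ^ k * pochN (1 - a - k) k := by
  induction k generalizing a with
  | zero => simp [pochN_zero]
  | succ k ih =>
    rw [pochN_succ', ih (a + 1), pochN_succ]
    push_cast
    rw [show 1 - (a + 1) - (k : ℂ) = 1 - a - (k + 1) by ring]
    ring

lemma pochN_vand (a b : ℂ) (n : ℕ) :
    ∑ l ∈ Finset.range (n + 1), (n.choose l : ℂ) * pochN a l * pochN b (n - l) = pochN (a + b) n := by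
  induction n generalizing a b with
  | zero => simp [pochN_zero]
  | succ n ih =>
    have key : ∑ l ∈ Finset.range (n + 2), ((n + 1).choose l : ℂ) * pochN a l * pochN b (n + 1 - l) =
        a * (∑ l ∈ Finset.range (n + 1), (n.choose l : ℂ) * pochN (a + 1) l * pochN b (n - l)) +
        b * ∑ l ∈ Finset.range (n + 1), (n.choose l : ℂ) * pochN a l * pochN (b + 1) (n - l) := by
      have e2 : b * ∑ l ∈ Finset.range (n + 1), (n.choose l : ℂ) * pochN a l * pochN (b + 1) (n - l)
          = ∑ l ∈ Finset.range (n + 2), (n.choose l : ℂ) * pochN a l * pochN b (n + 1 - l) := by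
        rw [Finset.sum_range_succ _ (n + 1), Nat.choose_succ_self, Finset.mul_sum]
        simp only [Nat.cast_zero, zero_mul, add_zero]
        refine Finset.sum_congr rfl fun l hl => ?_
        have : l ≤ n := by simpa [Nat.lt_succ_iff] using hl
        rw [show n + 1 - l = n - l + 1 by omega, pochN_succ']; ring
      rw [e2, Finset.sum_range_succ' _ (n + 1), Finset.sum_range_succ' _ (n + 1), Finset.mul_sum]
      simp only [Nat.choose_zero_right]
      rw [← add_assoc, ← Finset.sum_add_distrib]
      congr 1
      refine Finset.sum_congr rfl fun l hl => ?_
      rw [Nat.choose_succ_succ, pochN_succ', show n + 1 - (l + 1) = n - l by omega]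
      push_cast; ring
    rw [key, ih, ih, pochN_succ', show a + 1 + b = a + b + 1 by ring, show a + (b + 1) = a + b + 1 by ring]
    ring

/-- Chu–Vandermonde. -/
lemma chu (x c : ℂ) (n : ℕ) :
    ∑ l ∈ Finset.range (n + 1), (-1) ^ l * (n.choose l : ℂ) * pochN x l * pochN (c + l) (n - l) =
      pochN (c - x) n := by
  rw [pochN_reflect (c - x) n, show 1 - (c - x) - (n : ℂ) = x + (1 - c - n) by ring, ← pochN_vand,
    Finset.mul_sum]
  refine Finset.sum_congr rfl fun l hl => ?_
  have : l ≤ n := by simpa [Nat.lt_succ_iff] using hl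
  rw [pochN_reflect (c + l) (n - l), Nat.cast_sub this,
    show 1 - (c + (l : ℂ)) - (n - l) = 1 - c - n by ring]
  obtain ⟨r, rfl⟩ := Nat.exists_eq_add_of_le this
  rw [Nat.add_sub_cancel_left, pow_add]; ring

lemma pochN_neg_nat (n k : ℕ) (hk : k ≤ n) :
    pochN (-(n : ℂ)) k * ((n - k).factorial : ℂ) = (-1) ^ k * (n.factorial : ℂ) := by
  induction k with
  | zero => simp [pochN_zero]
  | succ k ih =>
    have ih := ih (by omega)
    rw [show n - k = n - (k + 1) + 1 by omega, Nat.factorial_succ] at ih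
    have c : ((n - (k + 1) + 1 : ℕ) : ℂ) = n - k := by
      rw [show n - (k + 1) + 1 = n - k by omega, Nat.cast_sub (by omega)]
    rw [Nat.cast_mul, c] at ih
    rw [pochN_succ, pow_succ]
    linear_combination -ih

lemma pochN_neg_nat_zero (n k : ℕ) (hk : n < k) : pochN (-(n : ℂ)) k = 0 := by
  unfold pochN
  exact Finset.prod_eq_zero (Finset.mem_range.2 hk) (by ring)

lemma pochN_neg_nat_ne (n k : ℕ) (hk : k ≤ n) : pochN (-(n : ℂ)) k ≠ 0 := by
  intro h
  have := pochN_neg_nat n k hk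
  rw [h, zero_mul] at this
  exact mul_ne_zero (pow_ne_zero _ (by norm_num)) (Nat.cast_ne_zero.2 n.factorial_ne_zero) this.symm

lemma pochN_half_ne (h k : ℕ) : pochN (1 / 2 - (h : ℂ)) k ≠ 0 := by
  unfold pochN
  refine Finset.prod_ne_zero_iff.2 fun i _ hi => ?_
  have : ((1 + 2 * (i : ℤ) - 2 * h : ℤ) : ℂ) = 0 := by push_cast; linear_combination 2 * hi
  have := Int.cast_eq_zero.1 this
  omega

/-- expansion of `(-X-N)_k`. -/
lemma poch_expand (X : ℂ) (N k : ℕ) (hk : k ≤ N) :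
    pochN (-X - N) k / pochN (-(N : ℂ)) k = ∑ i ∈ Finset.range (k + 1),
      (k.choose i : ℂ) * ((-1) ^ i * pochN X i / pochN (-(N : ℂ)) i) := by
  rw [div_eq_iff (pochN_neg_nat_ne N k hk), pochN_reflect (-X - N) k,
    show 1 - (-X - (N : ℂ)) - k = X + (N - k + 1) by ring, ← pochN_vand, Finset.mul_sum, Finset.sum_mul]
  refine Finset.sum_congr rfl fun i hi => ?_
  have hi : i ≤ k := by simpa [Nat.lt_succ_iff] using hi
  have h0 := pochN_neg_nat_ne N i (hi.trans hk)
  obtain ⟨r, rfl⟩ := Nat.exists_eq_add_of_le hi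
  rw [pochN_add, pochN_reflect (-(N : ℂ) + i) r, Nat.add_sub_cancel_left, pow_add]
  push_cast
  rw [show 1 - (-(N : ℂ) + i) - r = N - (i + r) + 1 by ring]
  field_simp

lemma half_ratio (n p h i : ℕ) (hh : p + n = 2 * h) (hi : i ≤ n) :
    pochN (1 / 2 - (h : ℂ) + p) (n - i) = (-1) ^ (n - i) * pochN (1 / 2 - (h : ℂ) + i) (n - i) := by
  rw [pochN_reflect, Nat.cast_sub hi]
  congr 2
  have : (p : ℂ) + n = 2 * h := by exact_mod_cast hh
  linear_combination -this

lemma inner_sum (n p h i : ℕ) (hh : p + n = 2 * h) (hi : i ≤ n) :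
    ∑ l ∈ Finset.range (n - i + 1), pochN (-(p : ℂ)) (i + l) * pochN (-(n : ℂ)) (i + l) /
      pochN (1 / 2 - (h : ℂ)) (i + l) / (l.factorial : ℂ) =
    (-1) ^ (n - i) * (pochN (-(p : ℂ)) i * pochN (-(n : ℂ)) i / pochN (1 / 2 - (h : ℂ)) i) := by
  have hc := chu (-(p : ℂ) + i) (1 / 2 - (h : ℂ) + i) (n - i)
  rw [show 1 / 2 - (h : ℂ) + i - (-(p : ℂ) + i) = 1 / 2 - (h : ℂ) + p by ring,
    half_ratio n p h i hh hi] at hc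
  have hE := pochN_half_ne h n
  have hE2 : pochN (1 / 2 - (h : ℂ)) n = pochN (1 / 2 - (h : ℂ)) i * pochN (1 / 2 - (h : ℂ) + i) (n - i) := by
    rw [← pochN_add]; congr 1; omega
  rw [hE2] at hE
  have hi0 := (mul_ne_zero_iff.1 hE).1
  have hi1 := (mul_ne_zero_iff.1 hE).2
  have : (-1) ^ (n - i) * (pochN (-(p : ℂ)) i * pochN (-(n : ℂ)) i / pochN (1 / 2 - (h : ℂ)) i) =
    (pochN (-(p : ℂ)) i * pochN (-(n : ℂ)) i / pochN (1 / 2 - (h : ℂ)) i) *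
      ((-1) ^ (n - i) * pochN (1 / 2 - (h : ℂ) + i) (n - i)) / pochN (1 / 2 - (h : ℂ) + i) (n - i) := by
    generalize pochN (1 / 2 - (h : ℂ) + i) (n - i) = A at hi1 ⊢
    field_simp
  rw [this, ← hc, Finset.mul_sum, Finset.sum_div]
  refine Finset.sum_congr rfl fun l hl => ?_
  have hl : l ≤ n - i := by simpa [Nat.lt_succ_iff] using hl
  have hch : pochN (-(n : ℂ) + i) l = (-1) ^ l * ((n - i).choose l : ℂ) * (l.factorial : ℂ) := by
    have h1 := pochN_neg_nat (n - i) l hl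
    rw [Nat.cast_sub hi, show -((n : ℂ) - i) = -(n : ℂ) + i by ring] at h1
    rw [← Nat.choose_mul_factorial_mul_factorial hl] at h1
    have h2 : ((n - i - l).factorial : ℂ) ≠ 0 := Nat.cast_ne_zero.2 (Nat.factorial_ne_zero _)
    apply mul_right_cancel₀ h2
    rw [h1]; push_cast; ring
  have hEl : pochN (1 / 2 - (h : ℂ) + i) (n - i) = pochN (1 / 2 - (h : ℂ) + i) l *
      pochN (1 / 2 - (h : ℂ) + i + l) (n - i - l) := by
    rw [← pochN_add]; congr 1; omega
  rw [hEl] at hi1 ⊢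
  have h3 := (mul_ne_zero_iff.1 hi1).1
  have h4 := (mul_ne_zero_iff.1 hi1).2
  have hf : (l.factorial : ℂ) ≠ 0 := Nat.cast_ne_zero.2 (Nat.factorial_ne_zero _)
  rw [pochN_add, pochN_add, pochN_add, hch]
  generalize pochN (1 / 2 - (h : ℂ) + i) l = A at h3 ⊢
  generalize pochN (1 / 2 - (h : ℂ) + i + l) (n - i - l) = B at h4 ⊢
  generalize pochN (1 / 2 - (h : ℂ)) i = D at hi0 ⊢
  field_simp

lemma reflection (N n p h : ℕ) (hn : n ≤ N) (hh : p + n = 2 * h) (X : ℂ) :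
    ∑ k ∈ Finset.range (n + 1), pochN (-X - N) k * pochN (-(p : ℂ)) k * pochN (-(n : ℂ)) k /
      (pochN (-(N : ℂ)) k * pochN (1 / 2 - (h : ℂ)) k) / (k.factorial : ℂ) =
    (-1) ^ n * ∑ k ∈ Finset.range (n + 1), pochN X k * pochN (-(p : ℂ)) k * pochN (-(n : ℂ)) k /
      (pochN (-(N : ℂ)) k * pochN (1 / 2 - (h : ℂ)) k) / (k.factorial : ℂ) := by
  have e1 : ∀ k ∈ Finset.range (n + 1),
      pochN (-X - N) k * pochN (-(p : ℂ)) k * pochN (-(n : ℂ)) k /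
      (pochN (-(N : ℂ)) k * pochN (1 / 2 - (h : ℂ)) k) / (k.factorial : ℂ) =
      ∑ i ∈ Finset.range (k + 1), ((-1) ^ i * pochN X i / pochN (-(N : ℂ)) i / (i.factorial : ℂ)) *
        (pochN (-(p : ℂ)) (i + (k - i)) * pochN (-(n : ℂ)) (i + (k - i)) /
          pochN (1 / 2 - (h : ℂ)) (i + (k - i)) / ((k - i).factorial : ℂ)) := by
    intro k hk
    have hk : k ≤ n := by simpa [Nat.lt_succ_iff] using hk
    have := poch_expand X N k (hk.trans hn)
    rw [show pochN (-X - N) k * pochN (-(p : ℂ)) k * pochN (-(n : ℂ)) k /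
      (pochN (-(N : ℂ)) k * pochN (1 / 2 - (h : ℂ)) k) / (k.factorial : ℂ) =
      (pochN (-X - N) k / pochN (-(N : ℂ)) k) * (pochN (-(p : ℂ)) k * pochN (-(n : ℂ)) k /
        pochN (1 / 2 - (h : ℂ)) k / (k.factorial : ℂ)) by
      simp only [div_eq_mul_inv, mul_inv]; ring, this, Finset.sum_mul]
    refine Finset.sum_congr rfl fun i hi => ?_
    have hi : i ≤ k := by simpa [Nat.lt_succ_iff] using hi
    rw [show i + (k - i) = k by omega, ← Nat.choose_mul_factorial_mul_factorial hi]
    have f1 : (i.factorial : ℂ) ≠ 0 := Nat.cast_ne_zero.2 (Nat.factorial_ne_zero _)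
    have f2 : ((k - i).factorial : ℂ) ≠ 0 := Nat.cast_ne_zero.2 (Nat.factorial_ne_zero _)
    have f3 : (k.choose i : ℂ) ≠ 0 := Nat.cast_ne_zero.2 (Nat.choose_pos hi).ne'
    have f4 := pochN_neg_nat_ne N i (by omega)
    have f5 := pochN_half_ne h k
    push_cast
    field_simp
  rw [Finset.sum_congr rfl e1]
  rw [Finset.sum_range_diag_flip (n + 1) (fun i l =>
    ((-1) ^ i * pochN X i / pochN (-(N : ℂ)) i / (i.factorial : ℂ)) *
        (pochN (-(p : ℂ)) (i + l) * pochN (-(n : ℂ)) (i + l) /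
          pochN (1 / 2 - (h : ℂ)) (i + l) / (l.factorial : ℂ))), Finset.mul_sum]
  refine Finset.sum_congr rfl fun i hi => ?_
  have hi : i ≤ n := by simpa [Nat.lt_succ_iff] using hi
  rw [← Finset.mul_sum, show n + 1 - i = n - i + 1 by omega, inner_sum n p h i hh hi]
  obtain ⟨r, rfl⟩ := Nat.exists_eq_add_of_le hi
  rw [Nat.add_sub_cancel_left, pow_add]
  simp only [div_eq_mul_inv, mul_inv]; ring

/-! Gamma factors -/

lemma gamma_half (h : ℕ) :
    Complex.Gamma ((h : ℂ) + 1 / 2) * Complex.Gamma (1 / 2 - (h : ℂ)) = Real.pi * (-1) ^ h := by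
  have := Complex.Gamma_mul_Gamma_one_sub ((h : ℂ) + 1 / 2)
  rw [show 1 - ((h : ℂ) + 1 / 2) = 1 / 2 - h by ring] at this
  rw [this, show (Real.pi : ℂ) * ((h : ℂ) + 1 / 2) = Real.pi / 2 + h * Real.pi by ring,
    Complex.sin_antiperiodic.add_nat_mul_eq, Complex.sin_pi_div_two]
  rcases Nat.even_or_odd h with e | o
  · simp [e.neg_one_pow]
  · simp [o.neg_one_pow, div_neg]

lemma gamma_half_shift (h k : ℕ) :
    Complex.Gamma ((h : ℂ) - k + 1 / 2) * pochN (1 / 2 - (h : ℂ)) k =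
      (-1) ^ k * Complex.Gamma ((h : ℂ) + 1 / 2) := by
  induction k with
  | zero => simp [pochN_zero]
  | succ k ih =>
    have hne : (h : ℂ) - (k + 1) + 1 / 2 ≠ 0 := by
      intro hi
      have : ((1 + 2 * (h : ℤ) - 2 * (k + 1) : ℤ) : ℂ) = 0 := by push_cast; linear_combination 2 * hi
      have := Int.cast_eq_zero.1 this
      omega
    have g := Complex.Gamma_add_one _ hne
    rw [show (h : ℂ) - (k + 1) + 1 / 2 + 1 = h - k + 1 / 2 by ring] at g
    rw [g] at ih
    rw [pochN_succ, pow_succ]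
    push_cast
    linear_combination -ih

lemma gamma_inv_shift (s : ℂ) (k : ℕ) :
    (Complex.Gamma (s - k))⁻¹ = (-1) ^ k * pochN (1 - s) k * (Complex.Gamma s)⁻¹ := by
  induction k with
  | zero => simp [pochN_zero]
  | succ k ih =>
    have := Complex.one_div_Gamma_eq_self_mul_one_div_Gamma_add_one (s - (k + 1))
    rw [show s - ((k : ℂ) + 1) + 1 = s - k by ring] at this
    push_cast
    rw [this, ih, pochN_succ]; ring

lemma truncN_sum (as bs : List ℂ) (n : ℕ) (hn : -(n : ℂ) ∈ as) (x : ℂ) :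
    pFq as bs x = ∑ k ∈ Finset.range (n + 1),
      ((as.map fun a => pochN a k).prod / (bs.map fun b => pochN b k).prod) * x ^ k /
      (Nat.factorial k : ℂ) := by
  unfold pFq
  have hle : truncN as ≤ n := Nat.sInf_le hn
  have hmem : -((truncN as : ℕ) : ℂ) ∈ as := Nat.sInf_mem (s := {k : ℕ | (-(k : ℂ)) ∈ as}) ⟨n, hn⟩
  refine Finset.sum_subset (Finset.range_subset_range.2 (by omega)) fun k _ hk => ?_
  have hk : truncN as < k := by simpa [Nat.lt_succ_iff] using hk
  have : (as.map fun a => pochN a k).prod = 0 := by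
    apply List.prod_eq_zero
    rw [List.mem_map]
    exact ⟨_, hmem, pochN_neg_nat_zero _ _ hk⟩
  rw [this]; simp

/-- The main sum in terms of `₃F₂`. -/
lemma sum_eval (N p n h : ℕ) (hp : p ≤ N) (hn : n ≤ N) (hh : p + n = 2 * h) (s : ℂ) :
    ((N - n).factorial : ℂ) * n.factorial * ∑ k ∈ Finset.range (p + 1), (p.choose k : ℂ) *
      ((N - k).choose (N - n) : ℂ) * (-1) ^ (h - k) *
      (Complex.Gamma (((h - k : ℕ) : ℂ) + 1 / 2) / Complex.Gamma (s - k)) =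
    (N.factorial : ℂ) * Real.pi / (Complex.Gamma (1 / 2 - (h : ℂ)) * Complex.Gamma s) *
      ∑ k ∈ Finset.range (n + 1), pochN (1 - s) k * pochN (-(p : ℂ)) k * pochN (-(n : ℂ)) k /
      (pochN (-(N : ℂ)) k * pochN (1 / 2 - (h : ℂ)) k) / (k.factorial : ℂ) := by
  have hg := gamma_half h
  have hpi : (Real.pi : ℂ) ≠ 0 := by exact_mod_cast Real.pi_ne_zero
  have hg0 : Complex.Gamma (1 / 2 - (h : ℂ)) ≠ 0 := by
    intro h0
    rw [h0, mul_zero] at hg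
    exact mul_ne_zero hpi (pow_ne_zero _ (by norm_num)) hg.symm
  -- extend both sums to range (N+1)
  have L : ∑ k ∈ Finset.range (p + 1), (p.choose k : ℂ) *
      ((N - k).choose (N - n) : ℂ) * (-1) ^ (h - k) *
      (Complex.Gamma (((h - k : ℕ) : ℂ) + 1 / 2) / Complex.Gamma (s - k)) =
      ∑ k ∈ Finset.range (N + 1), (p.choose k : ℂ) *
      ((N - k).choose (N - n) : ℂ) * (-1) ^ (h - k) *
      (Complex.Gamma (((h - k : ℕ) : ℂ) + 1 / 2) / Complex.Gamma (s - k)) := by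
    refine Finset.sum_subset (Finset.range_subset_range.2 (by omega)) fun k _ hk => ?_
    have hk : p < k := by simpa [Nat.lt_succ_iff] using hk
    rw [Nat.choose_eq_zero_of_lt hk]; simp
  have R : ∑ k ∈ Finset.range (n + 1), pochN (1 - s) k * pochN (-(p : ℂ)) k * pochN (-(n : ℂ)) k /
      (pochN (-(N : ℂ)) k * pochN (1 / 2 - (h : ℂ)) k) / (k.factorial : ℂ) =
      ∑ k ∈ Finset.range (N + 1), pochN (1 - s) k * pochN (-(p : ℂ)) k * pochN (-(n : ℂ)) k /
      (pochN (-(N : ℂ)) k * pochN (1 / 2 - (h : ℂ)) k) / (k.factorial : ℂ) := by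
    refine Finset.sum_subset (Finset.range_subset_range.2 (by omega)) fun k _ hk => ?_
    have hk : n < k := by simpa [Nat.lt_succ_iff] using hk
    rw [pochN_neg_nat_zero n k hk]; simp
  rw [L, R, Finset.mul_sum, Finset.mul_sum]
  refine Finset.sum_congr rfl fun k hk => ?_
  have hkN : k ≤ N := by simpa [Nat.lt_succ_iff] using hk
  by_cases hkp : k ≤ p
  swap
  · rw [Nat.choose_eq_zero_of_lt (show p < k by omega), pochN_neg_nat_zero p k (by omega)]; simp
  by_cases hkn : k ≤ n
  swap
  · rw [Nat.choose_eq_zero_of_lt (show N - k < N - n by omega), pochN_neg_nat_zero n k (by omega)]; simp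
  have hkh : k ≤ h := by omega
  have fne : ∀ m : ℕ, (m.factorial : ℂ) ≠ 0 := fun m => Nat.cast_ne_zero.2 (Nat.factorial_ne_zero _)
  have a1 : pochN (-(p : ℂ)) k = (-1) ^ k * (p.choose k : ℂ) * k.factorial := by
    apply mul_right_cancel₀ (fne (p - k))
    rw [pochN_neg_nat p k hkp, ← Nat.choose_mul_factorial_mul_factorial hkp]
    push_cast; ring
  have a2 : pochN (-(n : ℂ)) k = (-1) ^ k * n.factorial / (n - k).factorial := by
    rw [eq_div_iff (fne _), pochN_neg_nat n k hkn]
  have a3 : pochN (-(N : ℂ)) k = (-1) ^ k * N.factorial / (N - k).factorial := by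
    rw [eq_div_iff (fne _), pochN_neg_nat N k hkN]
  have a4 : ((N - k).choose (N - n) : ℂ) = (N - k).factorial / ((N - n).factorial * (n - k).factorial) := by
    rw [eq_div_iff (mul_ne_zero (fne _) (fne _)),
      ← Nat.choose_mul_factorial_mul_factorial (show N - n ≤ N - k by omega),
      show N - k - (N - n) = n - k by omega]
    push_cast; ring
  have a5 : Complex.Gamma (((h - k : ℕ) : ℂ) + 1 / 2) =
      (-1) ^ k * (Real.pi * (-1) ^ h / Complex.Gamma (1 / 2 - (h : ℂ))) / pochN (1 / 2 - (h : ℂ)) k := by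
    rw [eq_div_iff (pochN_half_ne h k), Nat.cast_sub hkh, gamma_half_shift, ← hg, mul_div_assoc, div_self hg0, mul_one]
  have s1 : ((-1 : ℂ)) ^ (h - k) = (-1) ^ h * (-1) ^ k := by
    obtain ⟨r, rfl⟩ := Nat.exists_eq_add_of_le hkh
    rw [Nat.add_sub_cancel_left, pow_add]
    have : ((-1 : ℂ)) ^ k * (-1) ^ k = 1 := by rw [← mul_pow]; simp
    linear_combination -(-1) ^ r * this
  have sk : ((-1 : ℂ)) ^ k * (-1) ^ k = 1 := by rw [← mul_pow]; simp
  have sh : ((-1 : ℂ)) ^ h * (-1) ^ h = 1 := by rw [← mul_pow]; simp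
  have hsk : ((-1 : ℂ)) ^ k ≠ 0 := pow_ne_zero _ (by norm_num)
  have b1 := pochN_half_ne h k
  have b2 := fne (N - k)
  have b3 := fne (N - n)
  have b4 := fne (n - k)
  have b5 := fne N
  have b6 := fne k
  have b7 := fne n
  rw [div_eq_mul_inv _ (Complex.Gamma (s - k)), gamma_inv_shift, s1, a5, a4, a1, a2, a3]
  rw [show (N.factorial : ℂ) * Real.pi / (Complex.Gamma (1 / 2 - (h : ℂ)) * Complex.Gamma s) =
    (N.factorial : ℂ) * Real.pi / (Complex.Gamma (1 / 2 - (h : ℂ))) * (Complex.Gamma s)⁻¹ by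
      simp only [div_eq_mul_inv, mul_inv]; ring]
  generalize (Complex.Gamma s)⁻¹ = G
  field_simp
  simp only [← pow_mul, mul_comm _ 2, pow_mul (-1 : ℂ) 2, neg_one_sq, one_pow]
  try ring

/-! Reduction of the matrix entries -/

lemma genBinom_nat (a k : ℕ) : genBinom (a : ℂ) k = (a.choose k : ℂ) := by
  unfold genBinom
  rw [div_eq_iff (Nat.cast_ne_zero.2 (Nat.factorial_ne_zero _))]
  by_cases hk : k ≤ a
  · rw [mul_comm, ← Nat.cast_mul, ← Nat.descFactorial_eq_factorial_mul_choose,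
      Nat.descFactorial_eq_prod_range, Nat.cast_prod]
    refine Finset.prod_congr rfl fun i hi => ?_
    have := Finset.mem_range.1 hi
    rw [Nat.cast_sub (by omega)]
  · rw [Nat.choose_eq_zero_of_lt (by omega)]
    rw [Finset.prod_eq_zero (Finset.mem_range.2 (show a < k by omega)) (by ring)]
    simp

open Polynomial in
lemma Kc_sum (a b n : ℕ) : Kc a b n = ∑ s ∈ Finset.range (n + 1),
    (a.choose (n - s) : ℂ) * (b.choose s : ℂ) * (-1) ^ s := by
  unfold Kc
  rw [mul_comm, coeff_mul, Finset.Nat.sum_antidiagonal_eq_sum_range_succ_mk]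
  refine Finset.sum_congr rfl fun s _ => ?_
  have h := coeff_lin_pow 1 1 b s
  rw [C_1, one_mul] at h
  rw [h, coeff_one_add_X_pow]
  simp; ring

lemma jacobi_K (a b n : ℕ) (α β : ℂ) (hα : (n : ℂ) + α = a) (hβ : (n : ℂ) + β = b) :
    jacobiP n α β 0 = (1 / 2) ^ n * Kc a b n := by
  unfold jacobiP
  rw [Kc_sum, Finset.mul_sum, hα, hβ]
  refine Finset.sum_congr rfl fun s hs => ?_
  have : s ≤ n := by simpa [Nat.lt_succ_iff] using hs
  obtain ⟨r, rfl⟩ := Nat.exists_eq_add_of_le this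
  rw [genBinom_nat, genBinom_nat, Nat.add_sub_cancel_left, pow_add,
    show ((0 : ℂ) - 1) / 2 = -1 * (1 / 2) by ring, mul_pow, zero_add]
  ring

lemma cc_ne (j : ℕ) (m : ℤ) : cc j m ≠ 0 := by
  unfold cc
  rw [Complex.ofReal_ne_zero]
  have : (0 : ℝ) < (Nat.factorial ((j : ℤ) + m).toNat) * (Nat.factorial ((j : ℤ) - m).toNat) := by
    exact_mod_cast Nat.mul_pos (Nat.factorial_pos _) (Nat.factorial_pos _)
  exact (Real.sqrt_pos.2 this).ne'

lemma cc_sq (j : ℕ) (m : ℤ) : cc j m * cc j m =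
    (Nat.factorial ((j : ℤ) + m).toNat : ℂ) * (Nat.factorial ((j : ℤ) - m).toNat : ℂ) := by
  unfold cc
  rw [← Complex.ofReal_mul, Real.mul_self_sqrt (by positivity)]
  push_cast; ring

lemma Smat_eq (j p q n : ℕ) (hN : q + p = 2 * j) (m1 m4 : ℤ) (h1 : m1 = p - j)
    (h4 : m4 = j - n) (z : ℂ) :
    Smat j m1 m4 z = (cc j m4 / cc j m1) * Complex.I ^ (-(m1 + m4)) * (1 / 4) ^ j *
      ∑ i ∈ Finset.range (2 * j + 1), Kc q p i * Kc i (2 * j - i) n * Qf z ((j : ℂ) - i) := by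
  have hNc : (q : ℂ) + p = 2 * j := by exact_mod_cast hN
  unfold Smat
  have e : ∑ k ∈ Finset.Icc (-(j : ℤ)) (j : ℤ),
      (-1 : ℂ) ^ k * Mmat j m1 k * Nmat j k m4 * Qf z (k : ℂ) =
    ∑ i ∈ Finset.range (2 * j + 1), (-1 : ℂ) ^ ((j : ℤ) - i) * Mmat j m1 ((j : ℤ) - i) *
      Nmat j ((j : ℤ) - i) m4 * Qf z (((j : ℤ) - i : ℤ) : ℂ) := by
    refine Finset.sum_nbij' (fun k => ((j : ℤ) - k).toNat) (fun i => (j : ℤ) - i) ?_ ?_ ?_ ?_ ?_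
    · intro k hk; simp at hk ⊢; omega
    · intro i hi; simp at hi ⊢; omega
    · intro k hk; simp at hk ⊢; omega
    · intro i hi; simp
    · intro k hk
      simp at hk
      rw [show (j : ℤ) - (((j : ℤ) - k).toNat : ℤ) = k by omega]
  rw [e, Finset.mul_sum]
  refine Finset.sum_congr rfl fun i hi => ?_
  have hi : i ≤ 2 * j := by simpa [Nat.lt_succ_iff] using hi
  unfold Mmat Nmat
  rw [show ((j : ℤ) - ((j : ℤ) - i)).toNat = i by omega, show ((j : ℤ) - m4).toNat = n by omega]
  rw [jacobi_K q p i _ _ (by rw [h1]; push_cast; linear_combination -hNc) (by rw [h1]; push_cast; ring),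
    jacobi_K i (2 * j - i) n _ _ (by rw [h4]; push_cast; ring)
      (by rw [h4, Nat.cast_sub hi]; push_cast; ring)]
  have hc := cc_ne j ((j : ℤ) - i)
  have hc1 := cc_ne j m1
  have t1 : (2 : ℂ) ^ (-((j : ℤ) - i)) * (1 / 2) ^ i = (1 / 2) ^ j := by
    rw [neg_sub, zpow_sub₀ (by norm_num)]
    simp only [zpow_natCast, one_div, inv_pow]
    field_simp
  have t2 : (2 : ℂ) ^ (-m4) * (1 / 2) ^ n = (1 / 2) ^ j := by
    rw [h4, neg_sub, zpow_sub₀ (by norm_num)]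
    simp only [zpow_natCast, one_div, inv_pow]
    field_simp
  have t3 : (1 / 2 : ℂ) ^ j * (1 / 2) ^ j = (1 / 4) ^ j := by
    rw [← mul_pow]; norm_num
  have t4 : (-1 : ℂ) ^ ((j : ℤ) - i) * (Complex.I ^ ((j : ℤ) - i - m1) * Complex.I ^ ((j : ℤ) - i - m4)) =
      Complex.I ^ (-(m1 + m4)) := by
    rw [← zpow_add₀ Complex.I_ne_zero, show ((j : ℤ) - i - m1 + ((j : ℤ) - i - m4)) =
      2 * ((j : ℤ) - i) + (-(m1 + m4)) by ring, zpow_add₀ Complex.I_ne_zero, zpow_mul,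
      show Complex.I ^ (2 : ℤ) = -1 by rw [show (2 : ℤ) = (2 : ℕ) by rfl, zpow_natCast, Complex.I_sq],
      ← mul_assoc, ← mul_zpow]
    simp
  rw [← t4, ← t3]
  nth_rw 1 [← t1]
  rw [← t2]
  push_cast
  field_simp

open Polynomial in
lemma Kc_neg (a b n : ℕ) : Kc b a n = (-1) ^ n * Kc a b n := by
  unfold Kc
  have h : ((1 + X) ^ b * (1 - X) ^ a : ℂ[X]) =
      ((1 + X) ^ a * (1 - X) ^ b : ℂ[X]).comp (C (-1) * X) := by
    simp only [mul_comp, pow_comp, add_comp, sub_comp, one_comp, X_comp, C_neg, C_1]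
    ring
  rw [h, comp_C_mul_X_coeff, mul_comm]

open Polynomial in
lemma reflect_K (a b : ℕ) : reflect (a + b) ((1 + X) ^ a * (1 - X) ^ b : ℂ[X]) =
    (-1) ^ b * ((1 + X) ^ a * (1 - X) ^ b) := by
  have r1 : reflect 1 (1 + X : ℂ[X]) = 1 + X := by
    rw [reflect_add, ← C_1, reflect_C, ← pow_one X, reflect_monomial, revAt_le le_rfl]
    simp; ring
  have r2 : reflect 1 (1 - X : ℂ[X]) = -1 * (1 - X) := by
    rw [reflect_sub, ← C_1, reflect_C, ← pow_one X, reflect_monomial, revAt_le le_rfl]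
    simp
  have d1 : ∀ a : ℕ, ((1 + X : ℂ[X]) ^ a).natDegree ≤ a := fun a => by compute_degree!
  have d2 : ∀ a : ℕ, ((1 - X : ℂ[X]) ^ a).natDegree ≤ a := fun a => by compute_degree!
  have p1 : ∀ a : ℕ, reflect a ((1 + X : ℂ[X]) ^ a) = (1 + X) ^ a := by
    intro a
    induction a with
    | zero => rw [pow_zero, ← C_1, reflect_C]; simp
    | succ a ih => rw [pow_succ, reflect_mul _ _ (d1 a) (by simpa using d1 1), ih, r1]
  have p2 : ∀ a : ℕ, reflect a ((1 - X : ℂ[X]) ^ a) = (-1) ^ a * (1 - X) ^ a := by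
    intro a
    induction a with
    | zero => rw [pow_zero, ← C_1, reflect_C]; simp
    | succ a ih => rw [pow_succ, reflect_mul _ _ (d2 a) (by simpa using d2 1), ih, r2]; ring
  rw [reflect_mul _ _ (d1 a) (d2 b), p1, p2]; ring

open Polynomial in
lemma Kc_rev (a b i : ℕ) (hi : i ≤ a + b) : Kc a b (a + b - i) = (-1) ^ b * Kc a b i := by
  have h := congrArg (fun f => coeff f i) (reflect_K a b)
  simp only [coeff_reflect, revAt_le hi] at h
  unfold Kc
  rw [h, show ((-1) ^ b : ℂ[X]) = C ((-1) ^ b) by simp, coeff_C_mul]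

lemma Qf_neg (z m : ℂ) : Qf z (-m) = Qf z m := by
  unfold Qf
  rw [← sub_eq_add_neg, sub_neg_eq_add, mul_comm (Complex.Gamma (z - m))]

lemma sum_odd (j p q n : ℕ) (hN : q + p = 2 * j) (ho : Odd (p + n)) (z : ℂ) :
    ∑ i ∈ Finset.range (2 * j + 1), Kc q p i * Kc i (2 * j - i) n * Qf z ((j : ℂ) - i) = 0 := by
  have h := Finset.sum_range_reflect
    (fun i => Kc q p i * Kc i (2 * j - i) n * Qf z ((j : ℂ) - i)) (2 * j + 1)
  have h2 : ∑ i ∈ Finset.range (2 * j + 1), Kc q p (2 * j + 1 - 1 - i) *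
      Kc (2 * j + 1 - 1 - i) (2 * j - (2 * j + 1 - 1 - i)) n * Qf z ((j : ℂ) - (2 * j + 1 - 1 - i : ℕ)) =
      -∑ i ∈ Finset.range (2 * j + 1), Kc q p i * Kc i (2 * j - i) n * Qf z ((j : ℂ) - i) := by
    rw [← Finset.sum_neg_distrib]
    refine Finset.sum_congr rfl fun i hi => ?_
    have hi : i ≤ 2 * j := by simpa [Nat.lt_succ_iff] using hi
    have k1 := Kc_rev q p i (by omega)
    rw [hN] at k1
    rw [show 2 * j + 1 - 1 - i = 2 * j - i by omega, show 2 * j - (2 * j - i) = i by omega, k1,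
      Kc_neg i (2 * j - i) n, Nat.cast_sub hi, ← Qf_neg]
    push_cast
    rw [show -((j : ℂ) - (2 * j - i)) = j - i by ring]
    have s : (-1 : ℂ) ^ p * (-1) ^ n = -1 := by rw [← pow_add, ho.neg_one_pow]
    linear_combination (Kc q p i * Kc i (2 * j - i) n * Qf z ((j : ℂ) - i)) * s
  rw [h2] at h
  have h3 := eq_neg_of_add_eq_zero_left (a := (2 : ℂ) * ∑ i ∈ Finset.range (2 * j + 1),
    Kc q p i * Kc i (2 * j - i) n * Qf z ((j : ℂ) - i)) (b := 0) (by linear_combination -h)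
  simpa using h3

/-- Matrix entries of the simple intertwining operator as `₃F₂` hypergeometric values:
vanishing for `m1 − m4` odd, and an explicit `₃F₂(…;1)` formula for `m1 − m4` even. -/
theorem stmt_1 (j : ℕ) (m1 m4 : ℤ) (h1 : |m1| ≤ (j : ℤ)) (h4 : |m4| ≤ (j : ℤ)) :
    (Odd (m1 - m4) → ∀ z : ℂ, 1 / 2 < z.re → Smat j m1 m4 z = 0) ∧
      (Even (m1 - m4) → ∀ z : ℂ, (j : ℝ) + 1 / 2 < z.re →
        Smat j m1 m4 z =
          ((-1 : ℂ) ^ ((m1 + m4) / 2) * (Nat.factorial (2 * j) : ℂ) * (Real.pi : ℂ) /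
              (cc j m1 * cc j m4)) *
            Complex.Gamma (z + ((m4 : ℂ) - m1 - 1) / 2) /
            (Complex.Gamma ((1 - 2 * (j : ℂ) - m1 + m4) / 2) *
              Complex.Gamma ((j : ℂ) + z)) *
            pFq [z - (j : ℂ) - 1, -(j : ℂ) - m1, -(j : ℂ) + m4]
              [-2 * (j : ℂ), (1 - 2 * (j : ℂ) - m1 + m4) / 2] 1) := by
  obtain ⟨a1, b1⟩ := abs_le.1 h1
  obtain ⟨a4, b4⟩ := abs_le.1 h4
  obtain ⟨p, hp⟩ : ∃ p : ℕ, m1 = p - j := ⟨((j : ℤ) + m1).toNat, by omega⟩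
  obtain ⟨q, hq⟩ : ∃ q : ℕ, q + p = 2 * j := ⟨((j : ℤ) - m1).toNat, by omega⟩
  obtain ⟨n, hn⟩ : ∃ n : ℕ, m4 = j - n := ⟨((j : ℤ) - m4).toNat, by omega⟩
  have hn2 : n ≤ 2 * j := by omega
  constructor
  · rintro ⟨t, ht⟩ z _
    rw [Smat_eq j p q n hq m1 m4 hp hn z, sum_odd j p q n hq, mul_zero]
    rw [Nat.odd_iff]; omega
  · rintro ⟨t, ht⟩ z hz
    obtain ⟨h, hh⟩ : ∃ h : ℕ, p + n = 2 * h := ⟨(p + n) / 2, by omega⟩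
    have hhc : (p : ℂ) + n = 2 * h := by exact_mod_cast hh
    have c1 : (m1 : ℂ) = p - j := by rw [hp]; push_cast; ring
    have c4 : (m4 : ℂ) = j - n := by rw [hn]; push_cast; ring
    rw [Smat_eq j p q n hq m1 m4 hp hn z]
    have T := lemT j p q n h hq hn2 hh z hz
    have E := sum_eval (2 * j) p n h (by omega) hn2 hh (z + j)
    have R := reflection (2 * j) n p h hn2 hh (1 - (z + j))
    have hF : pFq [z - (j : ℂ) - 1, -(j : ℂ) - m1, -(j : ℂ) + m4]
        [-2 * (j : ℂ), (1 - 2 * (j : ℂ) - m1 + m4) / 2] 1 =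
        (-1) ^ n * ∑ k ∈ Finset.range (n + 1), pochN (1 - (z + j)) k * pochN (-(p : ℂ)) k *
          pochN (-(n : ℂ)) k / (pochN (-((2 * j : ℕ) : ℂ)) k * pochN (1 / 2 - (h : ℂ)) k) /
            (k.factorial : ℂ) := by
      rw [← R, truncN_sum _ _ n (by
        have e : -(j : ℂ) + m4 = -n := by rw [c4]; ring
        simp [e])]
      refine Finset.sum_congr rfl fun k _ => ?_
      simp only [List.map_cons, List.map_nil, List.prod_cons, List.prod_nil, mul_one, one_pow]
      rw [c1, c4, show -(j : ℂ) - (p - j) = -p by ring, show -(j : ℂ) + (j - n) = -n by ring,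
        show (1 - 2 * (j : ℂ) - (p - j) + (j - n)) / 2 = 1 / 2 - h by linear_combination -hhc / 2,
        show -(1 - (z + (j : ℂ))) - ((2 * j : ℕ) : ℂ) = z - j - 1 by push_cast; ring,
        show -((2 * j : ℕ) : ℂ) = -2 * (j : ℂ) by push_cast; ring]
      ring
    rw [hF]
    generalize hS : (∑ k ∈ Finset.range (n + 1), pochN (1 - (z + j)) k * pochN (-(p : ℂ)) k *
          pochN (-(n : ℂ)) k / (pochN (-((2 * j : ℕ) : ℂ)) k * pochN (1 / 2 - (h : ℂ)) k) /
            (k.factorial : ℂ)) = F at E ⊢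
    generalize hT : (∑ i ∈ Finset.range (2 * j + 1),
      Kc q p i * Kc i (2 * j - i) n * Qf z ((j : ℂ) - i)) = T0 at T ⊢
    generalize hE : (∑ k ∈ Finset.range (p + 1), (p.choose k : ℂ) *
      ((2 * j - k).choose (2 * j - n) : ℂ) * (-1) ^ (h - k) *
      (Complex.Gamma (((h - k : ℕ) : ℂ) + 1 / 2) / Complex.Gamma (z + j - k))) = E0 at E
    have T2 : 4 ^ j * T0 = (-1) ^ n * 4 ^ (2 * j) * Complex.Gamma (z + j - h - 1 / 2) * E0 := by
      rw [T, ← hE, Finset.mul_sum]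
      refine Finset.sum_congr rfl fun k _ => ?_
      ring
    have T3 : (1 / 4) ^ j * T0 = (-1) ^ n * Complex.Gamma (z + j - h - 1 / 2) * E0 := by
      have h4j : (4 : ℂ) ^ j ≠ 0 := pow_ne_zero _ (by norm_num)
      have : (1 / 4 : ℂ) ^ j * 4 ^ j = 1 := by rw [← mul_pow]; norm_num
      rw [two_mul, pow_add] at T2
      have T4 : T0 = (-1) ^ n * 4 ^ j * Complex.Gamma (z + j - h - 1 / 2) * E0 := by
        apply mul_left_cancel₀ h4j
        rw [T2]; ring
      rw [T4]
      linear_combination ((-1) ^ n * Complex.Gamma (z + j - h - 1 / 2) * E0) * this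
    have hI : Complex.I ^ (-(m1 + m4)) = (-1 : ℂ) ^ ((m1 + m4) / 2) := by
      obtain ⟨r, hr⟩ : ∃ r : ℤ, m1 + m4 = 2 * r := ⟨t + m4, by omega⟩
      rw [hr, Int.mul_ediv_cancel_left _ (by norm_num), show -(2 * r) = 2 * (-r) by ring, zpow_mul,
        show Complex.I ^ (2 : ℤ) = -1 by
          rw [show (2 : ℤ) = (2 : ℕ) by rfl, zpow_natCast, Complex.I_sq],
        zpow_neg, ← inv_zpow]
      norm_num
    have hcc : cc j m4 * cc j m4 = ((2 * j - n).factorial : ℂ) * n.factorial := by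
      rw [cc_sq, show ((j : ℤ) + m4).toNat = 2 * j - n by omega, show ((j : ℤ) - m4).toNat = n by omega]
    rw [← hcc] at E
    rw [mul_assoc _ ((1 / 4 : ℂ) ^ j), T3, hI,
      show z + ((m4 : ℂ) - m1 - 1) / 2 = z + j - h - 1 / 2 by
        rw [c1, c4]; linear_combination -hhc / 2,
      show (1 - 2 * (j : ℂ) - m1 + m4) / 2 = 1 / 2 - h by
        rw [c1, c4]; linear_combination -hhc / 2, add_comm (j : ℂ) z]
    have n1 := cc_ne j m1
    have n4 := cc_ne j m4
    have E2 : E0 = ((2 * j).factorial : ℂ) * Real.pi /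
        (Complex.Gamma (1 / 2 - (h : ℂ)) * Complex.Gamma (z + j)) * F / (cc j m4 * cc j m4) := by
      rw [eq_div_iff (mul_ne_zero n4 n4), ← E]; ring
    rw [E2, div_eq_mul_inv _ (Complex.Gamma (1 / 2 - (h : ℂ)) * Complex.Gamma (z + j)),
      div_eq_mul_inv _ (Complex.Gamma (1 / 2 - (h : ℂ)) * Complex.Gamma (z + j))]
    generalize (Complex.Gamma (1 / 2 - (h : ℂ)) * Complex.Gamma (z + j))⁻¹ = G
    generalize Complex.Gamma (z + j - h - 1 / 2) = G2
    field_simp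

end

end Stmt1
end

section
/- Let j ≥ 0 be an integer and m1, m4 integers with |m1| ≤ j and |m4| ≤ j, and let x ∈ (0,1) be real. If m1 − m4 is odd, then Σ_{k=−j}^{j} (−1)^k · M^j_{m1,k} · N^j_{k,m4} · cos(2k·arcsin(√(1−x))) = 0. If m1 − m4 is even, then Σ_{k=−j}^{j} (−1)^k · M^j_{m1,k} · N^j_{k,m4} · cos(2k·arcsin(√(1−x))) = (c^j_{m1}/c^j_{m4}) · x^{(m4−m1)/2} · (1−x)^{−(m1+m4)/2} · P^{(m4−m1, −m1−m4)}_{j+m1}(1−2x). -/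
namespace Stmt2

noncomputable section

/-- Pochhammer symbol `(a)^{(k)} = a(a+1)⋯(a+k−1)` with natural exponent. -/
def pochN (a : ℂ) (k : ℕ) : ℂ := ∏ i ∈ Finset.range k, (a + i)

/-- Pochhammer symbol with complex exponent, `(a)^{(w)} = Γ(a+w)/Γ(a)`. -/
def pochC (a w : ℂ) : ℂ := Complex.Gamma (a + w) / Complex.Gamma a

/-- Generalized binomial coefficient `C(w,k) = w(w−1)⋯(w−k+1)/k!`. -/
def genBinom (w : ℂ) (k : ℕ) : ℂ := (∏ i ∈ Finset.range k, (w - i)) / (Nat.factorial k : ℂ)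

/-- Jacobi polynomial `P^{(α,β)}_n(x)`. -/
def jacobiP (n : ℕ) (α β x : ℂ) : ℂ :=
  ∑ s ∈ Finset.range (n + 1),
    genBinom ((n : ℂ) + α) (n - s) * genBinom ((n : ℂ) + β) s *
      ((x - 1) / 2) ^ s * ((x + 1) / 2) ^ (n - s)

/-- `c^j_m = √((j+m)!(j−m)!)`. -/
def cc (j : ℕ) (m : ℤ) : ℂ :=
  (Real.sqrt ((Nat.factorial ((j : ℤ) + m).toNat) * (Nat.factorial ((j : ℤ) - m).toNat)) : ℝ)

/-- Truncation index of a terminating hypergeometric series: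
`min {k : ℕ | −k is among the numerator parameters}`. -/
def truncN (as : List ℂ) : ℕ := sInf {k : ℕ | (-(k : ℂ)) ∈ as}

/-- Terminating hypergeometric sum `ₚF_q(as; bs; x) = Σ_{k=0}^{N} (as)ₖ/(bs)ₖ · xᵏ/k!`,
where `N` is the smallest `k` such that `−k` is a numerator parameter. -/
def pFq (as bs : List ℂ) (x : ℂ) : ℂ :=
  ∑ k ∈ Finset.range (truncN as + 1),
    ((as.map fun a => pochN a k).prod / (bs.map fun b => pochN b k).prod) * x ^ k /
      (Nat.factorial k : ℂ)

/-- `Q(z,m) = π·2^{2−2z}·Γ(2z−1)/(Γ(z+m)·Γ(z−m))`. -/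
def Qf (z m : ℂ) : ℂ :=
  (Real.pi : ℂ) * (2 : ℂ) ^ ((2 : ℂ) - 2 * z) * Complex.Gamma (2 * z - 1) /
    (Complex.Gamma (z + m) * Complex.Gamma (z - m))

/-- Change-of-basis matrix entry `M^j_{m,m'}`. -/
def Mmat (j : ℕ) (m m' : ℤ) : ℂ :=
  (cc j m' / cc j m) * Complex.I ^ (m' - m) * (2 : ℂ) ^ (-m') *
    jacobiP ((j : ℤ) - m').toNat ((m' : ℂ) - m) ((m' : ℂ) + m) 0

/-- Change-of-basis matrix entry `N^j_{m,m'}`. -/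
def Nmat (j : ℕ) (m m' : ℤ) : ℂ :=
  (cc j m' / cc j m) * Complex.I ^ (m - m') * (2 : ℂ) ^ (-m') *
    jacobiP ((j : ℤ) - m').toNat ((m' : ℂ) - m) ((m' : ℂ) + m) 0

/-- Intertwining-operator matrix entry `S^j_{m,m'}(z) = Σ_k (−1)^k M^j_{m,k} N^j_{k,m'} Q(z,k)`. -/
def Smat (j : ℕ) (m m' : ℤ) (z : ℂ) : ℂ :=
  ∑ k ∈ Finset.Icc (-(j : ℤ)) (j : ℤ), (-1 : ℂ) ^ k * Mmat j m k * Nmat j k m' * Qf z (k : ℂ)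

open Polynomial in
/-- Coefficients of a power of a linear polynomial. -/
lemma coeff_lin (u v : ℂ) (a n : ℕ) :
    ((C u + C v * X : ℂ[X]) ^ a).coeff n = (a.choose n : ℂ) * u ^ (a - n) * v ^ n := by
  rw [add_comm, add_pow, finsetSum_coeff]
  have : ∀ m ∈ Finset.range (a + 1),
      (((C v * X : ℂ[X]) ^ m * C u ^ (a - m) * ((a.choose m : ℕ) : ℂ[X])).coeff n) =
      if n = m then (a.choose m : ℂ) * u ^ (a - m) * v ^ m else 0 := by
    intro m _
    have e : ((C v * X : ℂ[X]) ^ m * C u ^ (a - m) * ((a.choose m : ℕ) : ℂ[X])) =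
        C ((a.choose m : ℂ) * u ^ (a - m) * v ^ m) * X ^ m := by
      simp only [mul_pow, C_mul, C_pow, map_natCast]; ring
    rw [e, coeff_C_mul_X_pow]
  rw [Finset.sum_congr rfl this, Finset.sum_ite_eq]
  split_ifs with h
  · rfl
  · rw [Nat.choose_eq_zero_of_lt (by simpa using h)]; simp

open Polynomial in
lemma coeff_lin_mul (u v u' v' : ℂ) (a b p : ℕ) :
    ((C u + C v * X : ℂ[X]) ^ a * (C u' + C v' * X) ^ b).coeff p =
      ∑ r ∈ Finset.range (p + 1), ((a.choose (p - r) : ℂ) * u ^ (a - (p - r)) * v ^ (p - r)) *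
        ((b.choose r : ℂ) * u' ^ (b - r) * v' ^ r) := by
  rw [mul_comm, coeff_mul, Finset.Nat.sum_antidiagonal_eq_sum_range_succ_mk]
  refine Finset.sum_congr rfl fun r _ => ?_
  rw [coeff_lin, coeff_lin]; ring

lemma genBinom_nat (n k : ℕ) : genBinom (n : ℂ) k = (n.choose k : ℂ) := by
  have h : ∏ i ∈ Finset.range k, ((n : ℂ) - i) = (n.descFactorial k : ℂ) := by
    induction k with
    | zero => simp
    | succ k ih =>
      rw [Finset.prod_range_succ, ih, Nat.descFactorial_succ]
      rcases le_or_gt k n with hk | hk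
      · push_cast [Nat.cast_sub hk]; ring
      · rw [Nat.descFactorial_of_lt hk]; simp
  unfold genBinom
  rw [h, Nat.descFactorial_eq_factorial_mul_choose, Nat.cast_mul]
  have : (k.factorial : ℂ) ≠ 0 := by exact_mod_cast k.factorial_ne_zero
  field_simp

/-- Krawtchouk coefficient. -/
def Kr (a b n : ℕ) : ℂ :=
  ((Polynomial.C 1 + Polynomial.C 1 * Polynomial.X : Polynomial ℂ) ^ a *
    (Polynomial.C 1 + Polynomial.C (-1) * Polynomial.X) ^ b).coeff n

lemma jacobi_zero (n a b : ℕ) (α β : ℂ) (ha : (n : ℂ) + α = a) (hb : (n : ℂ) + β = b) :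
    jacobiP n α β 0 = (2 : ℂ)⁻¹ ^ n * Kr a b n := by
  unfold jacobiP Kr
  rw [coeff_lin_mul, Finset.mul_sum]
  refine Finset.sum_congr rfl fun s hs => ?_
  rw [ha, hb, genBinom_nat, genBinom_nat]
  have : n = s + (n - s) := by simp at hs; omega
  have e : (2 : ℂ)⁻¹ ^ n = 2⁻¹ ^ s * 2⁻¹ ^ (n - s) := by rw [← pow_add, ← this]
  rw [e]
  have e2 : ((0 - 1 : ℂ) / 2) ^ s = (-1) ^ s * 2⁻¹ ^ s := by rw [← mul_pow]; norm_num
  rw [e2]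
  simp
  ring

open Polynomial in
/-- Homogenization. -/
def hom (A B : ℂ[X]) (N : ℕ) (P : ℂ[X]) : ℂ[X] :=
  ∑ n ∈ Finset.range (N + 1), C (P.coeff n) * A ^ n * B ^ (N - n)

open Polynomial in
lemma hom_step (A B : ℂ[X]) (N : ℕ) (P : ℂ[X]) (hP : P.natDegree ≤ N) (w : ℂ) :
    hom A B (N + 1) (P * (C 1 + C w * X)) = hom A B N P * (B + C w * A) := by
  have h0 : P.coeff (N + 1) = 0 := coeff_eq_zero_of_natDegree_lt (by omega)
  have e1 : hom A B (N + 1) P = hom A B N P * B := by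
    unfold hom
    rw [Finset.sum_range_succ, h0, Finset.sum_mul]
    simp only [map_zero, zero_mul, add_zero]
    refine Finset.sum_congr rfl fun n hn => ?_
    have : N + 1 - n = (N - n) + 1 := by simp at hn; omega
    rw [this]; ring
  have e2 : hom A B (N + 1) (P * X) = hom A B N P * A := by
    unfold hom
    rw [Finset.sum_range_succ', Finset.sum_mul]
    simp only [coeff_mul_X, mul_coeff_zero, coeff_X_zero, mul_zero, map_zero, zero_mul, add_zero]
    refine Finset.sum_congr rfl fun n hn => ?_
    have : N + 1 - (n + 1) = (N - n) := by omega
    rw [this]; ring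
  have e3 : hom A B (N + 1) (P * (C 1 + C w * X)) =
      hom A B (N + 1) P + C w * hom A B (N + 1) (P * X) := by
    have : P * (C 1 + C w * X) = P + C w * (P * X) := by rw [C_1]; ring
    rw [this]
    unfold hom
    rw [Finset.mul_sum, ← Finset.sum_add_distrib]
    refine Finset.sum_congr rfl fun n hn => ?_
    rw [coeff_add, coeff_C_mul, C_add, C_mul]; ring
  rw [e3, e1, e2]; ring

open Polynomial in
lemma deg_lin (w : ℂ) (a : ℕ) : ((C 1 + C w * X : ℂ[X]) ^ a).natDegree ≤ a := by
  have h1 : (C 1 + C w * X : ℂ[X]).natDegree ≤ 1 := by compute_degree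
  calc _ ≤ a * (C 1 + C w * X : ℂ[X]).natDegree := natDegree_pow_le
    _ ≤ a * 1 := Nat.mul_le_mul_left a h1
    _ = a := mul_one a

open Polynomial in
lemma hom_lin (A B : ℂ[X]) (a b : ℕ) :
    hom A B (a + b) ((C 1 + C 1 * X) ^ a * (C 1 + C (-1) * X) ^ b) =
      (B + A) ^ a * (B - A) ^ b := by
  induction b with
  | zero =>
    induction a with
    | zero => simp [hom]
    | succ a ih =>
      have := hom_step A B (a + 0) ((C 1 + C 1 * X) ^ a * (C 1 + C (-1) * X) ^ 0)
        (by simpa using deg_lin 1 a) 1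
      rw [ih] at this
      have e : a + 1 + 0 = a + 0 + 1 := by omega
      rw [e]
      simp only [pow_zero, mul_one, pow_succ, C_1, one_mul] at this ⊢
      exact this
  | succ b ih =>
    have := hom_step A B (a + b) ((C 1 + C 1 * X) ^ a * (C 1 + C (-1) * X) ^ b)
        (natDegree_mul_le_of_le (deg_lin 1 a) (deg_lin (-1) b)) (-1)
    rw [ih] at this
    rw [← add_assoc, pow_succ, ← mul_assoc, this]
    simp only [C_neg, C_1]
    ring

/-- The double Krawtchouk sum. -/
def SS (a b p : ℕ) (E F : ℂ) : ℂ :=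
  ∑ n ∈ Finset.range (a + b + 1), Kr a b n * Kr n (a + b - n) p * (F ^ n * E ^ (a + b - n))

open Polynomial in
lemma SS_eq (a b p : ℕ) (E F : ℂ) :
    SS a b p E F = ∑ r ∈ Finset.range (p + 1),
      ((a.choose (p - r) : ℂ) * (E + F) ^ (a - (p - r)) * (F - E) ^ (p - r)) *
        ((b.choose r : ℂ) * (E - F) ^ (b - r) * (-(E + F)) ^ r) := by
  rw [← coeff_lin_mul]
  have h := hom_lin (C F * (C 1 + C 1 * X)) (C E * (C 1 + C (-1) * X)) a b
  have e1 : (C E * (C 1 + C (-1) * X) + C F * (C 1 + C 1 * X) : ℂ[X]) =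
      C (E + F) + C (F - E) * X := by
    simp only [C_add, C_sub, C_neg, C_1]; ring
  have e2 : (C E * (C 1 + C (-1) * X) - C F * (C 1 + C 1 * X) : ℂ[X]) =
      C (E - F) + C (-(E + F)) * X := by
    simp only [C_add, C_sub, C_neg, C_1]; ring
  rw [e1, e2] at h
  rw [← h]
  unfold hom SS
  rw [finsetSum_coeff]
  refine Finset.sum_congr rfl fun n hn => ?_
  rw [show ∀ c : ℂ, C c * (C F * (C 1 + C 1 * X)) ^ n * (C E * (C 1 + C (-1) * X)) ^ (a + b - n)
    = C (c * (F ^ n * E ^ (a + b - n))) *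
      ((C 1 + C 1 * X) ^ n * (C 1 + C (-1) * X : ℂ[X]) ^ (a + b - n)) by
    intro c; simp only [mul_pow, C_mul, C_pow]; ring, coeff_C_mul]
  unfold Kr
  ring

lemma SS_swap (a b p : ℕ) (E F : ℂ) : SS a b p F E = (-1) ^ (b + p) * SS a b p E F := by
  rw [SS_eq, SS_eq, Finset.mul_sum]
  refine Finset.sum_congr rfl fun r hr => ?_
  by_cases hb : b < r
  · rw [Nat.choose_eq_zero_of_lt hb]; simp
  have hr' : r ≤ p := by simp at hr; omega
  have e1 : (E - F) ^ (p - r) = (-1) ^ (p - r) * (F - E) ^ (p - r) := by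
    rw [← mul_pow]; congr 1; ring
  have e2 : (F - E) ^ (b - r) = (-1) ^ (b - r) * (E - F) ^ (b - r) := by
    rw [← mul_pow]; congr 1; ring
  have e3 : ((-1 : ℂ)) ^ (b + p) = (-1) ^ (p - r) * (-1) ^ (b - r) := by
    rw [← pow_add, show b + p = (p - r + (b - r)) + 2 * r by omega, pow_add _ _ (2 * r), pow_mul]
    simp
  rw [e1, e2, e3, add_comm F E]; ring

lemma cc_sq (j : ℕ) (m : ℤ) (a b : ℕ) (ha : (a : ℤ) = j - m) (hb : (b : ℤ) = j + m) :
    cc j m ^ 2 = (b.factorial : ℂ) * a.factorial := by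
  unfold cc
  rw [← ha, ← hb, Int.toNat_natCast, Int.toNat_natCast, ← Complex.ofReal_pow, Real.sq_sqrt (by positivity)]
  push_cast; rfl

lemma cc_ne (j : ℕ) (m : ℤ) : cc j m ≠ 0 := by
  unfold cc
  rw [Complex.ofReal_ne_zero]
  positivity

lemma Mmat_eq (j : ℕ) (m k : ℤ) (a b n : ℕ) (ha : (a : ℤ) = j - m) (hb : (b : ℤ) = j + m)
    (hn : (n : ℤ) = j - k) :
    Mmat j m k = (cc j k / cc j m) * Complex.I ^ (k - m) * (2⁻¹ ^ j * Kr a b n) := by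
  unfold Mmat
  have ha' : (a : ℂ) = j - m := by exact_mod_cast congrArg (Int.cast : ℤ → ℂ) ha
  have hb' : (b : ℂ) = j + m := by exact_mod_cast congrArg (Int.cast : ℤ → ℂ) hb
  have hn' : (n : ℂ) = j - k := by exact_mod_cast congrArg (Int.cast : ℤ → ℂ) hn
  rw [← hn, Int.toNat_natCast, jacobi_zero n a b _ _ (by rw [ha', hn']; ring) (by rw [hb', hn']; ring)]
  have : (2 : ℂ) ^ (-k) * 2⁻¹ ^ n = 2⁻¹ ^ j := by
    rw [← zpow_natCast, ← zpow_natCast, inv_zpow', inv_zpow', ← zpow_add₀ (by norm_num)]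
    congr 1; omega
  rw [← this]; ring

lemma Nmat_eq (j : ℕ) (m k : ℤ) (a b n : ℕ) (ha : (a : ℤ) = j - m) (hb : (b : ℤ) = j + m)
    (hn : (n : ℤ) = j - k) :
    Nmat j m k = (cc j k / cc j m) * Complex.I ^ (m - k) * (2⁻¹ ^ j * Kr a b n) := by
  have h := Mmat_eq j m k a b n ha hb hn
  unfold Mmat at h
  unfold Nmat
  have hc : (cc j k / cc j m) ≠ 0 := div_ne_zero (cc_ne _ _) (cc_ne _ _)
  have hI : Complex.I ^ (k - m) ≠ 0 := zpow_ne_zero _ Complex.I_ne_zero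
  rw [mul_assoc ((cc j k / cc j m) * Complex.I ^ (k - m))] at h
  have := mul_left_cancel₀ (mul_ne_zero hc hI) h
  rw [← this]; ring

lemma lhs_eq (j : ℕ) (m1 m4 : ℤ) (a b p : ℕ) (ha : (a : ℤ) = j - m1) (hb : (b : ℤ) = j + m1)
    (hp : (p : ℤ) = j - m4) (θ : ℝ) :
    ∑ k ∈ Finset.Icc (-(j : ℤ)) (j : ℤ),
          (-1 : ℂ) ^ k * Mmat j m1 k * Nmat j k m4 * (Real.cos (2 * k * θ) : ℂ) =
    (cc j m4 / cc j m1) * Complex.I ^ (-m1 - m4) * (4⁻¹ ^ j) *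
      ((SS a b p (Complex.exp (θ * Complex.I)) (Complex.exp (-θ * Complex.I)) +
       SS a b p (Complex.exp (-θ * Complex.I)) (Complex.exp (θ * Complex.I))) / 2) := by
  unfold SS
  rw [← Finset.sum_add_distrib, Finset.sum_div, Finset.mul_sum]
  refine Finset.sum_nbij' (fun k => ((j : ℤ) - k).toNat) (fun n => (j : ℤ) - n) ?_ ?_ ?_ ?_ ?_
  · intro k hk; simp at hk ⊢; omega
  · intro n hn; simp at hn ⊢; omega
  · intro k hk; simp at hk ⊢; omega
  · intro n hn; simp at hn ⊢
  · intro k hk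
    simp only [Finset.mem_Icc] at hk
    obtain ⟨n, hn⟩ : ∃ n : ℕ, (n : ℤ) = j - k := ⟨((j : ℤ) - k).toNat, by omega⟩
    obtain ⟨l, hl⟩ : ∃ l : ℕ, (l : ℤ) = j + k := ⟨((j : ℤ) + k).toNat, by omega⟩
    rw [← hn, Int.toNat_natCast, Mmat_eq j m1 k a b n ha hb hn, Nmat_eq j k m4 n l p hn hl hp,
      show a + b - n = l by omega]
    have hn' : (n : ℂ) = j - k := by exact_mod_cast congrArg (Int.cast : ℤ → ℂ) hn
    have hl' : (l : ℂ) = j + k := by exact_mod_cast congrArg (Int.cast : ℤ → ℂ) hl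
    have hI : (-1 : ℂ) ^ k * (Complex.I ^ (k - m1) * Complex.I ^ (k - m4)) = Complex.I ^ (-m1 - m4) := by
      rw [← zpow_add₀ Complex.I_ne_zero,
        show k - m1 + (k - m4) = 2 * k + (-m1 - m4) by ring, zpow_add₀ Complex.I_ne_zero, zpow_mul]
      have : Complex.I ^ (2 : ℤ) = -1 := by
        rw [show (2 : ℤ) = ((2 : ℕ) : ℤ) by rfl, zpow_natCast, Complex.I_sq]
      rw [this, ← mul_assoc, ← mul_zpow]; simp
    have hcos : (Real.cos (2 * k * θ) : ℂ) =
        (Complex.exp (-θ * Complex.I) ^ n * Complex.exp (θ * Complex.I) ^ l +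
          Complex.exp (θ * Complex.I) ^ n * Complex.exp (-θ * Complex.I) ^ l) / 2 := by
      simp only [← Complex.exp_nat_mul, ← Complex.exp_add]
      rw [Complex.ofReal_cos, Complex.cos, hn', hl']
      push_cast
      congr 3 <;> ring
    have h4 : (4 : ℂ)⁻¹ ^ j = 2⁻¹ ^ j * 2⁻¹ ^ j := by rw [← mul_pow]; norm_num
    rw [← hI, hcos, h4]
    have h1 := cc_ne j k
    have h2 := cc_ne j m1
    field_simp

lemma choose_rel (u v t r : ℕ) :
    (((u + v).factorial : ℂ) * (t + r).factorial) * ((t + v).choose t * (u + r).choose r) =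
    (((u + r).factorial : ℂ) * (t + v).factorial) * ((u + v).choose u * (t + r).choose r) := by
  have f : ∀ n : ℕ, (n.factorial : ℂ) ≠ 0 := fun n => by exact_mod_cast n.factorial_ne_zero
  have h : ∀ x y : ℕ, ((x + y).choose x : ℂ) = (x + y).factorial / (x.factorial * y.factorial) :=
    fun x y => Nat.cast_add_choose ℂ
  have h' : ∀ x y : ℕ, ((x + y).choose y : ℂ) = (x + y).factorial / (x.factorial * y.factorial) :=
    fun x y => by rw [add_comm x y, h, mul_comm (x.factorial : ℂ)]
  rw [h, h, h', h']
  have := f u; have := f v; have := f t; have := f r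
  field_simp

lemma term_eq (c4 c1 c s : ℂ) (hc0 : c ≠ 0) (hs0 : s ≠ 0) (h1 : c1 ≠ 0) (h4 : c4 ≠ 0)
    (u v t r j : ℕ) (d e : ℤ)
    (hj : u + v + t + r = 2 * j)
    (hd : (v : ℤ) - r = 2 * d) (he : (u : ℤ) - t = 2 * e)
    (hc4 : c4 ^ 2 = ((u + v).factorial : ℂ) * (t + r).factorial)
    (hc1 : c1 ^ 2 = ((u + r).factorial : ℂ) * (t + v).factorial) :
    (c4 / c1) * Complex.I ^ (-(2 * e)) * (4⁻¹ ^ j) *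
      ((((t + v).choose t : ℂ) * (2 * c) ^ v * (-(2 * Complex.I * s)) ^ t) *
        (((u + r).choose r : ℂ) * (2 * Complex.I * s) ^ u * (-(2 * c)) ^ r)) =
    (c1 / c4) * (c ^ 2) ^ d * (s ^ 2) ^ (-e) *
      (((u + v).choose u : ℂ) * (t + r).choose r * (-(c ^ 2)) ^ r * (s ^ 2) ^ u) := by
  have hch := choose_rel u v t r
  rw [← hc4, ← hc1] at hch
  have hI : Complex.I ^ (-(2 * e)) * ((-Complex.I) ^ t * Complex.I ^ u) = 1 := by
    have : (-Complex.I) ^ t = Complex.I ^ (-(t : ℤ)) := by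
      rw [zpow_neg, zpow_natCast, ← inv_pow, Complex.inv_I]
    rw [this, ← zpow_natCast, ← zpow_add₀ Complex.I_ne_zero, ← zpow_add₀ Complex.I_ne_zero]
    rw [show -(2 * e) + (-(t : ℤ) + u) = 0 by omega, zpow_zero]
  have h2 : (4 : ℂ)⁻¹ ^ j * (2 ^ v * 2 ^ t * 2 ^ u * 2 ^ r) = 1 := by
    rw [← pow_add, ← pow_add, ← pow_add, show v + t + u + r = 2 * j by omega, pow_mul, ← mul_pow]
    norm_num
  have hcp : c ^ v * c ^ r = (c ^ 2) ^ d * (c ^ 2) ^ r := by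
    rw [← zpow_natCast, ← zpow_natCast, ← zpow_natCast, ← zpow_natCast, ← zpow_mul, ← zpow_mul,
      ← zpow_add₀ hc0, ← zpow_add₀ hc0]
    congr 1; push_cast; omega
  have hsp : s ^ t * s ^ u = (s ^ 2) ^ (-e) * (s ^ 2) ^ u := by
    rw [← zpow_natCast, ← zpow_natCast, ← zpow_natCast, ← zpow_natCast, ← zpow_mul, ← zpow_mul,
      ← zpow_add₀ hs0, ← zpow_add₀ hs0]
    congr 1; push_cast; omega
  have hch' : (c4 / c1) * ((t + v).choose t * (u + r).choose r) =
      (c1 / c4) * ((u + v).choose u * (t + r).choose r) := by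
    field_simp
    linear_combination hch
  have x1 : (-(2 * Complex.I * s)) ^ t = 2 ^ t * (-Complex.I) ^ t * s ^ t := by
    rw [← mul_pow, ← mul_pow]; congr 1; ring
  have x2 : (-(2 * c)) ^ r = (-1) ^ r * 2 ^ r * c ^ r := by
    rw [← mul_pow, ← mul_pow]; congr 1; ring
  have x3 : (-(c ^ 2)) ^ r = (-1) ^ r * (c ^ 2) ^ r := by
    rw [← mul_pow]; congr 1; ring
  rw [x1, x2, x3, mul_pow 2 c v, mul_pow (2 * Complex.I) s, mul_pow 2 Complex.I]
  calc _ = ((c4 / c1) * ((t + v).choose t * (u + r).choose r)) *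
        (Complex.I ^ (-(2 * e)) * ((-Complex.I) ^ t * Complex.I ^ u)) *
        ((4 : ℂ)⁻¹ ^ j * (2 ^ v * 2 ^ t * 2 ^ u * 2 ^ r)) * (-1) ^ r *
        (c ^ v * c ^ r) * (s ^ t * s ^ u) := by ring
    _ = _ := by rw [hch', hI, h2, hcp, hsp]; ring

/-- The diagonalized sum of change-of-basis matrices against `cos(2k·arcsin √(1−x))`:
zero for `m1 − m4` odd, and a Jacobi polynomial `P^{(m4−m1,−m1−m4)}_{j+m1}(1−2x)` for
`m1 − m4` even. -/
theorem stmt_2 (j : ℕ) (m1 m4 : ℤ) (h1 : |m1| ≤ (j : ℤ)) (h4 : |m4| ≤ (j : ℤ))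
    (x : ℝ) (hx : x ∈ Set.Ioo (0 : ℝ) 1) :
    (Odd (m1 - m4) →
      ∑ k ∈ Finset.Icc (-(j : ℤ)) (j : ℤ),
          (-1 : ℂ) ^ k * Mmat j m1 k * Nmat j k m4 *
            (Real.cos (2 * k * Real.arcsin (Real.sqrt (1 - x))) : ℂ) = 0) ∧
      (Even (m1 - m4) →
        ∑ k ∈ Finset.Icc (-(j : ℤ)) (j : ℤ),
            (-1 : ℂ) ^ k * Mmat j m1 k * Nmat j k m4 *
              (Real.cos (2 * k * Real.arcsin (Real.sqrt (1 - x))) : ℂ) =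
          (cc j m1 / cc j m4) * (x : ℂ) ^ ((m4 - m1) / 2) *
            ((1 : ℂ) - x) ^ (-((m1 + m4) / 2)) *
            jacobiP ((j : ℤ) + m1).toNat ((m4 : ℂ) - m1) (-(m1 : ℂ) - m4)
              (1 - 2 * x)) := by
  obtain ⟨hx0, hx1⟩ := hx
  rw [abs_le] at h1 h4
  obtain ⟨a, ha⟩ : ∃ n : ℕ, (n : ℤ) = j - m1 := ⟨((j : ℤ) - m1).toNat, by omega⟩
  obtain ⟨b, hb⟩ : ∃ n : ℕ, (n : ℤ) = j + m1 := ⟨((j : ℤ) + m1).toNat, by omega⟩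
  obtain ⟨p, hp⟩ : ∃ n : ℕ, (n : ℤ) = j - m4 := ⟨((j : ℤ) - m4).toNat, by omega⟩
  obtain ⟨q, hq⟩ : ∃ n : ℕ, (n : ℤ) = j + m4 := ⟨((j : ℤ) + m4).toNat, by omega⟩
  set θ := Real.arcsin (Real.sqrt (1 - x)) with hθ
  rw [lhs_eq j m1 m4 a b p ha hb hp θ, SS_swap a b p (Complex.exp (θ * Complex.I)) (Complex.exp (-θ * Complex.I))]
  constructor
  · rintro ⟨w, hw⟩
    have : Odd (b + p) := by
      rw [← Int.odd_coe_nat]; push_cast; exact ⟨j + w, by omega⟩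
    rw [this.neg_one_pow]; ring
  · rintro ⟨w, hw⟩
    have hev : Even (b + p) := by
      rw [← Int.even_coe_nat]; push_cast; exact ⟨j + w, by omega⟩
    rw [hev.neg_one_pow, one_mul, add_self_div_two, SS_eq]
    have hsin : Real.sin θ = Real.sqrt (1 - x) :=
      Real.sin_arcsin (by linarith [Real.sqrt_nonneg (1 - x)])
        (Real.sqrt_le_one.mpr (by linarith))
    have hcos : Real.cos θ = Real.sqrt x := by
      rw [hθ, Real.cos_arcsin, Real.sq_sqrt (by linarith)]; congr 1; ring
    have hs0 : (Real.sin θ : ℂ) ≠ 0 := by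
      rw [hsin, Complex.ofReal_ne_zero]; exact (Real.sqrt_pos.mpr (by linarith)).ne'
    have hc0 : (Real.cos θ : ℂ) ≠ 0 := by
      rw [hcos, Complex.ofReal_ne_zero]; exact (Real.sqrt_pos.mpr hx0).ne'
    have hs2 : (1 : ℂ) - x = (Real.sin θ : ℂ) ^ 2 := by
      rw [hsin, ← Complex.ofReal_pow, Real.sq_sqrt (by linarith)]; push_cast; ring
    have hc2 : (x : ℂ) = (Real.cos θ : ℂ) ^ 2 := by
      rw [hcos, ← Complex.ofReal_pow, Real.sq_sqrt hx0.le]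
    have hE : Complex.exp (θ * Complex.I) = Real.cos θ + Real.sin θ * Complex.I := by
      rw [Complex.exp_mul_I]; push_cast; rfl
    have hF : Complex.exp (-θ * Complex.I) = Real.cos θ - Real.sin θ * Complex.I := by
      rw [Complex.exp_mul_I, Complex.cos_neg, Complex.sin_neg]; push_cast; ring
    have hb' : (b : ℂ) = j + m1 := by exact_mod_cast congrArg (Int.cast : ℤ → ℂ) hb
    have hp' : (p : ℂ) = j - m4 := by exact_mod_cast congrArg (Int.cast : ℤ → ℂ) hp
    have hq' : (q : ℂ) = j + m4 := by exact_mod_cast congrArg (Int.cast : ℤ → ℂ) hq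
    have hd : (m4 - m1) / 2 = -w := by omega
    have he : (m1 + m4) / 2 = m1 - w := by omega
    rw [hE, hF, ← hb, Int.toNat_natCast, hd, he, show -m1 - m4 = -(2 * (m1 - w)) by omega]
    unfold jacobiP
    rw [show (b : ℂ) + ((m4 : ℂ) - m1) = q by rw [hb', hq']; ring,
      show (b : ℂ) + (-(m1 : ℂ) - m4) = p by rw [hb', hp']; ring,
      show ((1 - 2 * (x : ℂ) - 1) / 2) = -x by ring,
      show ((1 - 2 * (x : ℂ) + 1) / 2) = 1 - x by ring, hs2, hc2]
    simp only [genBinom_nat]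
    generalize (Real.cos θ : ℂ) = c at *
    generalize (Real.sin θ : ℂ) = s at *
    rw [show c + s * Complex.I + (c - s * Complex.I) = 2 * c by ring,
      show c - s * Complex.I - (c + s * Complex.I) = -(2 * Complex.I * s) by ring,
      show c + s * Complex.I - (c - s * Complex.I) = 2 * Complex.I * s by ring]
    rw [← Finset.sum_subset (s₂ := Finset.range (p + 1)) (s₁ := Finset.range (min p b + 1)),
      ← Finset.sum_subset (s₂ := Finset.range (b + 1)) (s₁ := Finset.range (min p b + 1)),
      Finset.mul_sum, Finset.mul_sum]
    rotate_left
    · intro i hi; simp only [Finset.mem_range] at hi ⊢; omega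
    · intro r hr hr'
      simp only [Finset.mem_range] at hr hr'
      rw [Nat.choose_eq_zero_of_lt (show p < r by omega)]; simp
    · intro i hi; simp only [Finset.mem_range] at hi ⊢; omega
    · intro r hr hr'
      simp only [Finset.mem_range] at hr hr'
      rw [Nat.choose_eq_zero_of_lt (show b < r by omega)]; simp
    refine Finset.sum_congr rfl fun r hr => ?_
    simp only [Finset.mem_range] at hr
    by_cases hpa : p - r ≤ a
    · have hqe : q = (b - r) + (a - (p - r)) := by omega
      have hae : a = (p - r) + (a - (p - r)) := by omega
      have hbe : b = (b - r) + r := by omega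
      have hpe : p = (p - r) + r := by omega
      have hc4 := cc_sq j m4 p q hp hq
      have hc1 := cc_sq j m1 a b ha hb
      have key := term_eq (cc j m4) (cc j m1) c s hc0 hs0 (cc_ne _ _) (cc_ne _ _)
        (b - r) (a - (p - r)) (p - r) r j (-w) (m1 - w) (by omega) (by omega) (by omega)
        (by rw [← hqe, ← hpe]; exact hc4) (by rw [← hae, ← hbe]; exact hc1)
      rw [← hqe, ← hae, ← hbe, ← hpe] at key
      exact key
    · rw [Nat.choose_eq_zero_of_lt (show a < p - r by omega),
        Nat.choose_eq_zero_of_lt (show q < b - r by omega)]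
      simp

end

end Stmt2
end

section
/- For all s1, s2 ∈ ℂ with Re(s1 + s2) < −1, the integral ∫_{−∞}^{∞} (1+it)^{s1} · (1−it)^{s2} dt converges and equals π · 2^{s1+s2+2} · Γ(−s1−s2−1) / (Γ(−s1) · Γ(−s2)). -/
open MeasureTheory Filter Topology Set FourierTransform

lemma aux_norm_add (t : ℝ) : ‖(1 + Complex.I * t : ℂ)‖ = (1 + t ^ 2) ^ (1 / 2 : ℝ) := by
  rw [Complex.norm_eq_sqrt_sq_add_sq, Real.sqrt_eq_rpow]; simp

lemma aux_norm_sub (t : ℝ) : ‖(1 - Complex.I * t : ℂ)‖ = (1 + t ^ 2) ^ (1 / 2 : ℝ) := by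
  rw [Complex.norm_eq_sqrt_sq_add_sq, Real.sqrt_eq_rpow]; simp

lemma aux_cpow_bound (z s : ℂ) : ‖z ^ s‖ ≤ ‖z‖ ^ s.re * Real.exp (Real.pi * |s.im|) := by
  refine (Complex.norm_cpow_le z s).trans ?_
  rw [div_eq_mul_inv, ← Real.exp_neg]
  gcongr
  have h1 := Complex.abs_arg_le_pi z
  calc -(z.arg * s.im) ≤ |z.arg * s.im| := neg_le_abs _
    _ = |z.arg| * |s.im| := abs_mul _ _
    _ ≤ _ := by gcongr

lemma aux_mem_add (t : ℝ) : (1 + Complex.I * t : ℂ) ∈ Complex.slitPlane := by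
  left; simp

lemma aux_mem_sub (t : ℝ) : (1 - Complex.I * t : ℂ) ∈ Complex.slitPlane := by
  left; simp

lemma aux_bound (s1 s2 : ℂ) (t : ℝ) :
    ‖(1 + Complex.I * t : ℂ) ^ s1 * (1 - Complex.I * t) ^ s2‖ ≤
      (Real.exp (Real.pi * |s1.im|) * Real.exp (Real.pi * |s2.im|)) *
        (1 + ‖t‖ ^ 2) ^ (-(-(s1 + s2).re) / 2) := by
  rw [norm_mul]
  have h1 := aux_cpow_bound (1 + Complex.I * t) s1
  have h2 := aux_cpow_bound (1 - Complex.I * t) s2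
  rw [aux_norm_add] at h1
  rw [aux_norm_sub] at h2
  refine (mul_le_mul h1 h2 (norm_nonneg _) (by positivity)).trans (le_of_eq ?_)
  have hp : (0 : ℝ) < 1 + t ^ 2 := by positivity
  rw [← Real.rpow_mul hp.le, ← Real.rpow_mul hp.le, Real.norm_eq_abs, sq_abs, Complex.add_re,
    show (- -(s1.re + s2.re) / 2) = 1 / 2 * s1.re + 1 / 2 * s2.re by ring, Real.rpow_add hp]
  ring

lemma aux_cont (s1 s2 : ℂ) :
    Continuous (fun t : ℝ => (1 + Complex.I * t : ℂ) ^ s1 * (1 - Complex.I * t) ^ s2) := by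
  refine Continuous.mul ?_ ?_
  · exact Continuous.cpow (by fun_prop) (by fun_prop) aux_mem_add
  · exact Continuous.cpow (by fun_prop) (by fun_prop) aux_mem_sub

lemma aux_integrable (s1 s2 : ℂ) (h : (s1 + s2).re < -1) :
    Integrable (fun t : ℝ => (1 + Complex.I * t : ℂ) ^ s1 * (1 - Complex.I * t) ^ s2) := by
  have := (integrable_rpow_neg_one_add_norm_sq (E := ℝ) (μ := volume) (r := -(s1 + s2).re)
    (by simp only [Module.finrank_self, Nat.cast_one]; linarith)).const_mul
      (Real.exp (Real.pi * |s1.im|) * Real.exp (Real.pi * |s2.im|))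
  exact this.mono' (aux_cont s1 s2).aestronglyMeasurable
    (Eventually.of_forall fun t => aux_bound s1 s2 t)

lemma aux_tendsto (s1 s2 : ℂ) (h : (s1 + s2).re < 0) {l : Filter ℝ}
    (hl : Tendsto (fun t : ℝ => ‖t‖) l atTop) :
    Tendsto (fun t : ℝ => (1 + Complex.I * t : ℂ) ^ s1 * (1 - Complex.I * t) ^ s2) l (𝓝 0) := by
  refine squeeze_zero_norm (aux_bound s1 s2) ?_
  rw [← mul_zero (Real.exp (Real.pi * |s1.im|) * Real.exp (Real.pi * |s2.im|))]
  refine Tendsto.const_mul _ ?_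
  have h1 : Tendsto (fun t : ℝ => 1 + ‖t‖ ^ 2) l atTop :=
    tendsto_atTop_add_const_left _ _ ((tendsto_pow_atTop two_ne_zero).comp hl)
  have h2 := (tendsto_rpow_neg_atTop (y := -(s1 + s2).re / 2) (by linarith)).comp h1
  refine h2.congr fun t => ?_
  simp only [Function.comp]
  congr 1; ring

/-- The integral under study. -/
noncomputable def auxI (s1 s2 : ℂ) : ℂ :=
  ∫ t : ℝ, (1 + Complex.I * t : ℂ) ^ s1 * (1 - Complex.I * t) ^ s2

lemma aux_deriv (s1 s2 : ℂ) (t : ℝ) :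
    HasDerivAt (fun t : ℝ => (1 + Complex.I * t : ℂ) ^ s1 * (1 - Complex.I * t) ^ s2)
      (Complex.I * s1 * ((1 + Complex.I * t : ℂ) ^ (s1 - 1) * (1 - Complex.I * t) ^ s2) -
        Complex.I * s2 * ((1 + Complex.I * t : ℂ) ^ s1 * (1 - Complex.I * t) ^ (s2 - 1))) t := by
  have h0 : HasDerivAt (fun z : ℂ => Complex.I * z) (Complex.I) (t : ℂ) := by
    simpa using (hasDerivAt_id (t : ℂ)).const_mul Complex.I
  have h1 := (h0.const_add 1).cpow_const (c := s1) (aux_mem_add t)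
  have h2 := (h0.const_sub 1).cpow_const (c := s2) (aux_mem_sub t)
  convert! (h1.mul h2).comp_ofReal using 1
  ring

lemma aux_parts (s1 s2 : ℂ) (h : (s1 + s2).re < 0) :
    s1 * auxI (s1 - 1) s2 = s2 * auxI s1 (s2 - 1) := by
  have i1 : Integrable (fun t : ℝ => (1 + Complex.I * t : ℂ) ^ (s1 - 1) * (1 - Complex.I * t) ^ s2) :=
    aux_integrable (s1 - 1) s2 (by simp at h ⊢; linarith)
  have i2 : Integrable (fun t : ℝ => (1 + Complex.I * t : ℂ) ^ s1 * (1 - Complex.I * t) ^ (s2 - 1)) :=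
    aux_integrable s1 (s2 - 1) (by simp at h ⊢; linarith)
  have := integral_of_hasDerivAt_of_tendsto (aux_deriv s1 s2)
    ((i1.const_mul _).sub (i2.const_mul _))
    (aux_tendsto s1 s2 h tendsto_abs_atBot_atTop) (aux_tendsto s1 s2 h tendsto_abs_atTop_atTop)
  rw [integral_sub (i1.const_mul _) (i2.const_mul _), integral_const_mul, integral_const_mul] at this
  change Complex.I * s1 * auxI (s1 - 1) s2 - Complex.I * s2 * auxI s1 (s2 - 1) = _ at this
  have hI := Complex.I_ne_zero
  apply mul_left_cancel₀ hI
  linear_combination this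

lemma aux_two (s1 s2 : ℂ) (h : (s1 + s2).re < 0) :
    auxI s1 (s2 - 1) + auxI (s1 - 1) s2 = 2 * auxI (s1 - 1) (s2 - 1) := by
  have i1 : Integrable (fun t : ℝ => (1 + Complex.I * t : ℂ) ^ (s1 - 1) * (1 - Complex.I * t) ^ s2) :=
    aux_integrable (s1 - 1) s2 (by simp at h ⊢; linarith)
  have i2 : Integrable (fun t : ℝ => (1 + Complex.I * t : ℂ) ^ s1 * (1 - Complex.I * t) ^ (s2 - 1)) :=
    aux_integrable s1 (s2 - 1) (by simp at h ⊢; linarith)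
  rw [auxI, auxI, auxI, ← integral_add i2 i1, ← integral_const_mul]
  congr 1
  ext t
  have n1 := Complex.slitPlane_ne_zero (aux_mem_add t)
  have n2 := Complex.slitPlane_ne_zero (aux_mem_sub t)
  rw [Complex.cpow_sub _ _ n1, Complex.cpow_sub _ _ n2, Complex.cpow_one, Complex.cpow_one]
  field_simp
  ring

lemma aux_gint (a r : ℂ) (ha : 0 < a.re) (hr : 0 < r.re) :
    IntegrableOn (fun x : ℝ => (x : ℂ) ^ (a - 1) * Complex.exp (-(r * x))) (Ioi 0) := by
  have h := integrableOn_rpow_mul_exp_neg_mul_rpow (p := 1) (s := a.re - 1) (b := r.re)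
    (by linarith) one_pos hr
  refine Integrable.mono' h ?_ ?_
  · refine ContinuousOn.aestronglyMeasurable ?_ measurableSet_Ioi
    refine ContinuousOn.mul ?_ (by fun_prop)
    refine ContinuousOn.cpow_const (by fun_prop) fun x hx => ?_
    exact Complex.ofReal_mem_slitPlane.2 hx
  · refine (ae_restrict_iff' measurableSet_Ioi).2 (Eventually.of_forall fun x hx => ?_)
    rw [norm_mul, Complex.norm_cpow_eq_rpow_re_of_pos hx, Complex.norm_exp]
    simp

lemma aux_gparts (a r : ℂ) (ha : 0 < a.re) (hr : 0 < r.re) :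
    a * ∫ x in Ioi (0 : ℝ), (x : ℂ) ^ (a - 1) * Complex.exp (-(r * x)) =
      r * ∫ x in Ioi (0 : ℝ), (x : ℂ) ^ a * Complex.exp (-(r * x)) := by
  have ha0 : a ≠ 0 := by rintro rfl; simp at ha
  have i1 := aux_gint a r ha hr
  have i2 := aux_gint (a + 1) r (by simp; linarith) hr
  simp only [add_sub_cancel_right] at i2
  have := integral_Ioi_of_hasDerivAt_of_tendsto (a := 0) (m := 0)
    (f := fun x : ℝ => (x : ℂ) ^ a * Complex.exp (-(r * x)))
    (f' := fun x : ℝ => a * ((x : ℂ) ^ (a - 1) * Complex.exp (-(r * x))) -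
      r * ((x : ℂ) ^ a * Complex.exp (-(r * x)))) ?_ ?_
    ((i1.const_mul a).sub (i2.const_mul r)) ?_
  · rw [integral_sub (i1.const_mul a) (i2.const_mul r), integral_const_mul,
      integral_const_mul] at this
    simp [ha0] at this
    linear_combination this
  · exact ((Complex.continuous_ofReal_cpow_const ha).mul (by fun_prop)).continuousWithinAt
  · intro x hx
    have h1 := hasDerivAt_ofReal_cpow_const (ne_of_gt hx) ha0
    have h0 : HasDerivAt (fun z : ℂ => Complex.exp (-(r * z)))
        (Complex.exp (-(r * x)) * (-(r * 1))) (x : ℂ) :=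
      (((hasDerivAt_id (x : ℂ)).const_mul r).neg).cexp
    convert! h1.mul h0.comp_ofReal using 1
    ring
  · refine squeeze_zero_norm' ?_ (tendsto_rpow_mul_exp_neg_mul_atTop_nhds_zero a.re r.re hr)
    filter_upwards [eventually_gt_atTop 0] with x hx
    rw [norm_mul, Complex.norm_cpow_eq_rpow_re_of_pos hx, Complex.norm_exp]
    simp

/-- Gamma density (unnormalised). -/
noncomputable def auxg (a : ℂ) : ℝ → ℂ :=
  indicator (Ioi 0) fun x : ℝ => (x : ℂ) ^ (a - 1) * Complex.exp (-((2 * Real.pi : ℝ) * x))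

lemma auxg_int (a : ℂ) (ha : 0 < a.re) : Integrable (auxg a) := by
  rw [auxg, integrable_indicator_iff measurableSet_Ioi]
  exact aux_gint a _ ha (by rw [Complex.ofReal_re]; positivity)

lemma auxg_mul (a : ℂ) (x : ℝ) : (x : ℂ) * auxg a x = auxg (a + 1) x := by
  by_cases hx : x ∈ Ioi (0 : ℝ)
  · have : (x : ℂ) ≠ 0 := by exact_mod_cast (ne_of_gt hx)
    rw [auxg, auxg, indicator_of_mem hx, indicator_of_mem hx, add_sub_cancel_right,
      Complex.cpow_sub _ _ this, Complex.cpow_one]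
    field_simp
  · rw [auxg, auxg, indicator_of_notMem hx, indicator_of_notMem hx, mul_zero]

lemma auxg_fourier_eq (a : ℂ) (w : ℝ) : 𝓕 (auxg a) w =
    ∫ x in Ioi (0 : ℝ), (x : ℂ) ^ (a - 1) *
      Complex.exp (-((2 * Real.pi * (1 + Complex.I * w)) * x)) := by
  rw [Real.fourier_real_eq_integral_exp_smul, ← integral_indicator measurableSet_Ioi]
  congr 1
  ext x
  by_cases hx : x ∈ Ioi (0 : ℝ)
  · rw [auxg, indicator_of_mem hx, indicator_of_mem hx, smul_eq_mul, mul_left_comm,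
      ← Complex.exp_add]
    congr 2
    push_cast
    ring
  · rw [auxg, indicator_of_notMem hx, indicator_of_notMem hx, smul_zero]

lemma auxg_rec (a : ℂ) (ha : 0 < a.re) (w : ℝ) :
    a * 𝓕 (auxg a) w = 2 * Real.pi * (1 + Complex.I * w) * 𝓕 (auxg (a + 1)) w := by
  rw [auxg_fourier_eq, auxg_fourier_eq, add_sub_cancel_right]
  exact aux_gparts a _ ha (by simp [Real.pi_pos])

lemma auxg_deriv (a : ℂ) (ha : 0 < a.re) (w : ℝ) :
    HasDerivAt (𝓕 (auxg a)) (-2 * Real.pi * Complex.I * 𝓕 (auxg (a + 1)) w) w := by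
  have h := Real.hasDerivAt_fourier (auxg_int a ha) (w := w) (by
    simp only [Complex.real_smul, auxg_mul]
    exact auxg_int _ (by simp; linarith))
  convert! h using 1
  rw [Real.fourier_real_eq_integral_exp_smul, Real.fourier_real_eq_integral_exp_smul,
    ← integral_const_mul]
  congr 1
  ext x
  rw [← auxg_mul]
  simp only [smul_eq_mul]
  ring

lemma auxg_fourier (a : ℂ) (ha : 0 < a.re) (w : ℝ) :
    𝓕 (auxg a) w = (2 * Real.pi : ℂ) ^ (-a) * Complex.Gamma a * (1 + Complex.I * w) ^ (-a) := by
  have hd : ∀ w : ℝ, HasDerivAt (fun w : ℝ => 𝓕 (auxg a) w * (1 + Complex.I * w : ℂ) ^ a) 0 w := by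
    intro w
    have h0 : HasDerivAt (fun z : ℂ => Complex.I * z) (Complex.I) (w : ℂ) := by
      simpa using (hasDerivAt_id (w : ℂ)).const_mul Complex.I
    have h1 := ((h0.const_add 1).cpow_const (c := a) (aux_mem_add w)).comp_ofReal
    convert! (auxg_deriv a ha w).mul h1 using 1
    have n1 := Complex.slitPlane_ne_zero (aux_mem_add w)
    have hr := auxg_rec a ha w
    rw [Complex.cpow_sub _ _ n1, Complex.cpow_one]
    field_simp
    linear_combination (-Complex.I) * (1 + Complex.I * w) ^ a * hr
  have hc := is_const_of_deriv_eq_zero (fun w => (hd w).differentiableAt)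
    (fun w => (hd w).deriv) w 0
  have h00 : 𝓕 (auxg a) 0 = (2 * Real.pi : ℂ) ^ (-a) * Complex.Gamma a := by
    rw [auxg_fourier_eq]
    have := Complex.integral_cpow_mul_exp_neg_mul_Ioi (a := a) (r := 2 * Real.pi) ha (by positivity)
    simp only [Complex.ofReal_zero, mul_zero, add_zero, mul_one]
    push_cast at this
    rw [this, one_div, Complex.inv_cpow, Complex.cpow_neg]
    rw [show (2 * Real.pi : ℂ) = ((2 * Real.pi : ℝ) : ℂ) by push_cast; rfl,
      Complex.arg_ofReal_of_nonneg (by positivity)]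
    exact Real.pi_pos.ne
  simp only [Complex.ofReal_zero, mul_zero, add_zero, Complex.one_cpow, mul_one] at hc
  have n1 := Complex.slitPlane_ne_zero (aux_mem_add w)
  have n2 : (1 + Complex.I * w : ℂ) ^ a ≠ 0 := by simp [Complex.cpow_eq_zero_iff, n1]
  rw [← h00, ← hc, Complex.cpow_neg, mul_assoc, mul_inv_cancel₀ n2, mul_one]

lemma auxg_cont (a : ℂ) (ha : 1 < a.re) : Continuous (auxg a) := by
  have h : auxg a = fun x : ℝ => ((max x 0 : ℝ) : ℂ) ^ (a - 1) *
      Complex.exp (-((2 * Real.pi : ℝ) * x)) := by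
    ext x
    have h1 : a - 1 ≠ 0 := by
      intro h; have := congrArg Complex.re h; simp at this; linarith
    by_cases hx : x ∈ Ioi (0 : ℝ)
    · rw [auxg, indicator_of_mem hx, max_eq_left (le_of_lt hx)]
    · rw [auxg, indicator_of_notMem hx, max_eq_right (not_lt.1 hx)]
      simp [h1]
  rw [h]
  refine Continuous.mul ?_ (by fun_prop)
  exact (Complex.continuous_ofReal_cpow_const (y := a - 1) (by simp; linarith)).comp
    (continuous_id.max continuous_const)

lemma aux_G_int (b : ℂ) (hb : 1 < b.re) :
    Integrable (fun t : ℝ => (1 + Complex.I * t : ℂ) ^ (-b)) := by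
  simpa using aux_integrable (-b) 0 (by simp; linarith)

lemma auxg_inv (b : ℂ) (hb : 1 < b.re) :
    𝓕 (fun t : ℝ => (1 - Complex.I * t : ℂ) ^ (-b)) =
      fun x => (2 * Real.pi : ℂ) ^ b / Complex.Gamma b * auxg b x := by
  have hb0 : 0 < b.re := by linarith
  have hF : 𝓕 (auxg b) = fun w : ℝ => ((2 * Real.pi : ℂ) ^ (-b) * Complex.Gamma b) *
      (1 + Complex.I * w) ^ (-b) := funext fun w => auxg_fourier b hb0 w
  have hinv := (auxg_cont b hb).fourierInv_fourier_eq (auxg_int b hb0)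
    (by rw [hF]; exact (aux_G_int b hb).const_mul _)
  have hG := Complex.Gamma_ne_zero_of_re_pos hb0
  have h2 : (2 * Real.pi : ℂ) ≠ 0 := by
    simp [Real.pi_ne_zero]
  have h3 : (2 * Real.pi : ℂ) ^ b ≠ 0 := by simp [Complex.cpow_eq_zero_iff, Real.pi_ne_zero]
  rw [Real.fourierInv_eq_fourier_comp_neg, hF] at hinv
  ext x
  rw [← hinv, Real.fourier_real_eq_integral_exp_smul, Real.fourier_real_eq_integral_exp_smul,
    ← integral_const_mul]
  congr 1
  ext t
  simp only [smul_eq_mul, Complex.ofReal_neg, mul_neg, ← sub_eq_add_neg]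
  rw [Complex.cpow_neg (2 * Real.pi : ℂ)]
  field_simp

lemma aux_base (a b : ℂ) (ha : 1 < a.re) (hb : 1 < b.re) :
    auxI (-a) (-b) = Real.pi * 2 ^ (2 - a - b) * Complex.Gamma (a + b - 1) /
      (Complex.Gamma a * Complex.Gamma b) := by
  have ha0 : 0 < a.re := by linarith
  have hb0 : 0 < b.re := by linarith
  have hGi : Integrable (fun t : ℝ => (1 - Complex.I * t : ℂ) ^ (-b)) := by
    simpa using aux_integrable 0 (-b) (by simp; linarith)
  have key : ∫ w : ℝ, 𝓕 (auxg a) w • (1 - Complex.I * w : ℂ) ^ (-b) =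
      ∫ x : ℝ, auxg a x • 𝓕 (fun t : ℝ => (1 - Complex.I * t : ℂ) ^ (-b)) x := by
    simpa using! (VectorFourier.integral_fourierIntegral_smul_eq_flip (L := innerₗ ℝ)
      Real.continuous_fourierChar continuous_inner (auxg_int a ha0) hGi)
  have hGa := Complex.Gamma_ne_zero_of_re_pos ha0
  have hGb := Complex.Gamma_ne_zero_of_re_pos hb0
  have hL : ∫ w : ℝ, 𝓕 (auxg a) w • (1 - Complex.I * w : ℂ) ^ (-b) =
      (2 * Real.pi : ℂ) ^ (-a) * Complex.Gamma a * auxI (-a) (-b) := by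
    rw [auxI, ← integral_const_mul]
    congr 1
    ext w
    rw [auxg_fourier a ha0, smul_eq_mul]
    ring
  have hR : ∫ x : ℝ, auxg a x • 𝓕 (fun t : ℝ => (1 - Complex.I * t : ℂ) ^ (-b)) x =
      (2 * Real.pi : ℂ) ^ b / Complex.Gamma b *
        ((1 / (4 * Real.pi : ℝ) : ℂ) ^ (a + b - 1) * Complex.Gamma (a + b - 1)) := by
    rw [auxg_inv b hb, ← Complex.integral_cpow_mul_exp_neg_mul_Ioi (by simp; linarith)
      (by positivity), ← integral_indicator measurableSet_Ioi, ← integral_const_mul]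
    congr 1
    ext x
    beta_reduce
    by_cases hx : x ∈ Ioi (0 : ℝ)
    · have : (x : ℂ) ≠ 0 := by exact_mod_cast (ne_of_gt hx)
      rw [auxg, auxg, indicator_of_mem hx, indicator_of_mem hx, indicator_of_mem hx, smul_eq_mul,
        show a + b - 1 - 1 = (a - 1) + (b - 1) by ring, Complex.cpow_add _ _ this,
        show (-((4 * Real.pi : ℝ) * x) : ℂ) = -((2 * Real.pi : ℝ) * x) + -((2 * Real.pi : ℝ) * x)
          by push_cast; ring, Complex.exp_add]
      ring
    · rw [auxg, indicator_of_notMem hx, indicator_of_notMem hx, zero_smul, mul_zero]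
  rw [hL, hR] at key
  have e1 : (2 * Real.pi : ℂ) ^ (-a) = Complex.exp (-a * (Real.log 2 + Real.log Real.pi)) := by
    rw [Complex.cpow_def_of_ne_zero (by simp [Real.pi_ne_zero]),
      show (2 * Real.pi : ℂ) = ((2 * Real.pi : ℝ) : ℂ) by push_cast; rfl,
      ← Complex.ofReal_log (by positivity), Real.log_mul two_ne_zero Real.pi_ne_zero]
    push_cast
    ring_nf
  have e2 : (2 * Real.pi : ℂ) ^ b = Complex.exp (b * (Real.log 2 + Real.log Real.pi)) := by
    rw [Complex.cpow_def_of_ne_zero (by simp [Real.pi_ne_zero]),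
      show (2 * Real.pi : ℂ) = ((2 * Real.pi : ℝ) : ℂ) by push_cast; rfl,
      ← Complex.ofReal_log (by positivity), Real.log_mul two_ne_zero Real.pi_ne_zero]
    push_cast
    ring_nf
  have e3 : (1 / (4 * Real.pi : ℝ) : ℂ) ^ (a + b - 1) =
      Complex.exp ((a + b - 1) * (-(2 * Real.log 2 + Real.log Real.pi))) := by
    rw [Complex.cpow_def_of_ne_zero (by simp [Real.pi_ne_zero]),
      show (1 / (4 * Real.pi : ℝ) : ℂ) = (((2 ^ 2 * Real.pi)⁻¹ : ℝ) : ℂ) by push_cast; norm_num,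
      ← Complex.ofReal_log (by positivity), Real.log_inv,
      Real.log_mul (by norm_num) Real.pi_ne_zero, Real.log_pow]
    push_cast
    ring_nf
  have e4 : (2 : ℂ) ^ (2 - a - b) = Complex.exp ((2 - a - b) * Real.log 2) := by
    rw [Complex.cpow_def_of_ne_zero two_ne_zero, show (2 : ℂ) = ((2 : ℝ) : ℂ) by push_cast; rfl,
      ← Complex.ofReal_log (by positivity)]
    push_cast
    ring_nf
  have e5 : (Real.pi : ℂ) = Complex.exp (Real.log Real.pi) := by
    rw [← Complex.ofReal_exp, Real.exp_log Real.pi_pos]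
  have e6 : (2 * Real.pi : ℂ) ^ b * (1 / (4 * Real.pi : ℝ) : ℂ) ^ (a + b - 1) =
      (2 * Real.pi : ℂ) ^ (-a) * (Real.pi * (2 : ℂ) ^ (2 - a - b)) := by
    rw [e1, e2, e3, e4]
    nth_rw 1 [e5]
    rw [← Complex.exp_add, ← Complex.exp_add, ← Complex.exp_add]
    ring_nf
  have h3 : (2 * Real.pi : ℂ) ^ (-a) ≠ 0 := by simp [Complex.cpow_eq_zero_iff, Real.pi_ne_zero]
  rw [eq_div_iff (mul_ne_zero hGa hGb)]
  apply mul_left_cancel₀ h3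
  have key2 := congrArg (· * Complex.Gamma b) key
  beta_reduce at key2
  calc _ = (2 * Real.pi : ℂ) ^ (-a) * Complex.Gamma a * auxI (-a) (-b) * Complex.Gamma b := by ring
    _ = _ := key2
    _ = ((2 * Real.pi : ℂ) ^ b * (1 / (4 * Real.pi : ℝ) : ℂ) ^ (a + b - 1)) *
      Complex.Gamma (a + b - 1) := by field_simp
    _ = _ := by rw [e6]; ring

/-- The claimed value. -/
noncomputable def auxR (s1 s2 : ℂ) : ℂ :=
  (Real.pi : ℂ) * (2 : ℂ) ^ (s1 + s2 + 2) * Complex.Gamma (-s1 - s2 - 1) /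
          (Complex.Gamma (-s1) * Complex.Gamma (-s2))

lemma auxR_symm (s1 s2 : ℂ) : auxR s1 s2 = auxR s2 s1 := by
  rw [auxR, auxR, add_comm s1 s2, mul_comm (Complex.Gamma (-s1)),
    show -s1 - s2 - 1 = -s2 - s1 - 1 by ring]

lemma auxI_symm (s1 s2 : ℂ) : auxI s1 s2 = auxI s2 s1 := by
  rw [auxI, auxI, ← integral_neg_eq_self]
  congr 1
  ext t
  push_cast
  rw [mul_comm]
  ring_nf

lemma auxI_rec (s1 s2 : ℂ) (h : (s1 + s2).re < -1) :
    (s1 + s2 + 1) * auxI s1 s2 = 2 * s1 * auxI (s1 - 1) s2 := by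
  have h1 := aux_parts s1 (s2 + 1) (by simp at h ⊢; linarith)
  have h2 := aux_two s1 (s2 + 1) (by simp at h ⊢; linarith)
  rw [add_sub_cancel_right] at h1 h2
  linear_combination s1 * h2 - h1

lemma auxR_rec (s1 s2 : ℂ) (h : (s1 + s2).re < -1) :
    (s1 + s2 + 1) * auxR s1 s2 = 2 * s1 * auxR (s1 - 1) s2 := by
  have hne : -s1 - s2 - 1 ≠ 0 := by
    intro h'; have := congrArg Complex.re h'; simp at this h; linarith
  have hG := Complex.Gamma_add_one _ hne
  have hG1 := Complex.one_div_Gamma_eq_self_mul_one_div_Gamma_add_one (-s1)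
  have h2 : (2 : ℂ) ^ (s1 + s2 + 2) = 2 ^ (s1 - 1 + s2 + 2) * 2 := by
    rw [show s1 + s2 + 2 = (s1 - 1 + s2 + 2) + 1 by ring, Complex.cpow_add _ _ two_ne_zero,
      Complex.cpow_one]
  rw [auxR, auxR, show -(s1 - 1) - s2 - 1 = -s1 - s2 - 1 + 1 by ring,
    show -(s1 - 1) = -s1 + 1 by ring, hG, div_eq_mul_inv, div_eq_mul_inv, mul_inv, mul_inv, hG1, h2]
  ring

lemma aux_step1 (n : ℕ) : ∀ s1 s2 : ℂ, (s1 + s2).re < -1 → s2.re < -1 → s1.re < n - 1 →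
    auxI s1 s2 = auxR s1 s2 := by
  induction n with
  | zero =>
    intro s1 s2 _ h2 h1
    have := aux_base (-s1) (-s2) (by simp at h1 ⊢; linarith) (by simp; linarith)
    rw [neg_neg, neg_neg] at this
    rw [this, auxR]
    ring_nf
  | succ n ih =>
    intro s1 s2 h h2 h1
    have hne : s1 + s2 + 1 ≠ 0 := by
      intro h'; have := congrArg Complex.re h'; simp at this h; linarith
    apply mul_left_cancel₀ hne
    rw [auxI_rec s1 s2 h, auxR_rec s1 s2 h, ih (s1 - 1) s2 (by simp at h ⊢; linarith) h2
      (by push_cast at h1; simp; linarith)]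

lemma aux_step2 (n : ℕ) : ∀ s1 s2 : ℂ, (s1 + s2).re < -1 → s2.re < n - 1 →
    auxI s1 s2 = auxR s1 s2 := by
  induction n with
  | zero =>
    intro s1 s2 h h2
    obtain ⟨m, hm⟩ := exists_nat_gt (s1.re + 1)
    exact aux_step1 m s1 s2 h (by simpa using h2) (by linarith)
  | succ n ih =>
    intro s1 s2 h h1
    have h' : (s2 + s1).re < -1 := by rwa [add_comm]
    have hne : s2 + s1 + 1 ≠ 0 := by
      intro h''; have := congrArg Complex.re h''; simp at this h; linarith
    rw [auxI_symm, auxR_symm]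
    apply mul_left_cancel₀ hne
    rw [auxI_rec s2 s1 h', auxR_rec s2 s1 h', auxI_symm, auxR_symm,
      ih s1 (s2 - 1) (by simp at h ⊢; linarith) (by push_cast at h1; simp; linarith)]

/-- For `Re(s1+s2) < −1`, the integral `∫ℝ (1+it)^{s1}(1−it)^{s2} dt` converges and equals
`π·2^{s1+s2+2}·Γ(−s1−s2−1)/(Γ(−s1)·Γ(−s2))` (principal branches). -/
theorem stmt_5 (s1 s2 : ℂ) (h : (s1 + s2).re < -1) :
    Integrable (fun t : ℝ => (1 + Complex.I * t) ^ s1 * (1 - Complex.I * t) ^ s2) ∧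
      ∫ t : ℝ, (1 + Complex.I * t) ^ s1 * (1 - Complex.I * t) ^ s2 =
        (Real.pi : ℂ) * (2 : ℂ) ^ (s1 + s2 + 2) * Complex.Gamma (-s1 - s2 - 1) /
          (Complex.Gamma (-s1) * Complex.Gamma (-s2)) := by
  refine ⟨aux_integrable s1 s2 h, ?_⟩
  obtain ⟨m, hm⟩ := exists_nat_gt (s2.re + 1)
  exact aux_step2 m s1 s2 h (by linarith)
end

section
/- For every z ∈ ℂ with Re z > 1/2 and every m ∈ ℂ, the integral ∫_{−∞}^{∞} (1+it)^{m−z} · (1−it)^{−m−z} dt converges and equals Q(z,m) = π · 2^{2−2z} · Γ(2z−1) / (Γ(z+m) · Γ(z−m)). -/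
namespace Stmt6

noncomputable section

open MeasureTheory

/-- `Q(z,m) = π·2^{2−2z}·Γ(2z−1)/(Γ(z+m)·Γ(z−m))`. -/
def Qf (z m : ℂ) : ℂ :=
  (Real.pi : ℂ) * (2 : ℂ) ^ ((2 : ℂ) - 2 * z) * Complex.Gamma (2 * z - 1) /
    (Complex.Gamma (z + m) * Complex.Gamma (z - m))

lemma cpow_add_one' (x y : ℂ) (hx : x ≠ 0) : x ^ (y + 1) = x ^ y * x := by
  rw [Complex.cpow_add _ _ hx, Complex.cpow_one]

lemma norm_cpow_bound (s : ℂ) (t : ℝ) :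
    ‖(1 + Complex.I * t) ^ s‖ ≤ (1 + t ^ 2) ^ (s.re / 2) * Real.exp (Real.pi * |s.im|) := by
  refine (Complex.norm_cpow_le _ _).trans ?_
  have h1 : ‖1 + Complex.I * (t : ℂ)‖ ^ s.re = (1 + t ^ 2) ^ (s.re / 2) := by
    have : ‖1 + Complex.I * (t : ℂ)‖ = (1 + t ^ 2) ^ (1 / 2 : ℝ) := by
      rw [← Real.sqrt_eq_rpow, Complex.norm_def]
      congr 1
      simp [Complex.normSq_apply]
      ring
    rw [this, ← Real.rpow_mul (by positivity)]
    congr 1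
    ring
  rw [h1, div_eq_mul_inv, ← Real.exp_neg]
  gcongr
  have h2 := Complex.abs_arg_le_pi (1 + Complex.I * (t : ℂ))
  calc -(Complex.arg (1 + Complex.I * (t : ℂ)) * s.im)
      ≤ |Complex.arg (1 + Complex.I * (t : ℂ)) * s.im| := neg_le_abs _
    _ = |Complex.arg (1 + Complex.I * (t : ℂ))| * |s.im| := abs_mul _ _
    _ ≤ _ := by gcongr

lemma norm_cpow_bound' (s : ℂ) (t : ℝ) :
    ‖(1 - Complex.I * t) ^ s‖ ≤ (1 + t ^ 2) ^ (s.re / 2) * Real.exp (Real.pi * |s.im|) := by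
  have := norm_cpow_bound s (-t)
  simpa [sub_eq_add_neg] using this

/-- The integrand in symmetric form. -/
def G (a b : ℂ) (t : ℝ) : ℂ := (1 + Complex.I * t) ^ (-a) * (1 - Complex.I * t) ^ (-b)

lemma mem_slit (t : ℝ) : 1 + Complex.I * (t : ℂ) ∈ Complex.slitPlane := by
  left; simp

lemma mem_slit' (t : ℝ) : 1 - Complex.I * (t : ℂ) ∈ Complex.slitPlane := by
  left; simp

lemma continuous_G (a b : ℂ) : Continuous (G a b) := by
  unfold G
  refine Continuous.mul ?_ ?_
  · exact Continuous.cpow (by fun_prop) continuous_const mem_slit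
  · exact Continuous.cpow (by fun_prop) continuous_const mem_slit'

lemma norm_G_le (a b : ℂ) (t : ℝ) : ‖G a b t‖ ≤ (1 + t ^ 2) ^ (-(a + b).re / 2) *
    (Real.exp (Real.pi * |a.im|) * Real.exp (Real.pi * |b.im|)) := by
  unfold G
  rw [norm_mul]
  have h1 := norm_cpow_bound (-a) t
  have h2 := norm_cpow_bound' (-b) t
  refine (mul_le_mul h1 h2 (norm_nonneg _) (by positivity)).trans (le_of_eq ?_)
  have : (1 + t ^ 2) ^ (-(a + b).re / 2) =
      (1 + t ^ 2) ^ ((-a).re / 2) * (1 + t ^ 2) ^ ((-b).re / 2) := by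
    rw [← Real.rpow_add (by positivity)]
    congr 1
    simp
    ring
  rw [this]
  simp
  ring

lemma integrable_G (a b : ℂ) (h : 1 < (a + b).re) : Integrable (G a b) := by
  have h0 : Integrable (fun t : ℝ => (1 + ‖t‖ ^ 2) ^ (-(a + b).re / 2)) :=
    integrable_rpow_neg_one_add_norm_sq (by simpa using h)
  refine (h0.mul_const (Real.exp (Real.pi * |a.im|) * Real.exp (Real.pi * |b.im|))).mono'
    (continuous_G a b).aestronglyMeasurable (Filter.Eventually.of_forall fun t => ?_)
  simpa using norm_G_le a b t

lemma tendsto_G (a b : ℂ) (h : 0 < (a + b).re) {l : Filter ℝ}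
    (hl : Filter.Tendsto (fun t : ℝ => 1 + t ^ 2) l Filter.atTop) :
    Filter.Tendsto (G a b) l (nhds 0) := by
  refine squeeze_zero_norm (norm_G_le a b) ?_
  rw [← zero_mul (Real.exp (Real.pi * |a.im|) * Real.exp (Real.pi * |b.im|))]
  refine Filter.Tendsto.mul_const _ ?_
  have := (tendsto_rpow_neg_atTop (y := (a + b).re / 2) (by linarith)).comp hl
  rw [neg_div]
  exact this

lemma hasDerivAt_G (a b : ℂ) (t : ℝ) :
    HasDerivAt (G a b) (Complex.I * (b * G a (b + 1) t - a * G (a + 1) b t)) t := by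
  have h1 : HasDerivAt (fun x : ℝ => 1 + Complex.I * (x : ℂ)) Complex.I t := by
    simpa using ((Complex.ofRealCLM.hasDerivAt (x := t)).const_mul Complex.I).const_add 1
  have h2 : HasDerivAt (fun x : ℝ => 1 - Complex.I * (x : ℂ)) (-Complex.I) t := by
    simpa using ((Complex.ofRealCLM.hasDerivAt (x := t)).const_mul Complex.I).const_sub 1
  have d1 : HasDerivAt (fun x : ℝ => (1 + Complex.I * (x : ℂ)) ^ (-a)) 
      (-a * (1 + Complex.I * (t : ℂ)) ^ (-a - 1) * Complex.I) t :=
    HasDerivAt.comp (h₂ := fun w : ℂ => w ^ (-a)) t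
      (Complex.hasStrictDerivAt_cpow_const (c := -a) (mem_slit t)).hasDerivAt h1
  have d2 : HasDerivAt (fun x : ℝ => (1 - Complex.I * (x : ℂ)) ^ (-b)) 
      (-b * (1 - Complex.I * (t : ℂ)) ^ (-b - 1) * (-Complex.I)) t :=
    HasDerivAt.comp (h₂ := fun w : ℂ => w ^ (-b)) t
      (Complex.hasStrictDerivAt_cpow_const (c := -b) (mem_slit' t)).hasDerivAt h2
  have := d1.mul d2
  refine this.congr_deriv ?_
  unfold G
  rw [show -a - 1 = -(a + 1) by ring, show -b - 1 = -(b + 1) by ring]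
  ring

lemma G_two (a b : ℂ) (t : ℝ) : G a (b + 1) t + G (a + 1) b t = 2 * G (a + 1) (b + 1) t := by
  unfold G
  have h1 := Complex.slitPlane_ne_zero (mem_slit t)
  have h2 := Complex.slitPlane_ne_zero (mem_slit' t)
  have e1 : (1 + Complex.I * (t : ℂ)) ^ (-a) =
      (1 + Complex.I * t) ^ (-(a + 1)) * (1 + Complex.I * t) := by
    rw [← cpow_add_one' _ _ h1]
    congr 1; ring
  have e2 : (1 - Complex.I * (t : ℂ)) ^ (-b) =
      (1 - Complex.I * t) ^ (-(b + 1)) * (1 - Complex.I * t) := by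
    rw [← cpow_add_one' _ _ h2]
    congr 1; ring
  rw [e1, e2]
  ring

lemma int_parts (a b : ℂ) (h : 0 < (a + b).re) :
    b * ∫ t, G a (b + 1) t = a * ∫ t, G (a + 1) b t := by
  have i1 : Integrable (G a (b + 1)) := integrable_G _ _ (by simp at h ⊢; linarith)
  have i2 : Integrable (G (a + 1) b) := integrable_G _ _ (by simp at h ⊢; linarith)
  have l1 : Filter.Tendsto (fun t : ℝ => 1 + t ^ 2) Filter.atTop Filter.atTop :=
    Filter.tendsto_atTop_add_const_left _ _ (Filter.tendsto_pow_atTop two_ne_zero)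
  have l2 : Filter.Tendsto (fun t : ℝ => 1 + t ^ 2) Filter.atBot Filter.atTop := by
    have := l1.comp Filter.tendsto_neg_atBot_atTop
    simpa [Function.comp_def] using this
  have := integral_of_hasDerivAt_of_tendsto (hasDerivAt_G a b)
    (((i1.const_mul b).sub (i2.const_mul a)).const_mul Complex.I)
    (tendsto_G a b h l2) (tendsto_G a b h l1)
  rw [integral_const_mul, integral_sub (i1.const_mul b) (i2.const_mul a), integral_const_mul,
    integral_const_mul] at this
  simp at this
  exact sub_eq_zero.mp this

lemma step_a (a b : ℂ) (h : 1 < (a + b).re) :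
    (a + b - 1) * ∫ t, G a b t = 2 * a * ∫ t, G (a + 1) b t := by
  have h3 : (a + (b - 1)).re = (a + b).re - 1 := by simp; ring
  have h1 := int_parts a (b - 1) (by rw [h3]; linarith)
  have i1 : Integrable (G a b) := integrable_G _ _ h
  have i2 : Integrable (G (a + 1) (b - 1)) := integrable_G _ _ (by
    rwa [show a + 1 + (b - 1) = a + b by ring])
  have h2 : (∫ t, G a b t) + ∫ t, G (a + 1) (b - 1) t = 2 * ∫ t, G (a + 1) b t := by
    rw [← integral_add i1 i2, ← integral_const_mul]
    congr 1
    ext t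
    have := G_two a (b - 1) t
    simpa using this
  rw [sub_add_cancel] at h1
  linear_combination h1 + a * h2

lemma symm_G (a b : ℂ) : ∫ t, G a b t = ∫ t, G b a t := by
  rw [← integral_neg_eq_self (G b a)]
  congr 1
  ext t
  simp [G, mul_comm, sub_eq_add_neg]

/-- The right hand side in symmetric form. -/
def R (a b : ℂ) : ℂ := (Real.pi : ℂ) * (2 : ℂ) ^ (2 - (a + b)) * Complex.Gamma (a + b - 1) *
  ((Complex.Gamma a)⁻¹ * (Complex.Gamma b)⁻¹)

lemma R_symm (a b : ℂ) : R a b = R b a := by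
  unfold R
  rw [add_comm a b]; ring

lemma R_step (a b : ℂ) (h : 1 < (a + b).re) : (a + b - 1) * R a b = 2 * a * R (a + 1) b := by
  unfold R
  have h0 : a + b - 1 ≠ 0 := by
    intro h0
    have := congrArg Complex.re h0
    simp at this h
    linarith
  have e1 : Complex.Gamma (a + 1 + b - 1) = (a + b - 1) * Complex.Gamma (a + b - 1) := by
    rw [← Complex.Gamma_add_one _ h0]; congr 1; ring
  have e2 : (2 : ℂ) ^ (2 - (a + b)) = 2 ^ (2 - (a + 1 + b)) * 2 := by
    rw [← cpow_add_one' _ _ two_ne_zero]; congr 1; ring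
  rw [e1, e2, Complex.one_div_Gamma_eq_self_mul_one_div_Gamma_add_one a]
  ring

lemma back (a b : ℂ) (h : 1 < (a + b).re) (H : ∫ t, G (a + 1) b t = R (a + 1) b) :
    ∫ t, G a b t = R a b := by
  have h0 : a + b - 1 ≠ 0 := by
    intro h0
    have := congrArg Complex.re h0
    simp at this h
    linarith
  apply mul_left_cancel₀ h0
  rw [step_a a b h, R_step a b h, H]

lemma back_n (n : ℕ) : ∀ (a b : ℂ), 1 < (a + b).re →
    (∫ t, G (a + n) b t = R (a + n) b) → ∫ t, G a b t = R a b := by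
  induction n with
  | zero => intro a b h H; simpa using H
  | succ n ih =>
    intro a b h H
    apply back a b h
    apply ih (a + 1) b
    · simp at h ⊢; linarith
    · rw [show a + 1 + (n : ℂ) = a + ((n + 1 : ℕ) : ℂ) by push_cast; ring]
      exact H

lemma integrableOn_gamma (a r : ℂ) (ha : 0 < a.re) (hr : 0 < r.re) :
    IntegrableOn (fun x : ℝ => (x : ℂ) ^ (a - 1) * Complex.exp (-(r * x))) (Set.Ioi 0) := by
  have h0 := integrableOn_rpow_mul_exp_neg_mul_rpow (p := 1) (s := a.re - 1) (b := r.re)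
    (by linarith) one_pos hr
  refine Integrable.mono' h0 ?_ ?_
  · refine ContinuousOn.aestronglyMeasurable ?_ measurableSet_Ioi
    refine ContinuousOn.mul ?_ (by fun_prop)
    exact ContinuousOn.cpow_const (by fun_prop) (fun x hx => Or.inl (by simpa using hx))
  · filter_upwards [ae_restrict_mem measurableSet_Ioi] with x hx
    rw [norm_mul, Complex.norm_cpow_eq_rpow_re_of_pos hx, Complex.norm_exp]
    simp

lemma laplace (a : ℂ) (ha : 0 < a.re) (r : ℂ) (hr : 0 < r.re) :
    ∫ x in Set.Ioi (0 : ℝ), (x : ℂ) ^ (a - 1) * Complex.exp (-(r * x)) =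
      r ^ (-a) * Complex.Gamma a := by
  set U : Set ℂ := {r : ℂ | 0 < r.re} with hU
  have hUo : IsOpen U := isOpen_lt continuous_const Complex.continuous_re
  have hUc : Convex ℝ U := convex_halfSpace_re_gt 0
  have hF : DifferentiableOn ℂ
      (fun r : ℂ => ∫ x in Set.Ioi (0 : ℝ), (x : ℂ) ^ (a - 1) * Complex.exp (-(r * x))) U := by
    intro r₀ hr₀
    have hr₀' : 0 < r₀.re := hr₀
    have hs : {r : ℂ | r₀.re / 2 < r.re} ∈ nhds r₀ :=
      (isOpen_lt continuous_const Complex.continuous_re).mem_nhds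
        (by simp only [Set.mem_ofPred_eq]; linarith)
    have key := hasDerivAt_integral_of_dominated_loc_of_deriv_le (𝕜 := ℂ)
      (μ := volume.restrict (Set.Ioi (0 : ℝ)))
      (F := fun (r : ℂ) (x : ℝ) => (x : ℂ) ^ (a - 1) * Complex.exp (-(r * x)))
      (F' := fun (r : ℂ) (x : ℝ) => (x : ℂ) ^ (a - 1) * (Complex.exp (-(r * x)) * (-x)))
      (x₀ := r₀) (bound := fun x : ℝ => x ^ a.re * Real.exp (-(r₀.re / 2) * x ^ (1 : ℝ)))
      hs ?_ ?_ ?_ ?_ ?_ ?_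
    · exact key.2.differentiableAt.differentiableWithinAt
    · filter_upwards [hUo.mem_nhds hr₀] with r hr
      exact (integrableOn_gamma a r ha hr).aestronglyMeasurable
    · exact integrableOn_gamma a r₀ ha hr₀
    · refine ContinuousOn.aestronglyMeasurable ?_ measurableSet_Ioi
      refine ContinuousOn.mul ?_ (by fun_prop)
      exact ContinuousOn.cpow_const (by fun_prop) (fun x hx => Or.inl (by simpa using hx))
    · filter_upwards [ae_restrict_mem measurableSet_Ioi] with x hx r hr
      have hx : 0 < x := hx
      have hr : r₀.re / 2 < r.re := hr
      rw [norm_mul, norm_mul, Complex.norm_cpow_eq_rpow_re_of_pos hx, Complex.norm_exp, norm_neg,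
        Complex.norm_real, Real.norm_of_nonneg hx.le]
      have e : x ^ a.re = x ^ (a - 1).re * x := by
        rw [← Real.rpow_add_one hx.ne']
        simp
      have e2 : Real.exp (-(r * x)).re ≤ Real.exp (-(r₀.re / 2) * x ^ (1 : ℝ)) := by
        apply Real.exp_le_exp.mpr
        simp
        nlinarith
      rw [e, mul_comm (Real.exp _) x, ← mul_assoc]
      gcongr
    · exact integrableOn_rpow_mul_exp_neg_mul_rpow (by linarith) one_pos (by linarith)
    · refine Filter.Eventually.of_forall fun x r _ => ?_
      have h1 : HasDerivAt (fun r : ℂ => -(r * (x : ℂ))) (-(x : ℂ)) r := by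
        have h2 := ((hasDerivAt_id' r).mul_const (x : ℂ)).neg
        rw [one_mul] at h2
        exact h2
      exact (h1.cexp).const_mul _
  have hG : DifferentiableOn ℂ (fun r : ℂ => r ^ (-a) * Complex.Gamma a) U := by
    intro r hr
    refine (DifferentiableAt.mul_const ?_ _).differentiableWithinAt
    exact (differentiableAt_id).cpow_const (Or.inl hr)
  have key := (hF.analyticOnNhd hUo).eqOn_of_preconnected_of_frequently_eq
    (hG.analyticOnNhd hUo) hUc.isPreconnected (z₀ := 1) (by simp [hU]) ?_
  · exact key hr
  · have hreal : ∀ t : ℝ, 0 < t → (∫ x in Set.Ioi (0 : ℝ), (x : ℂ) ^ (a - 1) *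
        Complex.exp (-((t : ℂ) * x))) = (t : ℂ) ^ (-a) * Complex.Gamma a := by
      intro t ht
      rw [Complex.integral_cpow_mul_exp_neg_mul_Ioi ha ht, one_div, Complex.inv_cpow,
        Complex.cpow_neg]
      rw [Complex.arg_ofReal_of_nonneg ht.le]
      exact Real.pi_pos.ne
    have ht : Filter.Tendsto (fun t : ℝ => (t : ℂ)) (nhdsWithin 1 {1}ᶜ)
        (nhdsWithin 1 {1}ᶜ) := by
      refine tendsto_nhdsWithin_iff.mpr ⟨?_, ?_⟩
      · exact (Complex.continuous_ofReal.tendsto' 1 1 (by simp)).mono_left nhdsWithin_le_nhds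
      · filter_upwards [self_mem_nhdsWithin] with t ht
        simpa using ht
    refine ht.frequently (Filter.Eventually.frequently ?_)
    filter_upwards [nhdsWithin_le_nhds (Ioi_mem_nhds (zero_lt_one (α := ℝ)))] with t ht
    exact hreal t ht

open FourierTransform in
lemma base (a b : ℂ) (ha : 1 < a.re) (hb : 1 < b.re) : ∫ t, G a b t = R a b := by
  -- the two gamma densities
  let g : ℂ → ℝ → ℂ := fun a => (Set.Ioi (0 : ℝ)).indicator
    (fun x : ℝ => (x : ℂ) ^ (a - 1) * Complex.exp (-((1 : ℂ) * x)))
  have gi : ∀ a : ℂ, 0 < a.re → Integrable (g a) := fun a ha =>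
    (integrableOn_gamma a 1 ha (by simp)).integrable_indicator measurableSet_Ioi
  have gF : ∀ a : ℂ, 0 < a.re → ∀ w : ℝ, 𝓕 (g a) w =
      (1 + Complex.I * ((2 * Real.pi * w : ℝ) : ℂ)) ^ (-a) * Complex.Gamma a := by
    intro a ha w
    rw [← laplace a ha _ (by simp), Real.fourier_real_eq_integral_exp_smul,
      ← integral_indicator measurableSet_Ioi]
    congr 1
    ext x
    by_cases hx : x ∈ Set.Ioi (0 : ℝ)
    · simp only [g, Set.indicator_of_mem hx, smul_eq_mul]
      rw [mul_left_comm, ← Complex.exp_add]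
      congr 2
      push_cast
      ring
    · simp only [g, Set.indicator_of_notMem hx, smul_zero]
  have gFi : 𝓕⁻ (g b) = fun w : ℝ =>
      (1 - Complex.I * ((2 * Real.pi * w : ℝ) : ℂ)) ^ (-b) * Complex.Gamma b := by
    ext w
    rw [Real.fourierInv_eq_fourier_neg, gF b (by linarith)]
    congr 2
    push_cast
    ring
  have pi2 : (2 * Real.pi) ≠ 0 := by positivity
  have iF : Integrable (𝓕 (g b)) := by
    have h1 : Integrable (fun w : ℝ => G b 0 (2 * Real.pi * w)) :=
      (integrable_G b 0 (by simpa using hb)).comp_mul_left' pi2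
    have : 𝓕 (g b) = fun w : ℝ => G b 0 (2 * Real.pi * w) * Complex.Gamma b := by
      ext w
      rw [gF b (by linarith)]
      simp [G]
    rw [this]
    exact h1.mul_const _
  have iFi : Integrable (𝓕⁻ (g b)) := by
    have : 𝓕⁻ (g b) = fun w => 𝓕 (g b) (-w) := by
      ext w; rw [Real.fourierInv_eq_fourier_neg]
    rw [this]
    exact iF.comp_neg
  have inv : ∀ x : ℝ, x ≠ 0 → 𝓕 (𝓕⁻ (g b)) x = g b x := by
    intro x hx
    refine (gi b (by linarith)).fourier_fourierInv_eq iF ?_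
    rcases lt_or_gt_of_ne hx with hx | hx
    · have : g b =ᶠ[nhds x] fun _ => 0 := by
        filter_upwards [Iio_mem_nhds hx] with y hy
        exact Set.indicator_of_notMem (by simpa using (le_of_lt hy)) _
      exact continuousAt_const.congr this.symm
    · have : g b =ᶠ[nhds x] fun x : ℝ => (x : ℂ) ^ (b - 1) * Complex.exp (-((1 : ℂ) * x)) := by
        filter_upwards [Ioi_mem_nhds hx] with y hy
        exact Set.indicator_of_mem hy _
      refine ContinuousAt.congr ?_ this.symm
      refine ContinuousAt.mul ?_ (by fun_prop)
      exact ContinuousAt.cpow (by fun_prop) continuousAt_const (Or.inl (by simpa using hx))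
  have mult : ∫ w, 𝓕 (g a) w * 𝓕⁻ (g b) w = ∫ x, g a x * 𝓕 (𝓕⁻ (g b)) x := by
    simpa using! (VectorFourier.integral_fourierIntegral_smul_eq_flip (L := innerₗ ℝ)
      Real.continuous_fourierChar continuous_inner (gi a (by linarith)) iFi)
  have lhs : ∫ w, 𝓕 (g a) w * 𝓕⁻ (g b) w =
      Complex.Gamma a * Complex.Gamma b * ((2 * Real.pi : ℝ) : ℂ)⁻¹ * ∫ t, G a b t := by
    have h1 : ∀ w : ℝ, 𝓕 (g a) w * 𝓕⁻ (g b) w =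
        Complex.Gamma a * Complex.Gamma b * G a b (2 * Real.pi * w) := by
      intro w
      rw [gF a (by linarith), gFi]
      simp only [G]
      ring
    simp_rw [h1]
    rw [integral_const_mul, Measure.integral_comp_mul_left (G a b) (2 * Real.pi),
      abs_of_pos (by positivity), Complex.real_smul]
    push_cast
    ring
  have rhs : ∫ x, g a x * 𝓕 (𝓕⁻ (g b)) x =
      (2 : ℂ) ^ (-(a + b - 1)) * Complex.Gamma (a + b - 1) := by
    rw [← laplace (a + b - 1) (by simp; linarith) 2 (by simp),
      ← integral_indicator measurableSet_Ioi]
    apply integral_congr_ae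
    filter_upwards [Measure.ae_ne volume (0 : ℝ)] with x hx
    rw [inv x hx]
    by_cases hx' : x ∈ Set.Ioi (0 : ℝ)
    · simp only [g, Set.indicator_of_mem hx']
      rw [show a + b - 1 - 1 = (a - 1) + (b - 1) by ring,
        Complex.cpow_add _ _ (Complex.ofReal_ne_zero.mpr hx),
        show -((2 : ℂ) * x) = -(1 * x) + -(1 * x) by ring, Complex.exp_add]
      ring
    · simp only [g, Set.indicator_of_notMem hx', zero_mul]
  rw [lhs, rhs] at mult
  have na : Complex.Gamma a ≠ 0 := Complex.Gamma_ne_zero_of_re_pos (by linarith)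
  have nb : Complex.Gamma b ≠ 0 := Complex.Gamma_ne_zero_of_re_pos (by linarith)
  have np : (Real.pi : ℂ) ≠ 0 := Complex.ofReal_ne_zero.mpr Real.pi_ne_zero
  unfold R
  rw [show 2 - (a + b) = -(a + b - 1) + 1 by ring, cpow_add_one' _ _ two_ne_zero]
  push_cast at mult
  field_simp at mult ⊢
  linear_combination mult

lemma general (a b : ℂ) (h : 1 < (a + b).re) : ∫ t, G a b t = R a b := by
  obtain ⟨n, hn⟩ := exists_nat_gt (1 - a.re)
  obtain ⟨k, hk⟩ := exists_nat_gt (1 - b.re)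
  apply back_n n a b h
  rw [symm_G, R_symm]
  apply back_n k
  · have : (0 : ℝ) ≤ n := n.cast_nonneg
    simp at h ⊢; linarith
  rw [symm_G, R_symm]
  apply base
  · simp; linarith
  · simp; linarith

/-- For `Re z > 1/2` and `m ∈ ℂ`, the integral `∫ℝ (1+it)^{m−z}(1−it)^{−m−z} dt` converges and
equals `Q(z,m)`. -/
theorem stmt_6 (z m : ℂ) (hz : 1 / 2 < z.re) :
    Integrable (fun t : ℝ => (1 + Complex.I * t) ^ (m - z) * (1 - Complex.I * t) ^ (-m - z)) ∧
      ∫ t : ℝ, (1 + Complex.I * t) ^ (m - z) * (1 - Complex.I * t) ^ (-m - z) = Qf z m := by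
  have e : (fun t : ℝ => (1 + Complex.I * t) ^ (m - z) * (1 - Complex.I * t) ^ (-m - z)) =
      G (z - m) (z + m) := by
    ext t
    simp only [G]
    congr 2 <;> ring
  have h : 1 < ((z - m) + (z + m)).re := by simp; linarith
  rw [e]
  refine ⟨integrable_G _ _ h, ?_⟩
  rw [general _ _ h]
  unfold R Qf
  rw [show z - m + (z + m) = 2 * z by ring, div_eq_mul_inv, mul_inv]
  ring

end

end Stmt6
end

section
/- For every z ∈ ℂ with Re z > 1/2 and every m ∈ ℂ, the integral ∫₀¹ x^{z−1} · (x(1−x))^{−1/2} · cos(2m·arcsin(√(1−x))) dx converges and equals Q(z,m) = π · 2^{2−2z} · Γ(2z−1) / (Γ(z+m) · Γ(z−m)). -/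
namespace Stmt7

noncomputable section

open MeasureTheory

/-- `Q(z,m) = π·2^{2−2z}·Γ(2z−1)/(Γ(z+m)·Γ(z−m))`. -/
def Qf (z m : ℂ) : ℂ :=
  (Real.pi : ℂ) * (2 : ℂ) ^ ((2 : ℂ) - 2 * z) * Complex.Gamma (2 * z - 1) /
    (Complex.Gamma (z + m) * Complex.Gamma (z - m))

/-- integrand in beta form -/
def ff (z m : ℂ) (x : ℝ) : ℂ :=
  (x : ℂ) ^ (z - 1 / 2 - 1) * (1 - (x : ℂ)) ^ ((1 / 2 : ℂ) - 1) *
    Complex.cos (2 * m * (Real.arcsin (Real.sqrt (1 - x)) : ℂ))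

/-- its integral -/
def FF (z m : ℂ) : ℂ := ∫ x in (0 : ℝ)..1, ff z m x

lemma ff_int (z m : ℂ) (hz : 1 / 2 < z.re) : IntervalIntegrable (ff z m) volume 0 1 := by
  unfold ff
  apply IntervalIntegrable.mul_continuousOn
  · apply Complex.betaIntegral_convergent
    · simp; norm_num at hz; linarith
    · norm_num
  · apply Continuous.continuousOn
    have := Real.continuous_arcsin
    fun_prop

lemma FF_zero (z : ℂ) : FF z 0 = Complex.betaIntegral (z - 1 / 2) (1 / 2) := by
  simp [FF, ff, Complex.betaIntegral]

lemma half_re (z : ℂ) (hz : 1 / 2 < z.re) : 0 < (z - 1 / 2).re := by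
  simp; norm_num at hz; linarith

lemma FF_zero_Gamma (z : ℂ) (hz : 1 / 2 < z.re) :
    FF z 0 = Complex.Gamma (z - 1 / 2) * Complex.Gamma (1 / 2) / Complex.Gamma z := by
  rw [FF_zero, Complex.betaIntegral_eq_Gamma_mul_div _ _ (half_re z hz) (by norm_num)]
  congr 2; ring

lemma FF_zero_ne (z : ℂ) (hz : 1 / 2 < z.re) : FF z 0 ≠ 0 := by
  rw [FF_zero_Gamma z hz]
  refine div_ne_zero (mul_ne_zero ?_ ?_) ?_
  · exact Complex.Gamma_ne_zero_of_re_pos (half_re z hz)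
  · exact Complex.Gamma_ne_zero_of_re_pos (by norm_num)
  · exact Complex.Gamma_ne_zero_of_re_pos (by linarith)

lemma ff_eq (z m : ℂ) (x : ℝ) (hx : x ∈ Set.Ioo (0 : ℝ) 1) :
    Complex.exp ((z - 1) * Real.log x) *
          (((x * (1 - x)) ^ (-(1 / 2 : ℝ)) : ℝ) : ℂ) *
          Complex.cos (2 * m * (Real.arcsin (Real.sqrt (1 - x)) : ℂ)) = ff z m x := by
  obtain ⟨h0, h1⟩ := hx
  unfold ff
  congr 1
  have hx0 : (x : ℂ) ≠ 0 := by exact_mod_cast h0.ne'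
  have e1 : Complex.exp ((z - 1) * Real.log x) = (x : ℂ) ^ (z - 1) := by
    rw [Complex.cpow_def_of_ne_zero hx0, Complex.ofReal_log h0.le, mul_comm]
  rw [e1, Real.mul_rpow h0.le (by linarith)]
  rw [Complex.ofReal_mul, Complex.ofReal_cpow h0.le, Complex.ofReal_cpow (by linarith), ← mul_assoc,
    ← Complex.cpow_add _ _ hx0]
  push_cast
  congr 2
  · ring
  · ring

lemma rec_m (z m : ℂ) (hz : 1 / 2 < z.re) :
    (z ^ 2 - m ^ 2) * FF (z + 1) m = z * (z - 1 / 2) * FF z m := by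
  have hz1 : 1 / 2 < (z + 1).re := by simp; norm_num at hz; linarith
  have hzn : z ≠ 0 := by rintro rfl; norm_num at hz
  have hzh : z - 1 / 2 ≠ 0 := by
    intro h; have := half_re z hz; rw [h] at this; simp at this
  have key := intervalIntegral.integral_eq_sub_of_hasDerivAt_of_le (a := 0) (b := 1)
    (f := fun x : ℝ => -2 * z * ((x : ℂ) ^ (z - 1 / 2) * ((Real.sqrt (1 - x) : ℝ) : ℂ) *
        Complex.cos (2 * m * (Real.arcsin (Real.sqrt (1 - x)) : ℂ))) +
        2 * m * ((x : ℂ) ^ z * Complex.sin (2 * m * (Real.arcsin (Real.sqrt (1 - x)) : ℂ))))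
    (f' := fun x => 2 * (z ^ 2 - m ^ 2) * ff (z + 1) m x - 2 * z * (z - 1 / 2) * ff z m x)
    zero_le_one ?_ ?_ ?_
  · rw [intervalIntegral.integral_sub ((ff_int _ _ hz1).const_mul _) ((ff_int _ _ hz).const_mul _),
      intervalIntegral.integral_const_mul, intervalIntegral.integral_const_mul] at key
    simp only [Complex.ofReal_zero, Complex.ofReal_one, Complex.zero_cpow hzn,
      Complex.zero_cpow hzh, sub_self, Real.sqrt_zero, Real.arcsin_zero, mul_zero, Complex.sin_zero,
      zero_mul, add_zero] at key
    change 2 * (z ^ 2 - m ^ 2) * FF (z + 1) m - 2 * z * (z - 1 / 2) * FF z m = 0 at key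
    linear_combination key / 2
  · have c1 : Continuous (fun x : ℝ => (x : ℂ) ^ (z - 1 / 2)) :=
      continuous_iff_continuousAt.2 fun x =>
        Complex.continuousAt_ofReal_cpow_const x _ (Or.inl (half_re z hz))
    have c2 : Continuous (fun x : ℝ => (x : ℂ) ^ z) :=
      continuous_iff_continuousAt.2 fun x =>
        Complex.continuousAt_ofReal_cpow_const x _ (Or.inl (by linarith))
    have := Real.continuous_arcsin
    apply Continuous.continuousOn
    fun_prop
  · rintro x ⟨h0, h1⟩
    have hx0 : (x : ℂ) ≠ 0 := by exact_mod_cast h0.ne'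
    have hS : 0 < Real.sqrt (1 - x) := Real.sqrt_pos.2 (by linarith)
    have hr : 0 < Real.sqrt x := Real.sqrt_pos.2 h0
    have hS2 : Real.sqrt (1 - x) ^ 2 = 1 - x := Real.sq_sqrt (by linarith)
    have hr2 : Real.sqrt x ^ 2 = x := Real.sq_sqrt h0.le
    have hS1 : Real.sqrt (1 - x) < 1 := by nlinarith
    have dA := hasDerivAt_ofReal_cpow_const h0.ne' hzh
    have dX := hasDerivAt_ofReal_cpow_const h0.ne' hzn
    have dS0 : HasDerivAt (fun y : ℝ => Real.sqrt (1 - y)) (-1 / (2 * Real.sqrt (1 - x))) x := by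
      have := ((hasDerivAt_id x).const_sub 1).sqrt (by simp; linarith)
      simpa using this
    have dS := dS0.ofReal_comp
    have dT0 := (Real.hasDerivAt_arcsin (by linarith) hS1.ne).comp x dS0
    rw [hS2, sub_sub_cancel] at dT0
    have dT := (dT0.ofReal_comp).const_mul (2 * m)
    have dC := (Complex.hasDerivAt_cos _).comp x dT
    have dN := (Complex.hasDerivAt_sin _).comp x dT
    have := (((dA.mul dS).mul dC).const_mul (-2 * z)).add ((dX.mul dN).const_mul (2 * m))
    refine HasDerivAt.congr_deriv (this.congr_of_eventuallyEq (Filter.Eventually.of_forall ?_)) ?_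
    · intro y; rfl
    · have eA : (x : ℂ) ^ (z - 1 / 2) = (x : ℂ) ^ (z - 1 / 2 - 1) * x := by
        rw [Complex.cpow_sub _ 1 hx0, Complex.cpow_one, div_mul_cancel₀ _ hx0]
      have er : (x : ℂ) ^ (1 / 2 : ℂ) = (Real.sqrt x : ℂ) := by
        rw [Real.sqrt_eq_rpow, Complex.ofReal_cpow h0.le]; norm_num
      have eS : (1 - (x : ℂ)) ^ ((1 / 2 : ℂ) - 1) = 1 / (Real.sqrt (1 - x) : ℂ) := by
        have e5 : (1 / 2 : ℂ) - 1 = -(1 / 2) := by norm_num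
        rw [e5, Complex.cpow_neg, Real.sqrt_eq_rpow, Complex.ofReal_cpow (by linarith)]
        push_cast
        simp
      have eX1 : (x : ℂ) ^ (z - 1) = (x : ℂ) ^ (z - 1 / 2 - 1) * (Real.sqrt x : ℂ) := by
        rw [← er, ← Complex.cpow_add _ _ hx0]; congr 1; ring
      have eX : (x : ℂ) ^ z = (x : ℂ) ^ (z - 1 / 2 - 1) * x * (Real.sqrt x : ℂ) := by
        rw [← eA, ← er, ← Complex.cpow_add _ _ hx0]; congr 1; ring
      have eF : (x : ℂ) ^ (z + 1 - 1 / 2 - 1) = (x : ℂ) ^ (z - 1 / 2 - 1) * x := by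
        rw [← eA]; congr 1; ring
      have hSc : ((Real.sqrt (1 - x) : ℝ) : ℂ) ≠ 0 := by exact_mod_cast hS.ne'
      have hrc : ((Real.sqrt x : ℝ) : ℂ) ≠ 0 := by exact_mod_cast hr.ne'
      have hS2c : ((Real.sqrt (1 - x) : ℝ) : ℂ) ^ 2 = 1 - x := by exact_mod_cast hS2
      have hr2c : ((Real.sqrt x : ℝ) : ℂ) ^ 2 = x := by exact_mod_cast hr2
      simp only [ff, Function.comp, Pi.mul_apply, eF, eS, eA, eX1, eX]
      push_cast
      generalize (x : ℂ) ^ (z - 1 / 2 - 1) = P at *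
      generalize Complex.cos (2 * m * ↑(Real.arcsin √(1 - x))) = c
      generalize Complex.sin (2 * m * ↑(Real.arcsin √(1 - x))) = s
      generalize ((Real.sqrt (1 - x) : ℝ) : ℂ) = S at *
      generalize ((Real.sqrt x : ℝ) : ℂ) = r at *
      generalize (x : ℂ) = y at *
      subst hr2c
      field_simp
      linear_combination (-2 * P * z * (z - 1 / 2) * c) * hS2c
  · exact ((ff_int _ _ hz1).const_mul _).sub ((ff_int _ _ hz).const_mul _)

lemma rec_0 (z : ℂ) (hz : 1 / 2 < z.re) : z * FF (z + 1) 0 = (z - 1 / 2) * FF z 0 := by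
  have hzn : z ≠ 0 := by rintro rfl; norm_num at hz
  have := rec_m z 0 hz
  apply mul_left_cancel₀ hzn
  linear_combination this

lemma cos_bound (w : ℂ) : ‖Complex.cos w - 1‖ ≤ ‖w‖ ^ 2 * Real.exp ‖w‖ := by
  have h1 := Complex.norm_exp_sub_sum_le_norm_mul_exp (w * Complex.I) 2
  have h2 := Complex.norm_exp_sub_sum_le_norm_mul_exp (-w * Complex.I) 2
  simp only [Finset.sum_range_succ, Finset.sum_range_zero, norm_mul, norm_neg, Complex.norm_I,
    mul_one] at h1 h2
  simp only [pow_zero, Nat.factorial_zero, Nat.factorial_one, Nat.cast_one, div_one, pow_one,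
    zero_add] at h1 h2
  have e : Complex.cos w - 1 = ((Complex.exp (w * Complex.I) - (1 + w * Complex.I)) +
      (Complex.exp (-w * Complex.I) - (1 + -w * Complex.I))) / 2 := by
    rw [Complex.cos]; ring
  rw [e, norm_div]
  have h3 := norm_add_le (Complex.exp (w * Complex.I) - (1 + w * Complex.I))
    (Complex.exp (-w * Complex.I) - (1 + -w * Complex.I))
  simp only [Complex.norm_ofNat]
  linarith

lemma cos_bound' (m : ℂ) : ∃ C : ℝ, 0 ≤ C ∧ ∀ x ∈ Set.Ioo (0 : ℝ) 1,
    ‖Complex.cos (2 * m * (Real.arcsin (Real.sqrt (1 - x)) : ℂ)) - 1‖ ≤ C * (1 - x) := by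
  refine ⟨(‖2 * m‖ * (Real.pi / 2)) ^ 2 * Real.exp (‖2 * m‖ * (Real.pi / 2)), by positivity, ?_⟩
  rintro x ⟨h0, h1⟩
  set t := Real.arcsin (Real.sqrt (1 - x)) with ht
  have hS2 : Real.sqrt (1 - x) ^ 2 = 1 - x := Real.sq_sqrt (by linarith)
  have hS0 := Real.sqrt_nonneg (1 - x)
  have hS1 : Real.sqrt (1 - x) ≤ 1 := by nlinarith
  have t0 : 0 ≤ t := Real.arcsin_nonneg.2 hS0
  have t1 : t ≤ Real.pi / 2 := Real.arcsin_le_pi_div_two _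
  have hs := Real.mul_le_sin t0 t1
  rw [ht, Real.sin_arcsin (by linarith) hS1, ← ht] at hs
  have hp := Real.pi_pos
  have ht2 : t ≤ Real.pi / 2 * Real.sqrt (1 - x) := by
    calc t = Real.pi / 2 * (2 / Real.pi * t) := by field_simp
      _ ≤ _ := by gcongr
  refine (cos_bound _).trans ?_
  have hn : ‖2 * m * (t : ℂ)‖ = ‖2 * m‖ * t := by
    rw [norm_mul, Complex.norm_real, Real.norm_of_nonneg t0]
  rw [hn]
  calc (‖2 * m‖ * t) ^ 2 * Real.exp (‖2 * m‖ * t)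
      ≤ (‖2 * m‖ * (Real.pi / 2 * Real.sqrt (1 - x))) ^ 2 * Real.exp (‖2 * m‖ * (Real.pi / 2)) := by
        gcongr
    _ = _ := by rw [mul_pow ‖2 * m‖ (_ * _), mul_pow _ (Real.sqrt _), hS2]; ring

/-- comparison -/
lemma diff_bound (m : ℂ) : ∃ C : ℝ, 0 ≤ C ∧ ∀ z : ℂ, 1 / 2 < z.re →
    ‖FF z m - FF z 0‖ ≤ C * (‖FF (z.re : ℂ) 0‖ / z.re) := by
  obtain ⟨C, hC, hb⟩ := cos_bound' m
  refine ⟨C / 2, by positivity, fun z hz => ?_⟩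
  have hσ : 0 < z.re := by linarith
  have hσ' : 1 / 2 < ((z.re : ℂ)).re := by simpa using hz
  have hre := half_re _ hσ'
  set r : ℝ → ℝ := fun x => x ^ (z.re - 1 / 2 - 1) * (1 - x) ^ ((1 / 2 : ℝ)) with hr
  have hB : Complex.betaIntegral ((z.re : ℂ) - 1 / 2) (3 / 2) =
      ((∫ x in (0 : ℝ)..1, r x : ℝ) : ℂ) := by
    rw [← intervalIntegral.integral_ofReal, Complex.betaIntegral]
    apply intervalIntegral.integral_congr
    intro x hx
    rw [Set.uIcc_of_le zero_le_one] at hx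
    simp only [hr]
    rw [Complex.ofReal_mul, Complex.ofReal_cpow hx.1, Complex.ofReal_cpow (by linarith [hx.2])]
    push_cast
    norm_num
  have hri : IntervalIntegrable r volume 0 1 := by
    have h := (Complex.betaIntegral_convergent (u := (z.re : ℂ) - 1 / 2) (v := 3 / 2) hre
      (by norm_num)).norm
    refine h.congr ?_
    intro x hx
    rw [Set.uIoc_of_le zero_le_one] at hx
    have hx1 : 0 ≤ 1 - x := by linarith [hx.2]
    have e : (x : ℂ) ^ ((z.re : ℂ) - 1 / 2 - 1) * (1 - (x : ℂ)) ^ ((3 / 2 : ℂ) - 1) = (r x : ℂ) := by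
      simp only [hr]
      rw [Complex.ofReal_mul, Complex.ofReal_cpow hx.1.le, Complex.ofReal_cpow hx1]
      push_cast
      norm_num
    change ‖_‖ = _
    rw [e, Complex.norm_real, Real.norm_of_nonneg]
    exact mul_nonneg (Real.rpow_nonneg hx.1.le _) (Real.rpow_nonneg hx1 _)
  have hB2 : Complex.betaIntegral ((z.re : ℂ) - 1 / 2) (3 / 2) = FF z.re 0 / (2 * z.re) := by
    rw [FF_zero_Gamma _ hσ', Complex.betaIntegral_eq_Gamma_mul_div _ _ hre (by norm_num)]
    have hzc : (z.re : ℂ) ≠ 0 := by exact_mod_cast hσ.ne'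
    have e1 : Complex.Gamma (3 / 2) = 1 / 2 * Complex.Gamma (1 / 2) := by
      rw [← Complex.Gamma_add_one _ (by norm_num)]; norm_num
    have e2 : (z.re : ℂ) - 1 / 2 + 3 / 2 = z.re + 1 := by ring
    rw [e2, Complex.Gamma_add_one _ hzc, e1]
    field_simp
  have main : ‖FF z m - FF z 0‖ ≤ ∫ x in (0 : ℝ)..1, C * r x := by
    unfold FF
    rw [← intervalIntegral.integral_sub (ff_int z m hz) (ff_int z 0 hz)]
    apply intervalIntegral.norm_integral_le_of_norm_le zero_le_one _ (hri.const_mul C)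
    have hne : ∀ᵐ x : ℝ, x ≠ 1 := by simp [ae_iff]
    filter_upwards [hne] with x hx1 hx
    have h0 : 0 < x := hx.1
    have h1 : x < 1 := lt_of_le_of_ne hx.2 hx1
    have e : ff z m x - ff z 0 x = (x : ℂ) ^ (z - 1 / 2 - 1) * (1 - (x : ℂ)) ^ ((1 / 2 : ℂ) - 1) *
        (Complex.cos (2 * m * (Real.arcsin (Real.sqrt (1 - x)) : ℂ)) - 1) := by
      simp [ff]; ring
    have e2 : (1 - (x : ℂ)) = ((1 - x : ℝ) : ℂ) := by push_cast; rfl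
    rw [e, norm_mul, norm_mul, Complex.norm_cpow_eq_rpow_re_of_pos h0, e2,
      Complex.norm_cpow_eq_rpow_re_of_pos (by linarith)]
    have e3 : (1 - x) ^ (1 / 2 : ℝ) = (1 - x) ^ ((1 / 2 : ℂ) - 1).re * (1 - x) := by
      rw [← Real.rpow_add_one (by linarith)]; norm_num
    have e4 : (z - 1 / 2 - 1).re = z.re - 1 / 2 - 1 := by simp
    simp only [hr]
    rw [e3, e4]
    have := hb x ⟨h0, h1⟩
    have hp : 0 ≤ x ^ (z.re - 1 / 2 - 1) * (1 - x) ^ ((1 / 2 : ℂ) - 1).re :=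
      mul_nonneg (Real.rpow_nonneg h0.le _) (Real.rpow_nonneg (by linarith) _)
    calc _ ≤ x ^ (z.re - 1 / 2 - 1) * (1 - x) ^ ((1 / 2 : ℂ) - 1).re * (C * (1 - x)) := by gcongr
      _ = _ := by ring
  rw [intervalIntegral.integral_const_mul] at main
  have hle : (∫ x in (0 : ℝ)..1, r x) ≤ ‖FF z.re 0‖ / (2 * z.re) := by
    calc _ ≤ |∫ x in (0 : ℝ)..1, r x| := le_abs_self _
      _ = ‖((∫ x in (0 : ℝ)..1, r x : ℝ) : ℂ)‖ := by rw [Complex.norm_real, Real.norm_eq_abs]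
      _ = _ := by
        rw [← hB, hB2, norm_div, norm_mul, Complex.norm_real, Real.norm_of_nonneg hσ.le]; simp
  calc _ ≤ C * (‖FF z.re 0‖ / (2 * z.re)) := main.trans (by gcongr)
    _ = _ := by field_simp

lemma add_nat_re (z : ℂ) (hz : 1 / 2 < z.re) (N : ℕ) : 1 / 2 < (z + N).re := by
  simp only [Complex.add_re, Complex.natCast_re]
  have : (0 : ℝ) ≤ N := by positivity
  linarith

lemma mono_bound (z : ℂ) (hz : 1 / 2 < z.re) (N : ℕ) :
    ‖FF ((z.re : ℂ) + N) 0‖ * ‖FF z 0‖ ≤ ‖FF (z + N) 0‖ * ‖FF (z.re : ℂ) 0‖ := by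
  have hσ' : 1 / 2 < ((z.re : ℂ)).re := by simpa using hz
  induction N with
  | zero => simp [mul_comm]
  | succ N ih =>
    have hw := add_nat_re z hz N
    have hs := add_nat_re _ hσ' N
    have r1 := rec_0 _ hw
    have r2 := rec_0 _ hs
    set w := z + N with hwd
    have hwr : (z.re : ℂ) + N = (w.re : ℂ) := by simp [hwd]
    rw [hwr] at r2 ih hs
    have e1 : z + ((N + 1 : ℕ) : ℂ) = w + 1 := by push_cast; rw [hwd]; ring
    have e2 : (z.re : ℂ) + ((N + 1 : ℕ) : ℂ) = w.re + 1 := by rw [← hwr]; push_cast; ring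
    rw [e1, e2]
    have hwp : 0 < w.re := by linarith
    have n1 := congrArg norm r1
    have n2 := congrArg norm r2
    rw [norm_mul, norm_mul] at n1 n2
    have e3 : ((w.re : ℂ) - 1 / 2) = ((w.re - 1 / 2 : ℝ) : ℂ) := by push_cast; rfl
    rw [e3, Complex.norm_real, Complex.norm_real, Real.norm_of_nonneg hwp.le,
      Real.norm_of_nonneg (by linarith)] at n2
    have hk : ‖w‖ * (w.re - 1 / 2) ≤ w.re * ‖w - 1 / 2‖ := by
      have a1 : ‖w‖ ≤ ‖w - 1 / 2‖ + 1 / 2 := by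
        have := norm_add_le (w - 1 / 2) (1 / 2)
        simpa using this
      have a2 : w.re - 1 / 2 ≤ ‖w - 1 / 2‖ := by
        have := Complex.re_le_norm (w - 1 / 2)
        simpa using this
      nlinarith
    have hwn : 0 < ‖w‖ := lt_of_lt_of_le hwp (Complex.re_le_norm w)
    refine le_of_mul_le_mul_left ?_ (mul_pos hwn hwp)
    calc ‖w‖ * w.re * (‖FF (w.re + 1) 0‖ * ‖FF z 0‖)
        = ‖w‖ * (w.re * ‖FF (w.re + 1) 0‖) * ‖FF z 0‖ := by ring
      _ = (‖w‖ * (w.re - 1 / 2)) * (‖FF w.re 0‖ * ‖FF z 0‖) := by rw [n2]; ring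
      _ ≤ (w.re * ‖w - 1 / 2‖) * (‖FF w 0‖ * ‖FF (z.re : ℂ) 0‖) := by gcongr
      _ = w.re * (‖w - 1 / 2‖ * ‖FF w 0‖) * ‖FF (z.re : ℂ) 0‖ := by ring
      _ = _ := by rw [← n1]; ring

open Filter Topology

lemma ratio_tendsto (z m : ℂ) (hz : 1 / 2 < z.re) :
    Tendsto (fun N : ℕ => FF (z + N) m / FF (z + N) 0) atTop (𝓝 1) := by
  obtain ⟨C, hC, hb⟩ := diff_bound m
  have hσ' : 1 / 2 < ((z.re : ℂ)).re := by simpa using hz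
  rw [tendsto_iff_norm_sub_tendsto_zero]
  have hlim : Tendsto (fun N : ℕ => C * (‖FF (z.re : ℂ) 0‖ / ‖FF z 0‖) * (1 / (z.re + (N : ℝ))))
      atTop (𝓝 0) := by
    have : Tendsto (fun N : ℕ => z.re + (N : ℝ)) atTop atTop :=
      tendsto_atTop_add_const_left _ _ tendsto_natCast_atTop_atTop
    have := (this.inv_tendsto_atTop).const_mul (C * (‖FF (z.re : ℂ) 0‖ / ‖FF z 0‖))
    simpa using this
  refine squeeze_zero (fun _ => norm_nonneg _) (fun N => ?_) hlim
  have hw := add_nat_re z hz N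
  have h0 := FF_zero_ne _ hw
  have h00 := FF_zero_ne _ hz
  have hre : (z + N).re = z.re + N := by simp
  have hp : 0 < z.re + N := by rw [← hre]; linarith
  have b := hb _ hw
  have mb := mono_bound z hz N
  rw [hre] at b
  rw [div_sub_one h0, norm_div, div_le_iff₀ (norm_pos_iff.2 h0)]
  refine b.trans ?_
  have : ‖FF ((z.re : ℂ) + N) 0‖ ≤ ‖FF (z + N) 0‖ * ‖FF (z.re : ℂ) 0‖ / ‖FF z 0‖ := by
    rw [le_div_iff₀ (norm_pos_iff.2 h00)]; exact mb
  push_cast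
  calc _ ≤ C * ((‖FF (z + N) 0‖ * ‖FF (z.re : ℂ) 0‖ / ‖FF z 0‖) / (z.re + N)) := by gcongr
    _ = _ := by ring

lemma prod_formula (z m : ℂ) (hz : 1 / 2 < z.re) (N : ℕ) :
    FF z m / FF z 0 = (∏ k ∈ Finset.range N, ((z + m + k) * (z - m + k) / (z + k) ^ 2)) *
      (FF (z + N) m / FF (z + N) 0) := by
  induction N with
  | zero => simp
  | succ N ih =>
    rw [ih, Finset.prod_range_succ, mul_assoc]
    congr 1
    have hw := add_nat_re z hz N
    have r1 := rec_0 _ hw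
    have r2 := rec_m _ m hw
    have h0 := FF_zero_ne _ hw
    have hw1 := add_nat_re z hz (N + 1)
    have h01 := FF_zero_ne _ hw1
    have e1 : z + ((N + 1 : ℕ) : ℂ) = z + N + 1 := by push_cast; ring
    rw [e1] at h01 ⊢
    have e2 : (z + m + N) * (z - m + N) = (z + N) ^ 2 - m ^ 2 := by ring
    rw [e2]
    generalize z + (N : ℂ) = w at *
    have hwn : w ≠ 0 := by rintro rfl; norm_num at hw
    have hwh : w - 1 / 2 ≠ 0 := by
      intro h; have := half_re w hw; rw [h] at this; simp at this
    rw [div_mul_div_comm, div_eq_div_iff h0 (by positivity)]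
    apply mul_left_cancel₀ hwh
    linear_combination (-(w * FF (w+1) 0) ) * r2 + (w ^ 2 - m ^ 2) * FF (w+1) m * r1

lemma GammaSeq_inv (s : ℂ) :
    Tendsto (fun n => (Complex.GammaSeq s n)⁻¹) atTop (𝓝 (Complex.Gamma s)⁻¹) := by
  by_cases h : Complex.Gamma s = 0
  · obtain ⟨k, rfl⟩ := (Complex.Gamma_eq_zero_iff s).1 h
    rw [h, inv_zero]
    refine tendsto_const_nhds.congr' ?_
    filter_upwards [eventually_ge_atTop k] with n hn
    rw [Complex.GammaSeq, Finset.prod_eq_zero (i := k) (by simp; omega) (by simp)]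
    simp
  · exact (Complex.GammaSeq_tendsto_Gamma s).inv₀ h

lemma prod_tendsto (z m : ℂ) (hz : 1 / 2 < z.re) :
    Tendsto (fun N : ℕ => ∏ k ∈ Finset.range N, ((z + m + k) * (z - m + k) / (z + k) ^ 2)) atTop
      (𝓝 (Complex.Gamma z ^ 2 * ((Complex.Gamma (z + m))⁻¹ * (Complex.Gamma (z - m))⁻¹))) := by
  rw [← tendsto_add_atTop_iff_nat 1]
  refine (((Complex.GammaSeq_tendsto_Gamma z).pow 2).mul
    ((GammaSeq_inv (z + m)).mul (GammaSeq_inv (z - m)))).congr' ?_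
  filter_upwards [eventually_ge_atTop 1] with n hn
  have hn0 : (n : ℂ) ≠ 0 := by exact_mod_cast (by omega : n ≠ 0)
  have hf : (n.factorial : ℂ) ≠ 0 := by exact_mod_cast n.factorial_ne_zero
  have hp : ∏ j ∈ Finset.range (n + 1), (z + j) ≠ 0 := by
    rw [Finset.prod_ne_zero_iff]
    intro j _ h
    have := add_nat_re z hz j
    rw [h] at this; norm_num at this
  have h1 : (n : ℂ) ^ (z + m) = n ^ z * n ^ m := Complex.cpow_add _ _ hn0
  have h2 : (n : ℂ) ^ (z - m) = n ^ z / n ^ m := Complex.cpow_sub _ _ hn0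
  have h3 : (n : ℂ) ^ z ≠ 0 := by simp [Complex.cpow_eq_zero_iff, hn0]
  have h4 : (n : ℂ) ^ m ≠ 0 := by simp [Complex.cpow_eq_zero_iff, hn0]
  simp only [Complex.GammaSeq, Finset.prod_div_distrib, Finset.prod_mul_distrib, Finset.prod_pow,
    h1, h2, inv_div]
  field_simp

lemma FF_eq (z m : ℂ) (hz : 1 / 2 < z.re) : FF z m = Qf z m := by
  have h := ((prod_tendsto z m hz).mul (ratio_tendsto z m hz)).congr
    (fun N => (prod_formula z m hz N).symm)
  have e := tendsto_nhds_unique tendsto_const_nhds h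
  rw [div_eq_iff (FF_zero_ne z hz), FF_zero_Gamma z hz] at e
  have hG : Complex.Gamma z ≠ 0 := Complex.Gamma_ne_zero_of_re_pos (by linarith)
  have d := Complex.Gamma_mul_Gamma_add_half (z - 1 / 2)
  have e1 : z - 1 / 2 + 1 / 2 = z := by ring
  have e2 : 2 * (z - 1 / 2) = 2 * z - 1 := by ring
  have e3 : 1 - (2 * z - 1) = 2 - 2 * z := by ring
  rw [e1, e2, e3] at d
  have hh : Complex.Gamma (1 / 2) = (Real.sqrt Real.pi : ℂ) := by
    have := Complex.Gamma_one_half_eq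
    rw [this, Real.sqrt_eq_rpow, Complex.ofReal_cpow Real.pi_pos.le]; norm_num
  have hpi : (Real.sqrt Real.pi : ℂ) * Real.sqrt Real.pi = Real.pi := by
    rw [← Complex.ofReal_mul, Real.mul_self_sqrt Real.pi_pos.le]
  rw [e, Qf, hh, div_eq_mul_inv _ (Complex.Gamma z), div_eq_mul_inv _ (_ * _), mul_inv, ← hpi]
  have hc : Complex.Gamma z ^ 2 * (Complex.Gamma z)⁻¹ = Complex.Gamma z := by field_simp
  linear_combination ((Complex.Gamma (z + m))⁻¹ * (Complex.Gamma (z - m))⁻¹ * Real.sqrt Real.pi) * d +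
    (Complex.Gamma (z + m))⁻¹ * (Complex.Gamma (z - m))⁻¹ * Real.sqrt Real.pi *
      Complex.Gamma (z - 1 / 2) * hc

/-- For `Re z > 1/2` and `m ∈ ℂ`, the integral
`∫₀¹ x^{z−1}·(x(1−x))^{−1/2}·cos(2m·arcsin(√(1−x))) dx` converges and equals `Q(z,m)`. -/
theorem stmt_7 (z m : ℂ) (hz : 1 / 2 < z.re) :
    IntegrableOn
        (fun x : ℝ => Complex.exp ((z - 1) * Real.log x) *
          (((x * (1 - x)) ^ (-(1 / 2 : ℝ)) : ℝ) : ℂ) *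
          Complex.cos (2 * m * (Real.arcsin (Real.sqrt (1 - x)) : ℂ)))
        (Set.Ioo (0 : ℝ) 1) ∧
      ∫ x in Set.Ioo (0 : ℝ) 1,
          Complex.exp ((z - 1) * Real.log x) *
            (((x * (1 - x)) ^ (-(1 / 2 : ℝ)) : ℝ) : ℂ) *
            Complex.cos (2 * m * (Real.arcsin (Real.sqrt (1 - x)) : ℂ)) = Qf z m := by
  have heq : Set.EqOn (fun x : ℝ => Complex.exp ((z - 1) * Real.log x) *
          (((x * (1 - x)) ^ (-(1 / 2 : ℝ)) : ℝ) : ℂ) *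
          Complex.cos (2 * m * (Real.arcsin (Real.sqrt (1 - x)) : ℂ))) (ff z m)
        (Set.Ioo (0 : ℝ) 1) := fun x hx => ff_eq z m x hx
  constructor
  · rw [integrableOn_congr_fun heq measurableSet_Ioo]
    exact (intervalIntegrable_iff_integrableOn_Ioo_of_le zero_le_one).1 (ff_int z m hz)
  · rw [setIntegral_congr_fun measurableSet_Ioo heq, ← FF_eq z m hz, FF,
      intervalIntegral.integral_of_le zero_le_one, integral_Ioc_eq_integral_Ioo]

end

end Stmt7
end
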